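/- Boundedness and coercivity of the Landau operator linearized at nearby Maxwellians: There exist η > 0, c > 0 and C > 0 such that for every Maxwellian μ₁ = μ(ϱ₁, u₁, θ₁) with |ϱ₁ − 1| + |u₁| + |θ₁ − 1| ≤ η, the following hold for all Schwartz functions f, g : ℝ³ → ℝ: (a) | ∫_{ℝ³} (L_{μ₁} f)(v) g(v) dv | ≤ C |f|_σ |g|_σ; (b) if f is purely microscopic, i.e., ∫_{ℝ³} μ₀(v)^{1/2} f(v) (1, v₁, v₂, v₃, |v|²) dv = 0 ∈ ℝ⁵, then ∫_{ℝ³} (L_{μ₁} f)(v) f(v) dv ≥ c |f|σ². (Consequently, by the Lax–Milgram theorem, L_{μ₁} restricted to the purely microscopic subspace is boundedly invertible.) -/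

import Mathlib

noncomputable section

open MeasureTheory Real

/-- Velocity space `ℝ³`. -/
abbrev V3 : Type := EuclideanSpace ℝ (Fin 3)

/-- The Maxwellian `μ(ϱ,u,θ)(v) = ϱ (2πθ)^{-3/2} exp(−|v−u|²/(2θ))`. -/
def maxwellian (ϱ : ℝ) (u : V3) (θ : ℝ) (v : V3) : ℝ :=
  ϱ * (2 * π * θ) ^ (-(3 : ℝ) / 2) * Real.exp (-‖v - u‖ ^ 2 / (2 * θ))

/-- The standard Maxwellian `μ₀ = μ(1,0,1)`. -/
def mu0 (v : V3) : ℝ := maxwellian 1 0 1 v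

/-- The Coulomb Landau kernel `φ^{ij}(z) = (δ^{ij} − z_iz_j/|z|²)|z|⁻¹`. -/
def kerC (z : V3) (i j : Fin 3) : ℝ :=
  ((if i = j then (1 : ℝ) else 0) - z i * z j / ‖z‖ ^ 2) * ‖z‖⁻¹

/-- Partial derivative `∂_i` in `v`. -/
def pd (i : Fin 3) (g : V3 → ℝ) (v : V3) : ℝ :=
  fderiv ℝ g v (EuclideanSpace.single i 1)

/-- The Landau collision operator with Coulomb interaction. -/
def landauQ (F₁ F₂ : V3 → ℝ) (v : V3) : ℝ :=
  ∑ i, pd i (fun w => ∫ u : V3, ∑ j,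
    kerC (w - u) i j * (F₁ u * pd j F₂ w - F₂ w * pd j F₁ u)) v

/-- `√μ₀`. -/
def sqmu (v : V3) : ℝ := Real.sqrt (mu0 v)

/-- The conjugated bilinear collision operator
`Γ[g,h] = μ₀^{-1/2} Q(μ₀^{1/2}g, μ₀^{1/2}h)`. -/
def Gam (g h : V3 → ℝ) (v : V3) : ℝ :=
  (sqmu v)⁻¹ * landauQ (fun w => sqmu w * g w) (fun w => sqmu w * h w) v

/-- The Landau operator linearized at the Maxwellian `μ₁`, conjugated by `μ₀^{1/2}`:
`L_{μ₁} f = −Γ[μ₀^{-1/2}μ₁, f] − Γ[f, μ₀^{-1/2}μ₁]`. -/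
def Lmu (mu1 : V3 → ℝ) (f : V3 → ℝ) (v : V3) : ℝ :=
  -Gam (fun w => (sqmu w)⁻¹ * mu1 w) f v - Gam f (fun w => (sqmu w)⁻¹ * mu1 w) v

/-- `σ^{ij} = φ^{ij} ∗ μ₀`. -/
def sigC (v : V3) (i j : Fin 3) : ℝ := ∫ u : V3, kerC (v - u) i j * mu0 u

/-- The (unweighted) dissipation norm squared `|f|²_σ`. -/
def sNormSq (f : V3 → ℝ) : ℝ :=
  ∫ v : V3, ∑ i, ∑ j, sigC v i j * (pd i f v * pd j f v + v i * v j * (f v) ^ 2)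


/-- polynomial growth, continuous -/
def PG (f : V3 → ℝ) : Prop := Continuous f ∧ ∃ C : ℝ, ∃ k : ℕ, 0 ≤ C ∧ ∀ x, |f x| ≤ C * (1 + ‖x‖) ^ k
/-- rapid decay, continuous -/
def Dec (f : V3 → ℝ) : Prop := Continuous f ∧ ∀ k : ℕ, ∃ C : ℝ, 0 ≤ C ∧ ∀ x, (1 + ‖x‖) ^ k * |f x| ≤ C

lemma Dec.mk_of {f : V3 → ℝ} (hc : Continuous f) (h : ∀ k : ℕ, ∃ C : ℝ, ∀ x, (1 + ‖x‖) ^ k * |f x| ≤ C) : Dec f :=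
  ⟨hc, fun k => by
    obtain ⟨C, hC⟩ := h k
    exact ⟨C, le_trans (by positivity) (hC 0), hC⟩⟩

lemma PG.mul_dec {p f : V3 → ℝ} (hp : PG p) (hf : Dec f) : Dec (fun x => p x * f x) := by
  obtain ⟨hpc, C, m, hC, hb⟩ := hp
  refine Dec.mk_of (hpc.mul hf.1) fun k => ?_
  obtain ⟨D, hD, hDb⟩ := hf.2 (k + m)
  refine ⟨C * D, fun x => ?_⟩
  rw [abs_mul]
  have h1 : (1 + ‖x‖) ^ k * (|p x| * |f x|) ≤ (1 + ‖x‖) ^ k * ((C * (1 + ‖x‖) ^ m) * |f x|) := by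
    gcongr; exact hb x
  have h2 := mul_le_mul_of_nonneg_left (hDb x) hC
  calc _ ≤ _ := h1
    _ = C * ((1 + ‖x‖) ^ (k + m) * |f x|) := by ring
    _ ≤ _ := h2

lemma Dec.pg {f : V3 → ℝ} (hf : Dec f) : PG f := by
  obtain ⟨C, hC, h⟩ := hf.2 0
  exact ⟨hf.1, C, 0, hC, by simpa using h⟩

lemma Dec.mul {f g : V3 → ℝ} (hf : Dec f) (hg : Dec g) : Dec (fun x => f x * g x) := hf.pg.mul_dec hg

lemma PG.mul {p f : V3 → ℝ} (hp : PG p) (hf : PG f) : PG (fun x => p x * f x) := by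
  obtain ⟨hpc, C, m, hC, hb⟩ := hp
  obtain ⟨hfc, D, n, hD, hd⟩ := hf
  refine ⟨hpc.mul hfc, C * D, m + n, by positivity, fun x => ?_⟩
  rw [abs_mul]
  calc _ ≤ (C * (1 + ‖x‖) ^ m) * (D * (1 + ‖x‖) ^ n) := by
        gcongr; exact hb x; exact hd x
    _ = _ := by ring

lemma Dec.add {f g : V3 → ℝ} (hf : Dec f) (hg : Dec g) : Dec (fun x => f x + g x) := by
  refine Dec.mk_of (hf.1.add hg.1) fun k => ?_
  obtain ⟨C, hC, h⟩ := hf.2 k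
  obtain ⟨D, hD, h'⟩ := hg.2 k
  refine ⟨C + D, fun x => ?_⟩
  calc (1 + ‖x‖) ^ k * |f x + g x| ≤ (1 + ‖x‖) ^ k * (|f x| + |g x|) := by
        gcongr; exact abs_add_le _ _
    _ ≤ _ := by rw [mul_add]; exact add_le_add (h x) (h' x)

lemma PG.add {f g : V3 → ℝ} (hf : PG f) (hg : PG g) : PG (fun x => f x + g x) := by
  obtain ⟨hpc, C, m, hC, hb⟩ := hf
  obtain ⟨hfc, D, n, hD, hd⟩ := hg
  refine ⟨hpc.add hfc, C + D, m + n, by positivity, fun x => ?_⟩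
  have h1 : (1 + ‖x‖) ^ m ≤ (1 + ‖x‖) ^ (m + n) := pow_le_pow_right₀ (by linarith [norm_nonneg x]) (by omega)
  have h2 : (1 + ‖x‖) ^ n ≤ (1 + ‖x‖) ^ (m + n) := pow_le_pow_right₀ (by linarith [norm_nonneg x]) (by omega)
  calc _ ≤ |f x| + |g x| := abs_add_le _ _
    _ ≤ C * (1 + ‖x‖) ^ (m + n) + D * (1 + ‖x‖) ^ (m + n) := by
      refine add_le_add ((hb x).trans ?_) ((hd x).trans ?_) <;> gcongr
    _ = _ := by ring

lemma PG.const (c : ℝ) : PG (fun _ => c) := ⟨continuous_const, |c|, 0, abs_nonneg _, by simp⟩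
lemma Dec.const_mul {f : V3 → ℝ} (c : ℝ) (hf : Dec f) : Dec (fun x => c * f x) := (PG.const c).mul_dec hf
lemma Dec.mul_pg {p f : V3 → ℝ} (hf : Dec f) (hp : PG p) : Dec (fun x => f x * p x) := by
  simpa [mul_comm] using hp.mul_dec hf
lemma Dec.mul_const {f : V3 → ℝ} (c : ℝ) (hf : Dec f) : Dec (fun x => f x * c) := hf.mul_pg (PG.const c)
lemma Dec.neg {f : V3 → ℝ} (hf : Dec f) : Dec (fun x => - f x) := by
  simpa using hf.const_mul (-1)
lemma Dec.sub {f g : V3 → ℝ} (hf : Dec f) (hg : Dec g) : Dec (fun x => f x - g x) := by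
  simpa [sub_eq_add_neg] using hf.add hg.neg
lemma PG.neg {f : V3 → ℝ} (hf : PG f) : PG (fun x => - f x) := by
  simpa using (PG.const (-1)).mul hf
lemma PG.sub {f g : V3 → ℝ} (hf : PG f) (hg : PG g) : PG (fun x => f x - g x) := by
  simpa [sub_eq_add_neg] using hf.add hg.neg
lemma PG.pow {f : V3 → ℝ} (hf : PG f) (n : ℕ) : PG (fun x => f x ^ n) := by
  induction n with
  | zero => simpa using PG.const 1
  | succ n ih => simpa [pow_succ] using ih.mul hf
lemma Dec.sq {f : V3 → ℝ} (hf : Dec f) : Dec (fun x => f x ^ 2) := by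
  simpa [pow_two] using hf.mul hf
lemma Dec.zero : Dec (fun _ => 0) := Dec.mk_of continuous_const fun k => ⟨0, by simp⟩
lemma Dec.sum {ι : Type*} (s : Finset ι) {f : ι → V3 → ℝ} (hf : ∀ i, Dec (f i)) : Dec (fun x => ∑ i ∈ s, f i x) := by
  classical
  induction s using Finset.induction_on with
  | empty => simpa using Dec.zero
  | insert a s ha ih => simpa [Finset.sum_insert ha] using (hf a).add ih
lemma PG.sum {ι : Type*} (s : Finset ι) {f : ι → V3 → ℝ} (hf : ∀ i, PG (f i)) : PG (fun x => ∑ i ∈ s, f i x) := by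
  classical
  induction s using Finset.induction_on with
  | empty => simpa using PG.const 0
  | insert a s ha ih => simpa [Finset.sum_insert ha] using (hf a).add ih

lemma abs_coord_le (x : V3) (i : Fin 3) : |x i| ≤ ‖x‖ := by
  simpa using EuclideanSpace.norm_eq x ▸ PiLp.norm_apply_le x i

lemma PG.coord (i : Fin 3) : PG (fun x => x i) :=
  ⟨by fun_prop, 1, 1, by norm_num, fun x => by
    have := abs_coord_le x i; linarith⟩
lemma PG.norm : PG (fun x => ‖x‖) :=
  ⟨by fun_prop, 1, 1, by norm_num, fun x => by
    rw [abs_norm]; linarith⟩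

lemma Dec.of_le {f g : V3 → ℝ} (hf : Dec f) (hg : Continuous g) (h : ∀ x, |g x| ≤ |f x|) : Dec g := by
  refine Dec.mk_of hg fun k => ?_
  obtain ⟨C, hC, hb⟩ := hf.2 k
  refine ⟨C, fun x => le_trans ?_ (hb x)⟩
  exact mul_le_mul_of_nonneg_left (h x) (by positivity)

lemma Dec.bdd {f : V3 → ℝ} (hf : Dec f) : ∃ C, 0 ≤ C ∧ ∀ x, |f x| ≤ C := by
  obtain ⟨C, hC, h⟩ := hf.2 0
  exact ⟨C, hC, by simpa using h⟩

lemma Dec.integrable {f : V3 → ℝ} (hf : Dec f) : Integrable f := by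
  obtain ⟨C, hC, h⟩ := hf.2 4
  have hi : Integrable (fun x : V3 => C * (1 + ‖x‖) ^ (-(4:ℝ))) := by
    refine (integrable_one_add_norm ?_).const_mul C
    simp; norm_num
  refine hi.mono' hf.1.aestronglyMeasurable (Filter.Eventually.of_forall fun x => ?_)
  have h1 : (0:ℝ) < 1 + ‖x‖ := by positivity
  rw [Real.rpow_neg h1.le, show (4:ℝ) = ((4:ℕ):ℝ) by norm_num, Real.rpow_natCast, ← div_eq_mul_inv, le_div_iff₀ (by positivity), mul_comm]
  exact h x

/-- n-times differentiable with polynomial growth. -/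
def PGc : ℕ → (V3 → ℝ) → Prop
  | 0, f => PG f
  | n + 1, f => PG f ∧ Differentiable ℝ f ∧ ∀ i, PGc n (pd i f)
/-- n-times differentiable with rapid decay. -/
def Dc : ℕ → (V3 → ℝ) → Prop
  | 0, f => Dec f
  | n + 1, f => Dec f ∧ Differentiable ℝ f ∧ ∀ i, Dc n (pd i f)

lemma Dc.dec {n : ℕ} {f : V3 → ℝ} (h : Dc n f) : Dec f := by
  cases n with
  | zero => exact h
  | succ n => exact h.1
lemma PGc.pg {n : ℕ} {f : V3 → ℝ} (h : PGc n f) : PG f := by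
  cases n with
  | zero => exact h
  | succ n => exact h.1
lemma Dc.mono {n : ℕ} {f : V3 → ℝ} (h : Dc (n+1) f) : Dc n f := by
  induction n generalizing f with
  | zero => exact h.1
  | succ n ih => exact ⟨h.1, h.2.1, fun i => ih (h.2.2 i)⟩
lemma PGc.mono {n : ℕ} {f : V3 → ℝ} (h : PGc (n+1) f) : PGc n f := by
  induction n generalizing f with
  | zero => exact h.1
  | succ n ih => exact ⟨h.1, h.2.1, fun i => ih (h.2.2 i)⟩

lemma pd_add {f g : V3 → ℝ} (hf : Differentiable ℝ f) (hg : Differentiable ℝ g) (i : Fin 3) :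
    pd i (fun x => f x + g x) = fun x => pd i f x + pd i g x := by
  ext x; simp only [pd]; rw [fderiv_fun_add (hf x) (hg x)]; rfl
lemma pd_mul {f g : V3 → ℝ} (hf : Differentiable ℝ f) (hg : Differentiable ℝ g) (i : Fin 3) :
    pd i (fun x => f x * g x) = fun x => pd i f x * g x + f x * pd i g x := by
  ext x; simp only [pd]; rw [fderiv_fun_mul (hf x) (hg x)]; simp; ring
lemma pd_const (c : ℝ) (i : Fin 3) : pd i (fun _ => c) = fun _ => 0 := by
  ext x; simp [pd]
lemma pd_coord (i j : Fin 3) : pd i (fun x => x j) = fun _ => if i = j then 1 else 0 := by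
  ext x
  have : HasFDerivAt (fun x : V3 => x j) (EuclideanSpace.proj j : V3 →L[ℝ] ℝ) x :=
    (EuclideanSpace.proj j : V3 →L[ℝ] ℝ).hasFDerivAt
  simp only [pd]; rw [this.fderiv]; simp [eq_comm]
lemma pd_const_mul (f : V3 → ℝ) (c : ℝ) (i : Fin 3) :
    pd i (fun x => c * f x) = fun x => c * pd i f x := by
  ext x; simp only [pd]
  have h2 : (fun x => c * f x) = c • f := rfl
  rw [h2, fderiv_const_smul_field]
  simp

lemma Dc.add {n : ℕ} {f g : V3 → ℝ} (hf : Dc n f) (hg : Dc n g) : Dc n (fun x => f x + g x) := by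
  induction n generalizing f g with
  | zero => exact Dec.add hf hg
  | succ n ih => exact ⟨hf.1.add hg.1, hf.2.1.add hg.2.1, fun i => by
      rw [pd_add hf.2.1 hg.2.1]; exact ih (hf.2.2 i) (hg.2.2 i)⟩
lemma PGc.add {n : ℕ} {f g : V3 → ℝ} (hf : PGc n f) (hg : PGc n g) : PGc n (fun x => f x + g x) := by
  induction n generalizing f g with
  | zero => exact PG.add hf hg
  | succ n ih => exact ⟨hf.1.add hg.1, hf.2.1.add hg.2.1, fun i => by
      rw [pd_add hf.2.1 hg.2.1]; exact ih (hf.2.2 i) (hg.2.2 i)⟩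
lemma PGc.mul_dc {n : ℕ} {f g : V3 → ℝ} (hf : PGc n f) (hg : Dc n g) : Dc n (fun x => f x * g x) := by
  induction n generalizing f g with
  | zero => exact PG.mul_dec hf hg
  | succ n ih => exact ⟨hf.1.mul_dec hg.1, hf.2.1.mul hg.2.1, fun i => by
      rw [pd_mul hf.2.1 hg.2.1]; exact (ih (hf.2.2 i) hg.mono).add (ih hf.mono (hg.2.2 i))⟩
lemma PGc.mul {n : ℕ} {f g : V3 → ℝ} (hf : PGc n f) (hg : PGc n g) : PGc n (fun x => f x * g x) := by
  induction n generalizing f g with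
  | zero => exact PG.mul hf hg
  | succ n ih => exact ⟨hf.1.mul hg.1, hf.2.1.mul hg.2.1, fun i => by
      rw [pd_mul hf.2.1 hg.2.1]; exact (ih (hf.2.2 i) hg.mono).add (ih hf.mono (hg.2.2 i))⟩
lemma Dc.pgc {n : ℕ} {f : V3 → ℝ} (hf : Dc n f) : PGc n f := by
  induction n generalizing f with
  | zero => exact Dec.pg hf
  | succ n ih => exact ⟨hf.1.pg, hf.2.1, fun i => ih (hf.2.2 i)⟩
lemma Dc.mul {n : ℕ} {f g : V3 → ℝ} (hf : Dc n f) (hg : Dc n g) : Dc n (fun x => f x * g x) := hf.pgc.mul_dc hg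
lemma PGc.const {n : ℕ} (c : ℝ) : PGc n (fun _ => c) := by
  induction n generalizing c with
  | zero => exact PG.const c
  | succ n ih => exact ⟨PG.const c, by fun_prop, fun i => by rw [pd_const]; exact ih 0⟩
lemma PGc.coord {n : ℕ} (j : Fin 3) : PGc n (fun x => x j) := by
  cases n with
  | zero => exact PG.coord j
  | succ n => exact ⟨PG.coord j, by fun_prop, fun i => by rw [pd_coord]; exact PGc.const _⟩
lemma Dc.const_mul {n : ℕ} {f : V3 → ℝ} (c : ℝ) (hf : Dc n f) : Dc n (fun x => c * f x) := (PGc.const c).mul_dc hf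

lemma Dc.schwartz (n : ℕ) (f : SchwartzMap V3 ℝ) : Dc n f := by
  have hd : ∀ f : SchwartzMap V3 ℝ, Dec f := fun f => Dec.mk_of f.continuous fun k => by
    have h := fun x => SchwartzMap.one_add_le_sup_seminorm_apply (𝕜 := ℝ) (m := (k, 0)) (k := k) (n := 0) le_rfl le_rfl f x
    simp only [norm_iteratedFDeriv_zero, Real.norm_eq_abs] at h
    exact ⟨_, h⟩
  induction n generalizing f with
  | zero => exact hd f
  | succ n ih => exact ⟨hd f, f.differentiable, fun i => by
      have : pd i f = (LineDeriv.lineDerivOp (EuclideanSpace.single i (1:ℝ)) f : SchwartzMap V3 ℝ) := by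
        ext x; rw [SchwartzMap.lineDerivOp_apply_eq_fderiv]; rfl
      rw [this]; exact ih _⟩


lemma nsq (x : V3) : ‖x‖ ^ 2 = x 0 ^ 2 + x 1 ^ 2 + x 2 ^ 2 := by
  rw [EuclideanSpace.real_norm_sq_eq, Fin.sum_univ_three]

/-- auxiliary Gaussian -/
def gs (a : ℝ) (u v : V3) : ℝ := Real.exp (-a * ‖v - u‖ ^ 2)

lemma gs_pos (a : ℝ) (u v : V3) : 0 < gs a u v := Real.exp_pos _

lemma gs_hasFDerivAt (a : ℝ) (u v : V3) : HasFDerivAt (gs a u)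
    (gs a u v • ((-a) • (2 • (innerSL ℝ (v - u))))) v := by
  unfold gs
  have h1 : HasFDerivAt (fun v : V3 => v - u) (ContinuousLinearMap.id ℝ V3) v := (hasFDerivAt_id v).sub_const u
  have h2 := (h1.norm_sq).const_mul (-a)
  have h3 := h2.exp
  rw [ContinuousLinearMap.comp_id] at h3
  exact h3

lemma gs_differentiable (a : ℝ) (u : V3) : Differentiable ℝ (gs a u) :=
  fun v => (gs_hasFDerivAt a u v).differentiableAt

lemma pd_gs (a : ℝ) (u : V3) (i : Fin 3) : pd i (gs a u) = fun v => (-2 * a * v i + 2 * a * u i) * gs a u v := by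
  ext v
  simp only [pd]; rw [(gs_hasFDerivAt a u v).fderiv]
  simp [EuclideanSpace.inner_single_right]
  ring

lemma exp_poly_bdd {a : ℝ} (ha : 0 < a) (k : ℕ) : ∃ C, 0 ≤ C ∧ ∀ r : ℝ, 0 ≤ r → (1 + r) ^ k * Real.exp (-a * r ^ 2) ≤ C := by
  refine ⟨k.factorial * Real.exp (1 + 1 / (4 * a)), by positivity, fun r hr => ?_⟩
  have h := Real.pow_div_factorial_le_exp (1 + r) (by linarith) k
  rw [div_le_iff₀ (by positivity)] at h
  calc _ ≤ (Real.exp (1 + r) * k.factorial) * Real.exp (-a * r ^ 2) := by gcongr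
    _ = k.factorial * (Real.exp (1 + r + -a * r ^ 2)) := by rw [Real.exp_add (1 + r)]; ring
    _ ≤ _ := by
      refine mul_le_mul_of_nonneg_left (Real.exp_le_exp.2 ?_) (by positivity)
      have : 1 / (4 * a) - (r + -a * r ^ 2) = (2 * a * r - 1) ^ 2 / (4 * a) := by field_simp; ring
      have h2 : 0 ≤ (2 * a * r - 1) ^ 2 / (4 * a) := by positivity
      linarith

lemma gs_dec {a : ℝ} (ha : 0 < a) (u : V3) : Dec (gs a u) := by
  refine Dec.mk_of (gs_differentiable a u).continuous fun k => ?_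
  obtain ⟨C, hC, h⟩ := exp_poly_bdd ha k
  refine ⟨(1 + ‖u‖) ^ k * C, fun x => ?_⟩
  rw [abs_of_pos (gs_pos _ _ _)]
  have h1 : 1 + ‖x‖ ≤ (1 + ‖u‖) * (1 + ‖x - u‖) := by
    have : ‖x‖ ≤ ‖x - u‖ + ‖u‖ := by simpa using norm_add_le (x - u) u
    nlinarith [norm_nonneg u, norm_nonneg (x - u), mul_nonneg (norm_nonneg u) (norm_nonneg (x - u))]
  calc _ ≤ ((1 + ‖u‖) * (1 + ‖x - u‖)) ^ k * gs a u x := by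
        have := (gs_pos a u x).le
        gcongr
    _ = (1 + ‖u‖) ^ k * ((1 + ‖x - u‖) ^ k * gs a u x) := by rw [mul_pow]; ring
    _ ≤ _ := by gcongr; exact h _ (norm_nonneg _)

lemma gs_dc (n : ℕ) {a : ℝ} (ha : 0 < a) (u : V3) : Dc n (gs a u) := by
  induction n with
  | zero => exact gs_dec ha u
  | succ n ih => exact ⟨gs_dec ha u, gs_differentiable a u, fun i => by
      rw [pd_gs]
      exact PGc.mul_dc (((PGc.const (-2 * a)).mul (PGc.coord i)).add (PGc.const _)) ih⟩

lemma maxwellian_eq (ϱ : ℝ) (u : V3) (θ : ℝ) : maxwellian ϱ u θ = fun v => (ϱ * (2 * π * θ) ^ (-(3 : ℝ) / 2)) * gs (1 / (2 * θ)) u v := by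
  ext v; unfold maxwellian gs; congr 2
  ring

/-- normalisation constant of `μ₀`. -/
def c0 : ℝ := (2 * π) ^ (-(3 : ℝ) / 2)
lemma c0_pos : 0 < c0 := by unfold c0; positivity
lemma mu0_eq : mu0 = fun v => c0 * gs (1 / 2) 0 v := by
  ext v; unfold mu0; rw [maxwellian_eq]; simp [c0]
lemma sqmu_eq : sqmu = fun v => √c0 * gs (1 / 4) 0 v := by
  ext v; unfold sqmu; rw [mu0_eq]
  rw [Real.sqrt_mul c0_pos.le]
  congr 1
  rw [Real.sqrt_eq_iff_mul_self_eq (gs_pos _ _ _).le (gs_pos _ _ _).le]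
  unfold gs; rw [← Real.exp_add]; congr 1; ring
lemma mu0_pos (v : V3) : 0 < mu0 v := by rw [mu0_eq]; exact mul_pos c0_pos (gs_pos _ _ _)
lemma sqmu_pos (v : V3) : 0 < sqmu v := Real.sqrt_pos.2 (mu0_pos v)
lemma sqmu_sq (v : V3) : sqmu v * sqmu v = mu0 v := Real.mul_self_sqrt (mu0_pos v).le
lemma sqmu_dc (n : ℕ) : Dc n sqmu := by
  rw [sqmu_eq]; exact (gs_dc n (by norm_num) 0).const_mul _
lemma mu0_dc (n : ℕ) : Dc n mu0 := by
  rw [mu0_eq]; exact (gs_dc n (by norm_num) 0).const_mul _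
lemma maxwellian_dc (n : ℕ) (ϱ : ℝ) (u : V3) {θ : ℝ} (h : 0 < θ) : Dc n (maxwellian ϱ u θ) := by
  rw [maxwellian_eq]; exact (gs_dc n (by positivity) u).const_mul _
lemma pd_sqmu (i : Fin 3) : pd i sqmu = fun v => -(v i / 2) * sqmu v := by
  rw [sqmu_eq, pd_const_mul, pd_gs]; ext v; simp; ring
lemma pd_mu0 (i : Fin 3) : pd i mu0 = fun v => -(v i) * mu0 v := by
  rw [mu0_eq, pd_const_mul, pd_gs]; ext v; simp; ring
lemma pd_maxwellian (ϱ : ℝ) (u : V3) {θ : ℝ} (h : 0 < θ) (i : Fin 3) :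
    pd i (maxwellian ϱ u θ) = fun v => -((v i - u i) / θ) * maxwellian ϱ u θ v := by
  rw [maxwellian_eq, pd_const_mul, pd_gs]; ext v; field_simp; ring

/-- `μ₁ / √μ₀` -/
def mq (ϱ : ℝ) (u : V3) (θ : ℝ) (v : V3) : ℝ := (sqmu v)⁻¹ * maxwellian ϱ u θ v
lemma mq_dc (n : ℕ) (ϱ : ℝ) (u : V3) {θ : ℝ} (h : 0 < θ) (h2 : θ < 2) : Dc n (mq ϱ u θ) := by
  set b : ℝ := 1 / (2 * θ) - 1 / 4 with hb
  have hbp : 0 < b := by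
    rw [hb]; rw [sub_pos]; apply one_div_lt_one_div_of_lt <;> linarith
  obtain ⟨K, hK⟩ : ∃ K : ℝ, mq ϱ u θ = fun v => K * gs b ((1 / (2 * θ * b)) • u) v := by
    refine ⟨(√c0)⁻¹ * (ϱ * (2 * π * θ) ^ (-(3 : ℝ) / 2)) * Real.exp (b * ‖(1 / (2 * θ * b)) • u‖ ^ 2 - 1 / (2 * θ) * ‖u‖ ^ 2), ?_⟩
    ext v
    unfold mq; rw [maxwellian_eq, sqmu_eq]; unfold gs
    have e : -(1 / (2 * θ)) * ‖v - u‖ ^ 2 = (-(1/4) * ‖v - 0‖ ^ 2) + ((b * ‖(1 / (2 * θ * b)) • u‖ ^ 2 - 1 / (2 * θ) * ‖u‖ ^ 2) + -b * ‖v - (1 / (2 * θ * b)) • u‖ ^ 2) := by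
      simp only [nsq, PiLp.sub_apply, PiLp.smul_apply, smul_eq_mul, PiLp.zero_apply]
      have e1 : ∀ x y : ℝ, b * (1 / (2 * θ * b) * y)^2 + -b * (x - 1 / (2 * θ * b) * y)^2 = - b * x ^ 2 + 1 / θ * x * y := by
        intro x y; field_simp; ring
      have := e1 (v 0) (u 0)
      have := e1 (v 1) (u 1)
      have := e1 (v 2) (u 2)
      have e2 : 1 / θ = 2 * (1 / (2 * θ)) := by field_simp
      have e3 : b = 1 / (2 * θ) - 1 / 4 := hb
      have e4 : ∀ x y : ℝ, -(1 / (2 * θ)) * (x - y) ^ 2 = -(1/4) * x ^2 + (- b * x ^ 2 + 1 / θ * x * y) - 1 / (2 * θ) * y ^ 2 := by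
        intro x y; rw [e2, e3]; ring
      have := e4 (v 0) (u 0)
      have := e4 (v 1) (u 1)
      have := e4 (v 2) (u 2)
      linarith
    simp only []
    rw [e, Real.exp_add, Real.exp_add]
    have := c0_pos
    field_simp
  rw [hK]; exact (gs_dc n hbp _).const_mul _
lemma sqmu_mul_mq (ϱ : ℝ) (u : V3) (θ : ℝ) (v : V3) : sqmu v * mq ϱ u θ v = maxwellian ϱ u θ v := by
  unfold mq; field_simp [(sqmu_pos v).ne']

/-- Integration by parts. -/
lemma ibp {K g : V3 → ℝ} (i : Fin 3) (hK : Differentiable ℝ K) (hg : Dc 1 g) {C : ℝ} (k : ℕ) 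
    (h1 : ∀ x, |K x| ≤ C * (1 + ‖x‖) ^ k) (h2 : ∀ x, |pd i K x| ≤ C * (1 + ‖x‖) ^ k) :
    Integrable (fun x => pd i K x * g x) ∧ Integrable (fun x => K x * pd i g x) ∧
    ∫ x, pd i K x * g x = - ∫ x, K x * pd i g x := by
  have hP : PG (fun x => C * (1 + ‖x‖) ^ k) := (PG.const C).mul (((PG.const 1).add PG.norm).pow k)
  have key : ∀ (p q : V3 → ℝ), AEStronglyMeasurable p volume → (∀ x, |p x| ≤ C * (1 + ‖x‖) ^ k) → Dec q → Integrable (fun x => p x * q x) := by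
    intro p q hp hb hq
    refine (hP.mul_dec hq).integrable.norm.mono' (hp.mul hq.1.aestronglyMeasurable) (Filter.Eventually.of_forall fun x => ?_)
    simp only [norm_mul, Real.norm_eq_abs]
    rw [← abs_mul, abs_mul]
    exact mul_le_mul_of_nonneg_right ((hb x).trans (le_trans (le_abs_self _) (by simp [abs_mul]))) (abs_nonneg _)
  have m1 : AEStronglyMeasurable (pd i K) volume := (measurable_fderiv_apply_const ℝ K _).aestronglyMeasurable
  have i1 := key _ _ m1 h2 hg.1
  have i2 := key _ _ hK.continuous.aestronglyMeasurable h1 (hg.2.2 i).dec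
  have i3 := key _ _ hK.continuous.aestronglyMeasurable h1 hg.1
  refine ⟨i1, i2, ?_⟩
  have := integral_mul_fderiv_eq_neg_fderiv_mul_of_integrable (μ := (volume : Measure V3)) (f := K) (g := g) (v := EuclideanSpace.single i 1) i1 i2 i3 (fun x _ => hK x) (fun x _ => hg.2.1 x)
  simp only [pd]
  rw [this, neg_neg]

lemma ibp_pg {K g : V3 → ℝ} (i : Fin 3) (hK : PGc 1 K) (hg : Dc 1 g) :
    ∫ x, pd i K x * g x = - ∫ x, K x * pd i g x := by
  obtain ⟨⟨hc, C, k, hC, hb⟩, hd, hp⟩ := hK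
  obtain ⟨_, C', k', hC', hb'⟩ := hp i
  refine (ibp i hd hg (C := C + C') (k + k') ?_ ?_).2.2
  · intro x
    have h1 : (1 + ‖x‖) ^ k ≤ (1 + ‖x‖) ^ (k + k') := pow_le_pow_right₀ (by linarith [norm_nonneg x]) (by omega)
    refine (hb x).trans ?_
    have : (0:ℝ) ≤ (1 + ‖x‖) ^ k := by positivity
    nlinarith
  · intro x
    have h1 : (1 + ‖x‖) ^ k' ≤ (1 + ‖x‖) ^ (k + k') := pow_le_pow_right₀ (by linarith [norm_nonneg x]) (by omega)
    refine (hb' x).trans ?_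
    have : (0:ℝ) ≤ (1 + ‖x‖) ^ k' := by positivity
    nlinarith

lemma integral_pd (i : Fin 3) {g : V3 → ℝ} (hg : Dc 1 g) : ∫ x, pd i g x = 0 := by
  have := ibp_pg i (PGc.const 1) hg
  rw [pd_const] at this
  simp at this
  exact this

lemma integral_mu0 : ∫ v, mu0 v = 1 := by
  rw [mu0_eq, integral_const_mul]
  unfold gs
  simp only [sub_zero]
  rw [GaussianFourier.integral_rexp_neg_mul_sq_norm (by norm_num)]
  simp only [c0, finrank_euclideanSpace, Fintype.card_fin]
  rw [show π / (1/2) = 2 * π by ring, ← Real.rpow_add (by positivity)]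
  norm_num
lemma integral_mu0_coord (i : Fin 3) : ∫ v, v i * mu0 v = 0 := by
  have := integral_pd i (mu0_dc 1)
  rw [pd_mu0] at this
  simp only [neg_mul, integral_neg] at this
  linarith
lemma integral_mu0_coord2 (i j : Fin 3) : ∫ v, v i * v j * mu0 v = if i = j then 1 else 0 := by
  have := ibp_pg i (PGc.coord j) (mu0_dc 1)
  rw [pd_mu0, pd_coord, integral_const_mul, integral_mu0, ← integral_neg] at this
  rw [mul_one] at this
  rw [this]
  congr 1; ext v; ring


/-- squared cross product -/
def cr (z : V3) (ξ : Fin 3 → ℝ) : ℝ :=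
  (z 0 * ξ 1 - z 1 * ξ 0) ^ 2 + (z 0 * ξ 2 - z 2 * ξ 0) ^ 2 + (z 1 * ξ 2 - z 2 * ξ 1) ^ 2
/-- kernel as bilinear form -/
def kq (z : V3) (ξ η : Fin 3 → ℝ) : ℝ := ∑ i, ∑ j, kerC z i j * (ξ i * η j)
/-- squared length -/
def sq3 (ξ : Fin 3 → ℝ) : ℝ := ξ 0 ^ 2 + ξ 1 ^ 2 + ξ 2 ^ 2

lemma cr_nonneg (z : V3) (ξ) : 0 ≤ cr z ξ := by unfold cr; positivity
lemma sq3_nonneg (ξ) : 0 ≤ sq3 ξ := by unfold sq3; positivity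

lemma kerC_symm (z : V3) (i j) : kerC z i j = kerC z j i := by
  unfold kerC; congr 1; rw [mul_comm (z i)]; simp [eq_comm]
lemma kerC_neg (z : V3) (i j) : kerC (-z) i j = kerC z i j := by
  unfold kerC; simp
lemma kerC_sub (v u : V3) (i j) : kerC (v - u) i j = kerC (u - v) i j := by
  rw [← kerC_neg, neg_sub]
lemma kerC_meas (i j) : Measurable (fun z => kerC z i j) := by
  unfold kerC; fun_prop
lemma kerC_abs (z : V3) (i j) : |kerC z i j| ≤ 2 * ‖z‖⁻¹ := by
  unfold kerC
  rw [abs_mul, abs_of_nonneg (inv_nonneg.2 (norm_nonneg z))]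
  gcongr
  have h1 : |z i * z j / ‖z‖ ^ 2| ≤ 1 := by
    rw [abs_div, abs_mul, abs_of_nonneg (sq_nonneg ‖z‖)]
    apply div_le_one_of_le₀ _ (by positivity)
    rw [pow_two]
    exact mul_le_mul (abs_coord_le z i) (abs_coord_le z j) (abs_nonneg _) (norm_nonneg _)
  have h2 : |if i = j then (1:ℝ) else 0| ≤ 1 := by split_ifs <;> simp
  exact (abs_sub _ _).trans (by linarith)

lemma kq_self (z : V3) (ξ) : kq z ξ ξ = ‖z‖⁻¹ ^ 3 * cr z ξ := by
  by_cases hz : z = 0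
  · subst hz; simp [kq, kerC]
  have hn : ‖z‖ ≠ 0 := norm_ne_zero_iff.2 hz
  have h2 := nsq z
  simp only [kq, kerC, cr, Fin.sum_univ_three]
  simp only [Fin.isValue, ↓reduceIte, zero_ne_one, one_ne_zero, Fin.reduceEq]
  field_simp
  linear_combination (ξ 0 ^ 2 + ξ 1 ^ 2 + ξ 2 ^ 2) * h2
lemma kq_nonneg (z : V3) (ξ) : 0 ≤ kq z ξ ξ := by
  rw [kq_self]; have := cr_nonneg z ξ; positivity
lemma kerC_mul (z : V3) (i) : ∑ j, kerC z i j * z j = 0 := by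
  by_cases hz : z = 0
  · subst hz; simp
  have hn : ‖z‖ ≠ 0 := norm_ne_zero_iff.2 hz
  have h2 := nsq z
  simp only [kerC, Fin.sum_univ_three]
  fin_cases i <;> simp <;> field_simp
  · linear_combination z 0 * h2
  · linear_combination z 1 * h2
  · linear_combination z 2 * h2
lemma kq_abs (z : V3) (ξ η) : |kq z ξ η| ≤ (kq z ξ ξ + kq z η η) / 2 := by
  have h1 := kq_nonneg z (fun i => ξ i + η i)
  have h2 := kq_nonneg z (fun i => ξ i - η i)
  have e1 : kq z (fun i => ξ i + η i) (fun i => ξ i + η i) = kq z ξ ξ + kq z η η + 2 * kq z ξ η := by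
    simp only [kq, Fin.sum_univ_three, kerC_symm z 1 0, kerC_symm z 2 0, kerC_symm z 2 1]; ring
  have e2 : kq z (fun i => ξ i - η i) (fun i => ξ i - η i) = kq z ξ ξ + kq z η η - 2 * kq z ξ η := by
    simp only [kq, Fin.sum_univ_three, kerC_symm z 1 0, kerC_symm z 2 0, kerC_symm z 2 1]; ring
  rw [abs_le]; constructor <;> linarith

/-- integrable and bounded -/
def Ib (g : V3 → ℝ) : Prop := Integrable g ∧ ∃ C, 0 ≤ C ∧ ∀ x, |g x| ≤ C
lemma Dec.ib {f : V3 → ℝ} (hf : Dec f) : Ib f := ⟨hf.integrable, hf.bdd⟩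
lemma ib_japanese (w : V3) : Ib (fun x => ((1 + ‖w - x‖) ^ 4)⁻¹) := by
  constructor
  · have hi : Integrable (fun x : V3 => (1 + ‖x‖) ^ (-(4:ℝ))) := by
      refine (integrable_one_add_norm ?_)
      simp; norm_num
    have := hi.comp_sub_left w
    convert this using 2 with x
    rw [Real.rpow_neg (by positivity), show (4:ℝ) = ((4:ℕ):ℝ) by norm_num, Real.rpow_natCast]
  · refine ⟨1, by norm_num, fun x => ?_⟩
    rw [abs_of_nonneg (by positivity)]
    apply inv_le_one_of_one_le₀
    apply one_le_pow₀; linarith [norm_nonneg (w - x)]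

/-- truncated Coulomb kernel -/
def k1 (z : V3) : ℝ := (Set.Iio 1).indicator (fun r : ℝ => r⁻¹) ‖z‖
lemma k1_nonneg (z) : 0 ≤ k1 z := by
  unfold k1
  by_cases h : ‖z‖ < 1
  · rw [Set.indicator_of_mem (by exact h)]; positivity
  · rw [Set.indicator_of_notMem (by exact h)]
lemma inv_le_k1 (z : V3) : ‖z‖⁻¹ ≤ k1 z + 1 := by
  unfold k1; 
  by_cases h : ‖z‖ < 1
  · rw [Set.indicator_of_mem (by exact h)]; linarith
  · rw [Set.indicator_of_notMem (by exact h), zero_add]; exact inv_le_one_of_one_le₀ (not_lt.1 h)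
lemma k1_integrable : Integrable k1 := by
  unfold k1
  rw [integrable_fun_norm_addHaar (volume : Measure V3) (f := (Set.Iio 1).indicator (fun r : ℝ => r⁻¹))]
  simp only [finrank_euclideanSpace, Fintype.card_fin, smul_eq_mul]
  have : IntegrableOn (fun y : ℝ => (Set.Icc 0 1).indicator (fun y => y) y) (Set.Ioi 0) := by
    apply Integrable.integrableOn
    rw [integrable_indicator_iff measurableSet_Icc]
    exact continuous_id.continuousOn.integrableOn_Icc
  refine Integrable.mono' this ?_ ?_
  · apply Measurable.aestronglyMeasurable
    refine (by fun_prop : Measurable fun y : ℝ => y ^ 2).mul (Measurable.indicator (by fun_prop) measurableSet_Iio)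
  · rw [ae_restrict_iff' measurableSet_Ioi]
    refine Filter.Eventually.of_forall fun y hy => ?_
    simp only [Set.mem_Ioi] at hy
    by_cases h : y < 1
    · rw [Set.indicator_of_mem (by exact h), Set.indicator_of_mem (show y ∈ Set.Icc (0:ℝ) 1 from ⟨hy.le, h.le⟩)]
      rw [Real.norm_of_nonneg (by positivity)]; field_simp; simp
    · rw [Set.indicator_of_notMem (by exact h)]; simp
      exact Set.indicator_nonneg (fun x hx => hx.1) _

lemma sing_integrable {g : V3 → ℝ} (hg : Ib g) (v : V3) : Integrable (fun u => ‖v - u‖⁻¹ * g u) := by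
  obtain ⟨hi, C, hC, hb⟩ := hg
  have h1 : Integrable (fun u => k1 (v - u) * C + |g u|) := 
    ((k1_integrable.comp_sub_left v).mul_const C).add hi.abs
  refine h1.mono' ((by fun_prop : Measurable fun u : V3 => ‖v - u‖⁻¹).aestronglyMeasurable.mul hi.1) (Filter.Eventually.of_forall fun u => ?_)
  rw [Real.norm_eq_abs, abs_mul, abs_of_nonneg (by positivity)]
  calc _ ≤ (k1 (v - u) + 1) * |g u| := by gcongr; exact inv_le_k1 _
    _ ≤ _ := by
      rw [add_mul, one_mul]
      gcongr
      · exact k1_nonneg _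
      · exact hb u

lemma sing_bound {g : V3 → ℝ} (hg : Ib g) : ∃ C, 0 ≤ C ∧ ∀ v, ∫ u, ‖v - u‖⁻¹ * |g u| ≤ C := by
  obtain ⟨hi, C, hC, hb⟩ := id hg
  refine ⟨(∫ z, k1 z) * C + ∫ u, |g u|, ?_, fun v => ?_⟩
  · exact add_nonneg (mul_nonneg (integral_nonneg k1_nonneg) hC) (integral_nonneg fun _ => abs_nonneg _)
  · have e : ∫ z, k1 z = ∫ u, k1 (v - u) := (integral_sub_left_eq_self k1 volume v).symm
    rw [e, ← integral_mul_const, ← integral_add ((k1_integrable.comp_sub_left v).mul_const C) hi.abs]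
    refine integral_mono ?_ (((k1_integrable.comp_sub_left v).mul_const C).add hi.abs) fun u => ?_
    · exact sing_integrable (g := fun u => |g u|) ⟨hi.abs, C, hC, by simpa using hb⟩ v
    · calc _ ≤ (k1 (v - u) + 1) * |g u| := by gcongr; exact inv_le_k1 _
        _ ≤ _ := by
          rw [add_mul, one_mul]
          gcongr
          · exact k1_nonneg _
          · exact hb u

lemma sing_prod {F G : V3 → ℝ} (hF : Ib F) (hG : Ib G) :
    Integrable (fun p : V3 × V3 => ‖p.1 - p.2‖⁻¹ * (|F p.1| * |G p.2|)) (volume.prod volume) := by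
  obtain ⟨hi, C, hC, hb⟩ := hF
  obtain ⟨hi', C', hC', hb'⟩ := hG
  have h1 : Integrable (fun p : V3 × V3 => C * (|G p.2| * k1 (p.1 - p.2))) (volume.prod volume) :=
    (Integrable.convolution_integrand (ContinuousLinearMap.mul ℝ ℝ) hi'.abs k1_integrable).const_mul C
  have h2 : Integrable (fun p : V3 × V3 => |F p.1| * |G p.2|) (volume.prod volume) := hi.abs.mul_prod hi'.abs
  refine (h1.add h2).mono' ?_ (Filter.Eventually.of_forall fun p => ?_)
  · exact (by fun_prop : Measurable fun p : V3 × V3 => ‖p.1 - p.2‖⁻¹).aestronglyMeasurable.mul h2.1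
  · rw [Real.norm_of_nonneg (by positivity)]
    simp only [Pi.add_apply]
    calc _ ≤ (k1 (p.1 - p.2) + 1) * (|F p.1| * |G p.2|) := by gcongr; exact inv_le_k1 _
      _ = |F p.1| * (|G p.2| * k1 (p.1 - p.2)) + |F p.1| * |G p.2| := by ring
      _ ≤ _ := by
        have := k1_nonneg (p.1 - p.2)
        gcongr; exact hb _

/-- the basic product-integrability lemma -/
lemma ker_prod {F G : V3 → ℝ} (hF : Dec F) (hG : Dec G) (i j) :
    Integrable (fun p : V3 × V3 => kerC (p.1 - p.2) i j * (F p.1 * G p.2)) (volume.prod volume) := by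
  refine ((sing_prod hF.ib hG.ib).const_mul 2).mono' ?_ (Filter.Eventually.of_forall fun p => ?_)
  · refine Measurable.aestronglyMeasurable ?_
    have h1 := hF.1.measurable
    have h2 := hG.1.measurable
    have h3 := (kerC_meas i j).comp (by fun_prop : Measurable fun p : V3 × V3 => p.1 - p.2)
    exact h3.mul ((h1.comp measurable_fst).mul (h2.comp measurable_snd))
  · rw [Real.norm_eq_abs, abs_mul, abs_mul, ← mul_assoc 2]
    exact mul_le_mul_of_nonneg_right (kerC_abs _ i j) (mul_nonneg (abs_nonneg _) (abs_nonneg _))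

lemma ker_int {g : V3 → ℝ} (hg : Ib g) (i j) (v : V3) : Integrable (fun u => kerC (v - u) i j * g u) := by
  refine ((sing_integrable (g := fun u => |g u|) ⟨hg.1.abs, by simpa using hg.2⟩ v).const_mul 2).mono' ?_ (Filter.Eventually.of_forall fun p => ?_)
  · exact ((kerC_meas i j).comp (by fun_prop : Measurable fun u : V3 => v - u)).aestronglyMeasurable.mul hg.1.1
  · rw [Real.norm_eq_abs, abs_mul, ← mul_assoc]
    exact mul_le_mul_of_nonneg_right (kerC_abs _ i j) (abs_nonneg _)

/-- convolution with the kernel -/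
def cv (i j : Fin 3) (F : V3 → ℝ) (w : V3) : ℝ := ∫ u, kerC (w - u) i j * F u

lemma cv_bdd {F : V3 → ℝ} (hF : Ib F) (i j) : ∃ C, 0 ≤ C ∧ ∀ w, |cv i j F w| ≤ C := by
  obtain ⟨C, hC, h⟩ := sing_bound hF
  refine ⟨2 * C, by positivity, fun w => ?_⟩
  have h1 : |cv i j F w| ≤ ∫ u, 2 * (‖w - u‖⁻¹ * |F u|) := by
    unfold cv; rw [← Real.norm_eq_abs]
    refine norm_integral_le_of_norm_le ((sing_integrable (g := fun u => |F u|) ⟨hF.1.abs, by simpa using hF.2⟩ w).const_mul 2) (Filter.Eventually.of_forall fun p => ?_)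
    rw [Real.norm_eq_abs, abs_mul, ← mul_assoc]
    exact mul_le_mul_of_nonneg_right (kerC_abs _ i j) (by positivity)
  rw [integral_const_mul] at h1
  exact h1.trans (by gcongr; exact h w)

lemma fderiv_coord (F : V3 → ℝ) (x y : V3) : fderiv ℝ F x y = ∑ i, y i * pd i F x := by
  have : y = ∑ i, y i • (EuclideanSpace.single i (1:ℝ) : V3) := by
    ext k; simp [Finset.sum_apply, Pi.single_apply, Fin.sum_univ_three]; fin_cases k <;> simp
  conv_lhs => rw [this]
  simp [pd]

lemma fderiv_norm_le (F : V3 → ℝ) (x : V3) : ‖fderiv ℝ F x‖ ≤ ∑ i, |pd i F x| := by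
  refine ContinuousLinearMap.opNorm_le_bound _ (Finset.sum_nonneg fun _ _ => abs_nonneg _) fun y => ?_
  rw [fderiv_coord, Real.norm_eq_abs, Finset.sum_mul]
  refine (Finset.abs_sum_le_sum_abs _ _).trans (Finset.sum_le_sum fun i _ => ?_)
  rw [abs_mul, mul_comm]
  gcongr; exact abs_coord_le y i

lemma cv_hasFDerivAt {F : V3 → ℝ} (hF : Dc 1 F) (i j) (w : V3) :
    HasFDerivAt (cv i j F) (∫ z, kerC z i j • fderiv ℝ F (w - z)) w ∧ Integrable (fun z => kerC z i j • fderiv ℝ F (w - z)) := by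
  have e : cv i j F = fun w => ∫ z, kerC z i j * F (w - z) := by
    ext w; unfold cv
    rw [← integral_sub_left_eq_self (fun z => kerC z i j * F (w - z)) volume w]
    simp
  rw [e]
  obtain ⟨C, hC, hb⟩ : ∃ C, 0 ≤ C ∧ ∀ x, (1 + ‖x‖) ^ 4 * ‖fderiv ℝ F x‖ ≤ C := by
    choose C hC hb using fun i => (hF.2.2 i).dec.2 4
    refine ⟨∑ i, C i, Finset.sum_nonneg fun i _ => hC i, fun x => ?_⟩
    calc _ ≤ (1 + ‖x‖) ^ 4 * ∑ i, |pd i F x| := by gcongr; exact fderiv_norm_le F x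
      _ ≤ _ := by rw [Finset.mul_sum]; exact Finset.sum_le_sum fun i _ => hb i x
  have hm : Measurable (fun x => fderiv ℝ F x) := measurable_fderiv ℝ F
  have hbd : ∀ z, ∀ x ∈ Metric.ball w 1, ‖kerC z i j • fderiv ℝ F (x - z)‖ ≤ 2 * (‖0 - z‖⁻¹ * (16 * C * ((1 + ‖w - z‖) ^ 4)⁻¹)) := by
    intro z x hx
    rw [norm_smul, Real.norm_eq_abs, zero_sub, norm_neg, ← mul_assoc]
    apply mul_le_mul (kerC_abs _ _ _) _ (norm_nonneg _) (by positivity)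
    have h1 : 1 + ‖w - z‖ ≤ 2 * (1 + ‖x - z‖) := by
      have : ‖w - z‖ ≤ ‖w - x‖ + ‖x - z‖ := by simpa using norm_add_le (w - x) (x - z)
      have h3 : ‖w - x‖ < 1 := by rw [← dist_eq_norm, dist_comm]; exact hx
      linarith [norm_nonneg (x - z)]
    have h2 : (1 + ‖w - z‖) ^ 4 ≤ 16 * (1 + ‖x - z‖) ^ 4 := by
      calc _ ≤ (2 * (1 + ‖x - z‖)) ^ 4 := by gcongr
        _ = _ := by ring
    rw [← div_eq_mul_inv, le_div_iff₀ (by positivity)]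
    calc _ ≤ ‖fderiv ℝ F (x - z)‖ * (16 * (1 + ‖x - z‖) ^ 4) := by gcongr
      _ = 16 * ((1 + ‖x - z‖) ^ 4 * ‖fderiv ℝ F (x - z)‖) := by ring
      _ ≤ _ := by gcongr; exact hb _
  have hbi : Integrable (fun z : V3 => 2 * (‖0 - z‖⁻¹ * (16 * C * ((1 + ‖w - z‖) ^ 4)⁻¹))) := by
    have := ib_japanese w
    refine (sing_integrable ?_ 0).const_mul 2
    obtain ⟨hi, D, hD, hbD⟩ := this
    refine ⟨hi.const_mul _, 16 * C * D, by positivity, fun x => ?_⟩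
    rw [abs_mul, abs_of_nonneg (by positivity : 0 ≤ 16 * C)]
    gcongr; exact hbD x
  have hms : AEStronglyMeasurable (fun z => kerC z i j • fderiv ℝ F (w - z)) volume :=
    ((kerC_meas i j).smul (hm.comp (by fun_prop : Measurable fun z : V3 => w - z))).aestronglyMeasurable
  constructor
  · refine hasFDerivAt_integral_of_dominated_of_fderiv_le (F' := fun x z => kerC z i j • fderiv ℝ F (x - z)) (Metric.ball_mem_nhds w one_pos) ?_ ?_ hms (Filter.Eventually.of_forall hbd) hbi ?_
    · refine Filter.Eventually.of_forall fun x => ?_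
      exact ((kerC_meas i j).mul (hF.1.1.measurable.comp (by fun_prop : Measurable fun z : V3 => x - z))).aestronglyMeasurable
    · have := (ker_int hF.1.ib i j w).comp_sub_left w
      simpa using this
    · refine Filter.Eventually.of_forall fun z x hx => ?_
      have h1 : HasFDerivAt (fun x : V3 => x - z) (ContinuousLinearMap.id ℝ V3) x := (hasFDerivAt_id x).sub_const z
      have h2 := ((hF.2.1 (x - z)).hasFDerivAt.comp x h1).const_mul (kerC z i j)
      rw [ContinuousLinearMap.comp_id] at h2
      exact h2
  · exact hbi.mono' hms (Filter.Eventually.of_forall fun z => hbd z w (Metric.mem_ball_self one_pos))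

lemma cv_diff {F : V3 → ℝ} (hF : Dc 1 F) (i j) : Differentiable ℝ (cv i j F) :=
  fun w => (cv_hasFDerivAt hF i j w).1.differentiableAt

lemma pd_cv {F : V3 → ℝ} (hF : Dc 1 F) (i j k) : pd k (cv i j F) = cv i j (pd k F) := by
  ext w
  unfold pd
  obtain ⟨h1, h2⟩ := cv_hasFDerivAt hF i j w
  rw [h1.fderiv, ContinuousLinearMap.integral_apply h2]
  unfold cv
  rw [← integral_sub_left_eq_self _ volume w]
  simp


/-- integrable with given integral -/
def HI {α : Type*} [MeasurableSpace α] (μ : Measure α) (f : α → ℝ) (a : ℝ) : Prop := Integrable f μ ∧ ∫ x, f x ∂μ = a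
section
variable {α : Type*} [MeasurableSpace α] {μ : Measure α} {f g : α → ℝ} {a b : ℝ}
lemma HI.add (hf : HI μ f a) (hg : HI μ g b) : HI μ (fun x => f x + g x) (a + b) :=
  ⟨hf.1.add hg.1, by rw [integral_add hf.1 hg.1, hf.2, hg.2]⟩
lemma HI.sub (hf : HI μ f a) (hg : HI μ g b) : HI μ (fun x => f x - g x) (a - b) :=
  ⟨hf.1.sub hg.1, by rw [integral_sub hf.1 hg.1, hf.2, hg.2]⟩
lemma HI.cmul (c : ℝ) (hf : HI μ f a) : HI μ (fun x => c * f x) (c * a) :=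
  ⟨hf.1.const_mul c, by rw [integral_const_mul, hf.2]⟩
lemma HI.neg (hf : HI μ f a) : HI μ (fun x => - f x) (- a) :=
  ⟨hf.1.neg, by rw [integral_neg, hf.2]⟩
lemma HI.congr (hf : HI μ f a) (h : ∀ x, g x = f x) (hab : b = a) : HI μ g b := by
  have : g = f := funext h
  subst this; subst hab; exact hf
lemma HI.sum {ι : Type*} (s : Finset ι) {f : ι → α → ℝ} {a : ι → ℝ} (h : ∀ i, HI μ (f i) (a i)) :
    HI μ (fun x => ∑ i ∈ s, f i x) (∑ i ∈ s, a i) :=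
  ⟨integrable_finsetSum _ fun i _ => (h i).1, by
    rw [integral_finsetSum _ fun i _ => (h i).1]; exact Finset.sum_congr rfl fun i _ => (h i).2⟩
lemma HI.le (hf : HI μ f a) (hg : HI μ g b) (h : ∀ x, f x ≤ g x) : a ≤ b := by
  rw [← hf.2, ← hg.2]; exact integral_mono hf.1 hg.1 h
lemma HI.nonneg (hf : HI μ f a) (h : ∀ x, 0 ≤ f x) : 0 ≤ a := by
  rw [← hf.2]; exact integral_nonneg h
lemma HI.mk' (hf : Integrable f μ) : HI μ f (∫ x, f x ∂μ) := ⟨hf, rfl⟩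
end
lemma Dec.hi {f : V3 → ℝ} (hf : Dec f) : HI volume f (∫ x, f x) := ⟨hf.integrable, rfl⟩

/-- Japanese bracket -/
def jb (v : V3) : ℝ := √(1 + ‖v‖ ^ 2)
lemma jb_sq (v : V3) : jb v ^ 2 = 1 + ‖v‖ ^ 2 := Real.sq_sqrt (by positivity)
lemma jb_pos (v : V3) : 0 < jb v := Real.sqrt_pos.2 (by positivity)
lemma one_le_jb (v : V3) : 1 ≤ jb v := by
  have := jb_sq v; have := jb_pos v; nlinarith [sq_nonneg ‖v‖]
lemma jb_le (v : V3) : jb v ≤ 1 + ‖v‖ := by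
  unfold jb; rw [Real.sqrt_le_left (by positivity)]; nlinarith [norm_nonneg v]
lemma le_jb (v : V3) : 1 + ‖v‖ ≤ 2 * jb v := by
  have h1 := jb_sq v; have h2 := jb_pos v; have := norm_nonneg v
  have := one_le_jb v
  have : ‖v‖ ≤ jb v := by nlinarith
  linarith
lemma jb_hasFDerivAt (v : V3) : HasFDerivAt jb ((1 / (2 * jb v)) • (2 • (innerSL ℝ v))) v := by
  have h1 : HasFDerivAt (fun v : V3 => v) (ContinuousLinearMap.id ℝ V3) v := (hasFDerivAt_id v)
  have h2 := ((h1.norm_sq).const_add 1).sqrt (by positivity)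
  rw [ContinuousLinearMap.comp_id] at h2
  exact h2
lemma jb_diff : Differentiable ℝ jb := fun v => (jb_hasFDerivAt v).differentiableAt
lemma pd_jb (i : Fin 3) (v : V3) : pd i jb v = v i * (jb v)⁻¹ := by
  simp only [pd]; rw [(jb_hasFDerivAt v).fderiv]
  have := jb_pos v
  simp [EuclideanSpace.inner_single_right]
  field_simp
/-- negative powers of the bracket -/
def jp (n : ℕ) (v : V3) : ℝ := (jb v)⁻¹ ^ n
lemma jp_pos (n) (v : V3) : 0 < jp n v := by have := jb_pos v; unfold jp; positivity
lemma jp_diff (n) : Differentiable ℝ (jp n) := 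
  (jb_diff.inv fun v => (jb_pos v).ne').pow n
lemma pd_jp (n : ℕ) (i : Fin 3) : pd i (jp n) = fun v => -(n:ℝ) * (v i * jp (n+2) v) := by
  ext v
  have h := ((hasDerivAt_inv (jb_pos v).ne').pow n).comp_hasFDerivAt v (jb_diff v).hasFDerivAt
  have e : pd i (jp n) v = (n * (jb v)⁻¹ ^ (n - 1) * (-(jb v ^ 2)⁻¹)) * pd i jb v := by
    simp only [pd]
    have h' : HasFDerivAt (jp n) _ v := h
    rw [h'.fderiv]; simp
  rw [e, pd_jb]
  unfold jp
  rcases n with _ | n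
  · simp
  · have := jb_pos v
    simp only [Nat.add_sub_cancel]
    push_cast
    rw [show n + 1 + 2 = n + 3 by ring, pow_add, ← inv_pow]
    ring
lemma jp_le_one (n) (v : V3) : jp n v ≤ 1 := 
  pow_le_one₀ (by have := jb_pos v; positivity) (inv_le_one_of_one_le₀ (one_le_jb v))
lemma jp_pgc (m n : ℕ) : PGc m (jp n) := by
  have h0 : ∀ n, PG (jp n) := fun n => ⟨(jp_diff n).continuous, 1, 0, by norm_num, fun x => by
      rw [abs_of_pos (jp_pos n x)]; simpa using jp_le_one n x⟩
  induction m generalizing n with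
  | zero => exact h0 n
  | succ m ih => exact ⟨h0 n, jp_diff n, fun i => by
      rw [pd_jp]; exact (PGc.const _).mul ((PGc.coord i).mul (ih _))⟩
lemma jp_rel (n) (v : V3) : jp (n+2) v * (1 + ‖v‖^2) = jp n v := by
  rw [← jb_sq]; unfold jp; have := jb_pos v; rw [pow_add]; field_simp

/-- the weighted quadratic form -/
def qf (v : V3) (ξ : Fin 3 → ℝ) : ℝ := jp 3 v * (sq3 ξ + cr v ξ)
lemma qf_nonneg (v ξ) : 0 ≤ qf v ξ := 
  mul_nonneg (jp_pos 3 v).le (add_nonneg (sq3_nonneg _) (cr_nonneg _ _))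

lemma cr_le (z : V3) (ξ) : cr z ξ ≤ ‖z‖ ^ 2 * sq3 ξ := by
  rw [nsq]; unfold cr sq3
  nlinarith [sq_nonneg (z 0 * ξ 0 + z 1 * ξ 1 + z 2 * ξ 2)]
lemma cr_sub_le (v u : V3) (ξ) : cr (v - u) ξ ≤ 2 * cr v ξ + 2 * (‖u‖ ^ 2 * sq3 ξ) := by
  have h := cr_le u ξ
  have h1 := cr_nonneg (v + u) ξ
  have e : cr (v - u) ξ + cr (v + u) ξ = 2 * cr v ξ + 2 * cr u ξ := by
    simp only [cr, PiLp.sub_apply, PiLp.add_apply]; ring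
  linarith
lemma one_add_norm_le (v u : V3) : 1 + ‖v‖ ≤ (1 + ‖v - u‖) * (1 + ‖u‖) := by
  have : ‖v‖ ≤ ‖v - u‖ + ‖u‖ := by simpa using norm_add_le (v - u) u
  nlinarith [norm_nonneg u, norm_nonneg (v - u), mul_nonneg (norm_nonneg u) (norm_nonneg (v - u))]
lemma norm_sub_le' (v u : V3) : ‖v - u‖ ≤ (1 + ‖v‖) * (1 + ‖u‖) := by
  have := norm_sub_le v u
  nlinarith [norm_nonneg u, norm_nonneg v, mul_nonneg (norm_nonneg u) (norm_nonneg v)]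

lemma kq_upper (v u : V3) (ξ) : kq (v - u) ξ ξ ≤ 
    qf v ξ * (4 * (‖v - u‖⁻¹ * (1 + ‖u‖) ^ 3) + 8 * (1 + ‖u‖) ^ 5) := by
  rw [kq_self]
  set z := v - u with hz
  have hs := sq3_nonneg ξ
  have hc := cr_nonneg z ξ
  have hcv := cr_nonneg v ξ
  have hnu := norm_nonneg u
  have h1 : ‖z‖⁻¹ ^ 3 * cr z ξ * (1 + ‖z‖) ^ 3 ≤ 4 * (‖z‖⁻¹ * sq3 ξ + cr z ξ) := by
    by_cases h0 : z = 0
    · rw [h0]; simp [cr]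
    have hp : 0 < ‖z‖ := norm_pos_iff.2 h0
    have : (1 + ‖z‖) ^ 3 ≤ 4 * (1 + ‖z‖ ^ 3) := by nlinarith [sq_nonneg (1 - ‖z‖), mul_nonneg hp.le (sq_nonneg (1 - ‖z‖))]
    have h2 := cr_le z ξ
    calc _ ≤ ‖z‖⁻¹ ^ 3 * cr z ξ * (4 * (1 + ‖z‖ ^ 3)) := by gcongr
      _ = 4 * (‖z‖⁻¹ ^ 3 * cr z ξ + cr z ξ) := by field_simp
      _ ≤ 4 * (‖z‖⁻¹ ^ 3 * (‖z‖ ^ 2 * sq3 ξ) + cr z ξ) := by gcongr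
      _ = _ := by field_simp
  have h3 : jb v ^ 3 ≤ (1 + ‖z‖) ^ 3 * (1 + ‖u‖) ^ 3 := by
    rw [← mul_pow]; have := jb_pos v
    gcongr
    exact (jb_le v).trans (one_add_norm_le v u)
  have h4 : cr z ξ ≤ 2 * (1 + ‖u‖) ^ 2 * (sq3 ξ + cr v ξ) := by
    have := cr_sub_le v u ξ
    have a1 : 0 ≤ 2 * (1 + ‖u‖) ^ 2 - 2 * ‖u‖ ^ 2 := by nlinarith
    have a2 : 0 ≤ 2 * (1 + ‖u‖) ^ 2 - 2 := by nlinarith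
    nlinarith [mul_nonneg a1 hs, mul_nonneg a2 hcv]
  have hj := jb_pos v
  have hj3 : 0 < jb v ^ 3 := by positivity
  have h5 : ‖z‖⁻¹ ^ 3 * cr z ξ * jb v ^ 3 ≤ (sq3 ξ + cr v ξ) * (4 * (‖z‖⁻¹ * (1 + ‖u‖) ^ 3) + 8 * (1 + ‖u‖) ^ 5) := by
    calc _ ≤ ‖z‖⁻¹ ^ 3 * cr z ξ * ((1 + ‖z‖) ^ 3 * (1 + ‖u‖) ^ 3) := by gcongr
      _ = (‖z‖⁻¹ ^ 3 * cr z ξ * (1 + ‖z‖) ^ 3) * (1 + ‖u‖) ^ 3 := by ring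
      _ ≤ (4 * (‖z‖⁻¹ * sq3 ξ + cr z ξ)) * (1 + ‖u‖) ^ 3 := by gcongr
      _ ≤ (4 * (‖z‖⁻¹ * (sq3 ξ + cr v ξ) + 2 * (1 + ‖u‖) ^ 2 * (sq3 ξ + cr v ξ))) * (1 + ‖u‖) ^ 3 := by 
          gcongr; linarith
      _ = _ := by ring
  have e : qf v ξ = (sq3 ξ + cr v ξ) / jb v ^ 3 := by unfold qf jp; field_simp
  rw [e, div_mul_eq_mul_div, le_div_iff₀ hj3]
  exact h5

lemma kq_int {N : V3 → ℝ} (hN : Dec N) (v : V3) (ξ η) : Integrable (fun u => kq (v - u) ξ η * N u) := by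
  have : (fun u => kq (v - u) ξ η * N u) = fun u => ∑ i, ∑ j, (ξ i * η j) * (kerC (v - u) i j * N u) := by
    ext u; simp only [kq, Finset.sum_mul]
    refine Finset.sum_congr rfl fun i _ => Finset.sum_congr rfl fun j _ => by ring
  rw [this]
  exact integrable_finsetSum _ fun i _ => integrable_finsetSum _ fun j _ => (ker_int hN.ib i j v).const_mul _
lemma kq_int_eq {N : V3 → ℝ} (hN : Dec N) (v : V3) (ξ η) : 
    ∫ u, kq (v - u) ξ η * N u = ∑ i, ∑ j, cv i j N v * (ξ i * η j) := by
  have : (fun u => kq (v - u) ξ η * N u) = fun u => ∑ i, ∑ j, (ξ i * η j) * (kerC (v - u) i j * N u) := by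
    ext u; simp only [kq, Finset.sum_mul]
    refine Finset.sum_congr rfl fun i _ => Finset.sum_congr rfl fun j _ => by ring
  rw [this, integral_finsetSum _ fun i _ => integrable_finsetSum _ fun j _ => (ker_int hN.ib i j v).const_mul _]
  refine Finset.sum_congr rfl fun i _ => ?_
  rw [integral_finsetSum _ fun j _ => (ker_int hN.ib i j v).const_mul _]
  refine Finset.sum_congr rfl fun j _ => ?_
  rw [integral_const_mul, cv, mul_comm]

lemma onorm_pg (k : ℕ) : PG (fun u : V3 => (1 + ‖u‖) ^ k) := ((PG.const 1).add PG.norm).pow k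

lemma sig_upper {N : V3 → ℝ} (hN : Dec N) (h0 : ∀ u, 0 ≤ N u) : ∃ C, 0 ≤ C ∧ ∀ v ξ, 
    ∫ u, kq (v - u) ξ ξ * N u ≤ C * qf v ξ := by
  have hi3 : Dec (fun u => (1 + ‖u‖) ^ 3 * N u) := (onorm_pg 3).mul_dec hN
  have hi5 : Dec (fun u => (1 + ‖u‖) ^ 5 * N u) := (onorm_pg 5).mul_dec hN
  obtain ⟨C, hC, hb⟩ := sing_bound hi3.ib
  have h5 : 0 ≤ ∫ u, (1 + ‖u‖) ^ 5 * N u := integral_nonneg fun u => by have := h0 u; positivity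
  refine ⟨4 * C + 8 * ∫ u, (1 + ‖u‖) ^ 5 * N u, by positivity, fun v ξ => ?_⟩
  have i1 : Integrable (fun u => ‖v - u‖⁻¹ * |(1 + ‖u‖) ^ 3 * N u|) := by
    exact sing_integrable ⟨hi3.ib.1.abs, by simpa using hi3.ib.2⟩ v
  calc _ ≤ ∫ u, qf v ξ * (4 * (‖v - u‖⁻¹ * |(1 + ‖u‖) ^ 3 * N u|) + 8 * ((1 + ‖u‖) ^ 5 * N u)) := by
        refine integral_mono (kq_int hN v ξ ξ) (((i1.const_mul 4).add (hi5.integrable.const_mul 8)).const_mul _) fun u => ?_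
        have := kq_upper v u ξ
        have h := h0 u
        simp only
        rw [abs_of_nonneg (by positivity)]
        calc _ ≤ (qf v ξ * (4 * (‖v - u‖⁻¹ * (1 + ‖u‖) ^ 3) + 8 * (1 + ‖u‖) ^ 5)) * N u := by gcongr
          _ = _ := by ring
    _ = qf v ξ * (4 * (∫ u, ‖v - u‖⁻¹ * |(1 + ‖u‖) ^ 3 * N u|) + 8 * ∫ u, (1 + ‖u‖) ^ 5 * N u) := by
        rw [integral_const_mul, integral_add (i1.const_mul 4) (hi5.integrable.const_mul 8), integral_const_mul, integral_const_mul]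
    _ ≤ qf v ξ * (4 * C + 8 * ∫ u, (1 + ‖u‖) ^ 5 * N u) := by
        have := qf_nonneg v ξ
        gcongr; exact hb v
    _ = _ := by ring

lemma sig_lower : ∃ c, 0 < c ∧ ∀ v ξ, c * qf v ξ ≤ ∫ u, kq (v - u) ξ ξ * mu0 u := by
  obtain ⟨C, hC, hb⟩ := exp_poly_bdd (a := 1/2) (by norm_num) 3
  have hC1 : 0 < C + 1 := by linarith
  set G := ∫ u, gs 1 0 u with hG
  have hd : Dec (gs 1 0) := gs_dec one_pos 0
  have hGp : 0 < G := by
    rw [hG, integral_pos_iff_support_of_nonneg (fun u => (gs_pos 1 0 u).le) hd.integrable]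
    have : Function.support (gs 1 0) = Set.univ := by
      ext u; simp [(gs_pos 1 0 u).ne']
    rw [this]; simp
  have m1 : ∀ i, ∫ u : V3, u i * gs 1 0 u = 0 := by
    intro i
    have := integral_pd i (gs_dc 1 one_pos 0)
    rw [pd_gs] at this
    have e : ∫ u : V3, (-2 * 1 * u i + 2 * 1 * (0 : V3) i) * gs 1 0 u = (-2) * ∫ u : V3, u i * gs 1 0 u := by
      rw [← integral_const_mul]; congr 1; ext u; simp; ring
    linarith
  have m2 : ∀ i j : Fin 3, ∫ u : V3, u i * u j * gs 1 0 u = if i = j then G / 2 else 0 := by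
    intro i j
    have := ibp_pg i (PGc.coord j) (gs_dc 1 one_pos 0)
    rw [pd_gs, pd_coord, integral_const_mul, ← hG] at this
    have e : ∫ u : V3, u j * ((-2 * 1 * u i + 2 * 1 * (0 : V3) i) * gs 1 0 u) = (-2) * ∫ u : V3, u i * u j * gs 1 0 u := by
      rw [← integral_const_mul]; congr 1; ext u; simp; ring
    rw [e] at this
    split_ifs at this ⊢ <;> linarith
  refine ⟨c0 * G / (8 * (C + 1)), by have := c0_pos; positivity, fun v ξ => ?_⟩
  have i0 := hd.integrable
  have i1 : ∀ i, Integrable (fun u : V3 => u i * gs 1 0 u) := fun i => ((PG.coord i).mul_dec hd).integrable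
  have i2 : ∀ i j, Integrable (fun u : V3 => u i * u j * gs 1 0 u) := fun i j => 
    (((PG.coord i).mul (PG.coord j)).mul_dec hd).integrable
  have key : ∀ a b : Fin 3, a ≠ b → Integrable (fun u : V3 => ((v a - u a) * ξ b - (v b - u b) * ξ a) ^ 2 * gs 1 0 u) ∧ ∫ u : V3, ((v a - u a) * ξ b - (v b - u b) * ξ a) ^ 2 * gs 1 0 u =
     G * ((v a * ξ b - v b * ξ a) ^ 2 + (ξ a ^ 2 + ξ b ^ 2) / 2) := by
    intro a b hab
    have h1 : ∀ i : Fin 3, HI volume (fun u : V3 => u i * gs 1 0 u) 0 := fun i => ⟨i1 i, m1 i⟩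
    have h2 : ∀ i j : Fin 3, HI volume (fun u : V3 => u i * u j * gs 1 0 u) (if i = j then G / 2 else 0) := fun i j => ⟨i2 i j, m2 i j⟩
    have h0 : HI volume (gs 1 0) G := ⟨i0, hG.symm⟩
    refine HI.congr (((((h0.cmul ((v a * ξ b - v b * ξ a) ^ 2)).add ((h1 a).cmul (-2 * (v a * ξ b - v b * ξ a) * ξ b))).add ((h1 b).cmul (2 * (v a * ξ b - v b * ξ a) * ξ a))).add ((h2 a a).cmul (ξ b ^ 2))).add (((h2 b b).cmul (ξ a ^ 2)).add ((h2 a b).cmul (-2 * ξ a * ξ b)))) ?_ ?_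
    · intro u; ring
    · simp only [if_true, if_neg hab]; ring
  obtain ⟨k1, e1⟩ := key 0 1 (by decide)
  obtain ⟨k2, e2⟩ := key 0 2 (by decide)
  obtain ⟨k3, e3⟩ := key 1 2 (by decide)
  have hcr : (fun u => cr (v - u) ξ * gs 1 0 u) = fun u : V3 => ((v 0 - u 0) * ξ 1 - (v 1 - u 1) * ξ 0) ^ 2 * gs 1 0 u + ((v 0 - u 0) * ξ 2 - (v 2 - u 2) * ξ 0) ^ 2 * gs 1 0 u + ((v 1 - u 1) * ξ 2 - (v 2 - u 2) * ξ 1) ^ 2 * gs 1 0 u := by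
    ext u; simp only [cr, PiLp.sub_apply]; ring
  have hI : Integrable (fun u => cr (v - u) ξ * gs 1 0 u) := by
    rw [hcr]; exact (k1.add k2).add k3
  have hV : ∫ u, cr (v - u) ξ * gs 1 0 u = G * (sq3 ξ + cr v ξ) := by
    rw [hcr, integral_add (by exact k1.add k2) k3, integral_add k1 k2, e1, e2, e3]
    unfold sq3 cr; ring
  have hj := jb_pos v
  calc _ = ∫ u, (c0 / (8 * (C + 1)) * jp 3 v) * (cr (v - u) ξ * gs 1 0 u) := by
        rw [integral_const_mul, hV]; unfold qf; ring
    _ ≤ _ := by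
      refine integral_mono (hI.const_mul _) (kq_int (mu0_dc 0) v ξ ξ) fun u => ?_
      simp only
      rw [kq_self]
      by_cases h0 : v - u = 0
      · rw [h0]; simp [cr]
      have hp : 0 < ‖v - u‖ := norm_pos_iff.2 h0
      have hc := cr_nonneg (v - u) ξ
      have hg := gs_pos 1 0 u
      have hc0 := c0_pos
      have h1 : ‖v - u‖ ^ 3 ≤ 8 * jb v ^ 3 * (1 + ‖u‖) ^ 3 := by
        calc _ ≤ (2 * jb v * (1 + ‖u‖)) ^ 3 := by
              gcongr
              exact (norm_sub_le' v u).trans (by gcongr; exact le_jb v)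
          _ = _ := by ring
      have h2 : (1 + ‖u‖) ^ 3 * gs 1 0 u * c0 ≤ (C + 1) * mu0 u := by
        have := hb ‖u‖ (norm_nonneg u)
        rw [mu0_eq]
        have e : gs 1 0 u = Real.exp (-(1/2) * ‖u‖ ^ 2) * gs (1/2) 0 u := by
          unfold gs; rw [← Real.exp_add]; congr 1; simp; ring
        have := gs_pos (1/2) 0 u
        rw [e]
        calc _ = ((1 + ‖u‖) ^ 3 * Real.exp (-(1/2) * ‖u‖ ^ 2)) * (gs (1/2) 0 u * c0) := by ring
          _ ≤ (C + 1) * (gs (1/2) 0 u * c0) := by gcongr; linarith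
          _ = _ := by ring
      have h3 : c0 * gs 1 0 u * ‖v - u‖ ^ 3 ≤ (8 * (C + 1) * jb v ^ 3) * mu0 u := by
        calc _ ≤ c0 * gs 1 0 u * (8 * jb v ^ 3 * (1 + ‖u‖) ^ 3) := by gcongr
          _ = (8 * jb v ^ 3) * ((1 + ‖u‖) ^ 3 * gs 1 0 u * c0) := by ring
          _ ≤ (8 * jb v ^ 3) * ((C + 1) * mu0 u) := by gcongr
          _ = _ := by ring
      have h4 : c0 / (8 * (C + 1)) * jp 3 v * gs 1 0 u ≤ ‖v - u‖⁻¹ ^ 3 * mu0 u := by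
        have e1 : c0 / (8 * (C + 1)) * jp 3 v * gs 1 0 u = (c0 * gs 1 0 u) / (8 * (C + 1) * jb v ^ 3) := by
          unfold jp; field_simp
        have e2 : ‖v - u‖⁻¹ ^ 3 * mu0 u = mu0 u / ‖v - u‖ ^ 3 := by field_simp
        rw [e1, e2, div_le_div_iff₀ (by positivity) (by positivity)]
        linarith
      calc _ = (c0 / (8 * (C + 1)) * jp 3 v * gs 1 0 u) * cr (v - u) ξ := by ring
        _ ≤ (‖v - u‖⁻¹ ^ 3 * mu0 u) * cr (v - u) ξ := by gcongr
        _ = _ := by ring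


/-- gradient as a coordinate vector -/
def gr (f : V3 → ℝ) (v : V3) : Fin 3 → ℝ := fun i => pd i f v
/-- comparison energy -/
def TT (f : V3 → ℝ) : ℝ := ∫ v, qf v (gr f v) + jp 1 v * f v ^ 2

lemma jp_pg (n) : PG (jp n) := jp_pgc 0 n
lemma sq3_dec {X : Fin 3 → V3 → ℝ} (hX : ∀ i, Dec (X i)) : Dec (fun v => sq3 (fun i => X i v)) :=
  ((hX 0).sq.add (hX 1).sq).add (hX 2).sq
lemma cr_dec {X : Fin 3 → V3 → ℝ} (hX : ∀ i, Dec (X i)) : Dec (fun v => cr v (fun i => X i v)) := by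
  have h : ∀ i j, Dec (fun v => (v i * X j v - v j * X i v) ^ 2) := fun i j =>
    (((PG.coord i).mul_dec (hX j)).sub ((PG.coord j).mul_dec (hX i))).sq
  exact ((h 0 1).add (h 0 2)).add (h 1 2)
lemma qf_dec {X : Fin 3 → V3 → ℝ} (hX : ∀ i, Dec (X i)) : Dec (fun v => qf v (fun i => X i v)) :=
  (jp_pg 3).mul_dec ((sq3_dec hX).add (cr_dec hX))
lemma cv_pg {F : V3 → ℝ} (hF : Dc 1 F) (i j) : PG (cv i j F) := by
  obtain ⟨C, hC, h⟩ := cv_bdd hF.dec.ib i j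
  exact ⟨(cv_diff hF i j).continuous, C, 0, hC, by simpa using h⟩
lemma TT_hi {f : V3 → ℝ} (hf : Dc 1 f) : HI volume (fun v => qf v (gr f v) + jp 1 v * f v ^ 2) (TT f) :=
  ((qf_dec (fun i => (hf.2.2 i).dec)).add ((jp_pg 1).mul_dec hf.1.sq)).hi
lemma TT_nonneg (f : V3 → ℝ) : 0 ≤ TT f := integral_nonneg fun v => 
  add_nonneg (qf_nonneg _ _) (mul_nonneg (jp_pos 1 v).le (sq_nonneg _))

/-- the σ-quadratic form -/
def sg (v : V3) (ξ : Fin 3 → ℝ) : ℝ := ∑ i, ∑ j, cv i j mu0 v * (ξ i * ξ j)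
lemma sg_dec {X : Fin 3 → V3 → ℝ} (hX : ∀ i, Dec (X i)) : Dec (fun v => sg v (fun i => X i v)) :=
  Dec.sum _ fun i => Dec.sum _ fun j => (cv_pg (mu0_dc 1) i j).mul_dec ((hX i).mul (hX j))
lemma sNorm_hi {f : V3 → ℝ} (hf : Dc 1 f) : HI volume (fun v => sg v (gr f v) + sg v (fun i => v i * f v)) (sNormSq f) := by
  have := (sg_dec (fun i => (hf.2.2 i).dec)).add (sg_dec (fun i => (PG.coord i).mul_dec hf.1))
  refine this.hi.congr (fun v => rfl) ?_
  unfold sNormSq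
  congr 1; ext v
  unfold sg
  rw [← Finset.sum_add_distrib]
  refine Finset.sum_congr rfl fun i _ => ?_
  rw [← Finset.sum_add_distrib]
  refine Finset.sum_congr rfl fun j _ => ?_
  unfold sigC cv; ring

lemma qf_self (v : V3) (a : ℝ) : qf v (fun i => v i * a) = jp 3 v * (‖v‖ ^ 2 * a ^ 2) := by
  unfold qf cr sq3; rw [nsq]; ring

/-- the uncertainty-type integration by parts -/
lemma unc {f : V3 → ℝ} (hf : Dc 1 f) (n : ℕ) : 
    HI volume (fun v => jp n v * (2 * f v * ∑ i, v i * pd i f v)) (-∫ v, (3 * jp n v - n * (‖v‖ ^ 2 * jp (n+2) v)) * f v ^ 2) := by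
  have hd : ∀ i, Dec (fun v => jp n v * (2 * f v * (v i * pd i f v))) := fun i =>
    (jp_pg n).mul_dec ((hf.1.const_mul 2).mul ((PG.coord i).mul_dec (hf.2.2 i).dec))
  have h2 : ∀ i, Dec (fun v => (jp n v - n * (v i ^ 2 * jp (n+2) v)) * f v ^ 2) := fun i =>
    ((jp_pg n).sub ((PG.const n).mul (((PG.coord i).pow 2).mul (jp_pg (n+2))))).mul_dec hf.1.sq
  have h1 : ∀ i, HI volume (fun v => jp n v * (2 * f v * (v i * pd i f v))) (-∫ v, (jp n v - n * (v i ^ 2 * jp (n+2) v)) * f v ^ 2) := by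
    intro i
    refine ⟨(hd i).integrable, ?_⟩
    have := ibp_pg i ((PGc.coord i).mul (jp_pgc 1 n)) (hf.mul hf)
    rw [pd_mul (by fun_prop) (jp_diff n), pd_mul hf.2.1 hf.2.1, pd_coord, pd_jp] at this
    have e : ∫ v, jp n v * (2 * f v * (v i * pd i f v)) = ∫ x : V3, x i * jp n x * (pd i f x * f x + f x * pd i f x) := by
      congr 1; ext v; ring
    rw [e, ← neg_eq_iff_eq_neg.2 this]
    congr 2; ext v; simp; ring
  refine (HI.sum Finset.univ h1).congr (fun v => ?_) ?_
  · simp only [Finset.mul_sum]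
  · rw [Finset.sum_neg_distrib, ← integral_finsetSum _ fun i _ => (h2 i).integrable]
    congr 2; ext v; rw [nsq]; simp only [Fin.sum_univ_three]; ring

lemma unc_ineq {f : V3 → ℝ} (hf : Dc 1 f) :
    ∫ v, jp 3 v * f v ^ 2 ≤ 2 * ∫ v, jp 3 v * (sq3 (gr f v) + ‖v‖ ^ 2 * f v ^ 2) := by
  have d1 : Dec (fun v => jp 3 v * (sq3 (gr f v) + ‖v‖ ^ 2 * f v ^ 2)) :=
    (jp_pg 3).mul_dec ((sq3_dec fun i => (hf.2.2 i).dec).add ((PG.norm.pow 2).mul_dec hf.1.sq))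
  have d2 : Dec (fun v => jp 3 v * f v ^ 2) := (jp_pg 3).mul_dec hf.1.sq
  have d3 : Dec (fun v => (3 * jp 3 v - (3:ℕ) * (‖v‖ ^ 2 * jp (3+2) v)) * f v ^ 2) := 
    (((PG.const 3).mul (jp_pg 3)).sub ((PG.const _).mul ((PG.norm.pow 2).mul (jp_pg _)))).mul_dec hf.1.sq
  have u := unc hf 3
  have h1 := (d1.hi.add u).nonneg fun v => ?_
  · have h2 := (d2.hi.cmul 3).le ((d3.hi).add (d1.hi.cmul 3)) fun v => ?_
    · linarith [d1.hi.nonneg fun v => mul_nonneg (jp_pos 3 v).le (add_nonneg (sq3_nonneg _) (by positivity))]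
    · have e := jp_rel 3 v
      have := jp_pos 3 v
      have := jp_pos 5 v
      have := sq3_nonneg (gr f v)
      have e' : ‖v‖ ^ 2 * jp (3 + 2) v ≤ ‖v‖ ^ 2 * jp 3 v := by
        gcongr
        rw [← e]; nlinarith [sq_nonneg ‖v‖]
      push_cast
      have h4 : 0 ≤ jp 3 v * sq3 (gr f v) := by positivity
      nlinarith [mul_le_mul_of_nonneg_right e' (sq_nonneg (f v))]
  · have : jp 3 v * (sq3 (gr f v) + ‖v‖ ^ 2 * f v ^ 2) + jp 3 v * (2 * f v * ∑ i, v i * pd i f v) 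
      = jp 3 v * ((pd 0 f v + v 0 * f v)^2 + (pd 1 f v + v 1 * f v)^2 + (pd 2 f v + v 2 * f v)^2) := by
      rw [nsq]; simp only [sq3, gr, Fin.sum_univ_three]; ring
    rw [this]
    have := jp_pos 3 v
    positivity

lemma sNorm_equiv : ∃ C, 0 < C ∧ ∀ f, Dc 1 f → TT f ≤ C * sNormSq f ∧ sNormSq f ≤ C * TT f := by
  obtain ⟨c, hc, hl⟩ := sig_lower
  obtain ⟨C, hC, hu⟩ := sig_upper (mu0_dc 0) (fun u => (mu0_pos u).le)
  have hl' : ∀ v ξ, c * qf v ξ ≤ sg v ξ := fun v ξ => by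
    have := hl v ξ; rwa [kq_int_eq (mu0_dc 0)] at this
  have hu' : ∀ v ξ, sg v ξ ≤ C * qf v ξ := fun v ξ => by
    have := hu v ξ; rwa [kq_int_eq (mu0_dc 0)] at this
  refine ⟨3 / c + C + 1, by positivity, fun f hf => ?_⟩
  have hs := sNorm_hi hf
  have ht := TT_hi hf
  have hq : HI volume (fun v => qf v (gr f v)) (∫ v, qf v (gr f v)) := (qf_dec (fun i => (hf.2.2 i).dec)).hi
  have hq2 : HI volume (fun v => qf v (fun i => v i * f v)) _ := (qf_dec (fun i => (PG.coord i).mul_dec hf.1)).hi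
  have hT := TT_nonneg f
  have hA : c * (∫ v, qf v (gr f v)) + c * (∫ v, qf v (fun i => v i * f v)) ≤ sNormSq f :=
    ((hq.cmul c).add (hq2.cmul c)).le hs fun v => add_le_add (hl' _ _) (hl' _ _)
  have hB : sNormSq f ≤ C * TT f := hs.le (ht.cmul C) fun v => by
    have h1 := hu' v (gr f v)
    have h2 := hu' v (fun i => v i * f v)
    have h3 : qf v (fun i => v i * f v) ≤ jp 1 v * f v ^ 2 := by
      rw [qf_self, ← jp_rel 1 v]
      have := jp_pos 3 v
      have h4 : 0 ≤ jp 3 v * f v ^ 2 := by positivity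
      have : jp (1+2) v = jp 3 v := rfl
      rw [this]
      nlinarith
    nlinarith [mul_le_mul_of_nonneg_left h3 hC]
  have hS : 0 ≤ sNormSq f := hs.nonneg fun v => by
    have h1 := hl' v (gr f v)
    have h2 := hl' v (fun i => v i * f v)
    nlinarith [mul_nonneg hc.le (qf_nonneg v (gr f v)), mul_nonneg hc.le (qf_nonneg v (fun i => v i * f v))]
  have d2 : HI volume (fun v => jp 3 v * f v ^ 2) _ := ((jp_pg 3).mul_dec hf.1.sq).hi
  have hu2 := unc_ineq hf
  have d1 : HI volume (fun v => jp 3 v * (sq3 (gr f v) + ‖v‖ ^ 2 * f v ^ 2)) (∫ v, jp 3 v * (sq3 (gr f v) + ‖v‖ ^ 2 * f v ^ 2)) :=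
    ((jp_pg 3).mul_dec ((sq3_dec fun i => (hf.2.2 i).dec).add ((PG.norm.pow 2).mul_dec hf.1.sq))).hi
  have h3 := d1.le (hq.add hq2) fun v => by
    rw [qf_self]; unfold qf
    have := mul_nonneg (jp_pos 3 v).le (cr_nonneg v (gr f v))
    linarith
  have h4 : TT f ≤ _ := ht.le ((hq.add hq2).add d2) fun v => by
    rw [qf_self, ← jp_rel 1 v]
    have : jp (1+2) v = jp 3 v := rfl
    rw [this]; linarith
  have h5 : TT f ≤ 3 * ((∫ v, qf v (gr f v)) + ∫ v, qf v (fun i => v i * f v)) := by linarith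
  have h6 : TT f ≤ 3 / c * sNormSq f := by
    rw [div_mul_eq_mul_div, le_div_iff₀ hc]
    nlinarith
  constructor
  · nlinarith
  · have : 0 ≤ 3 / c * TT f := by positivity
    nlinarith


/-- twisted gradient -/
def xv (α : ℝ) (β : V3) (f : V3 → ℝ) (j : Fin 3) (v : V3) : ℝ := pd j f v + (α * v j - β j) * f v

lemma xv_dc {n : ℕ} {f : V3 → ℝ} (hf : Dc (n+1) f) (α : ℝ) (β : V3) (j) : Dc n (xv α β f j) := by
  have h := PGc.mul_dc (((PGc.const (n := n) α).mul (PGc.coord j)).add (PGc.const (- β j))) hf.mono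
  have := (hf.2.2 j).add h
  have e : xv α β f j = fun x => pd j f x + (α * x j + -β j) * f x := by
    ext v; unfold xv; ring
  rw [e]; exact this

lemma cv_pgc {F : V3 → ℝ} (hF : Dc 2 F) (i j) : PGc 1 (cv i j F) :=
  ⟨cv_pg hF.mono i j, cv_diff hF.mono i j, fun k => by
    rw [pd_cv hF.mono]; exact cv_pg (hF.2.2 k) i j⟩

lemma weak1 {K g : V3 → ℝ} (i) (hK : Dc 1 K) (hg : Dc 1 g) : 
    HI volume (fun v => (sqmu v)⁻¹ * pd i (fun w => sqmu w * K w) v * g v) (-∫ v, K v * xv (1/2) 0 g i v) := by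
  have e : ∀ v, (sqmu v)⁻¹ * pd i (fun w => sqmu w * K w) v * g v = pd i K v * g v - K v * (v i / 2 * g v) := by
    intro v
    rw [pd_mul (sqmu_dc 1).2.1 hK.2.1, pd_sqmu]
    have := sqmu_pos v
    field_simp; ring
  have d1 : Dec (fun v => pd i K v * g v) := (hK.2.2 i).dec.mul hg.1
  have d2 : Dec (fun v => K v * (v i / 2 * g v)) := by
    have := hK.1.mul (((PG.coord i).mul (PG.const (1/2))).mul_dec hg.1)
    simpa [div_eq_mul_inv] using this
  have d3 : Dec (fun v => K v * pd i g v) := hK.1.mul (hg.2.2 i).dec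
  refine (d1.hi.sub d2.hi).congr e ?_
  rw [ibp_pg i hK.pgc hg]
  have := (d3.hi.add d2.hi).2
  rw [← neg_add', ← this]
  congr 2; ext v; simp [xv]; ring

lemma inner1 {M f : V3 → ℝ} {θ : ℝ} {u₁ : V3} (hM : Dc 2 M) (hf : Dc 3 f)
    (hpd : ∀ j v, pd j M v = -((v j - u₁ j) / θ) * M v) (i : Fin 3) (w : V3) : 
    ∫ u, ∑ j, kerC (w - u) i j * (M u * pd j (fun w => sqmu w * f w) w - (sqmu w * f w) * pd j M u) =
     sqmu w * ∑ j, cv i j M w * xv (1/θ - 1/2) (θ⁻¹ • u₁) f j w := by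
  have e : ∀ u, ∑ j, kerC (w - u) i j * (M u * pd j (fun w => sqmu w * f w) w - (sqmu w * f w) * pd j M u) = 
      ∑ j, (sqmu w * xv (1/θ - 1/2) (θ⁻¹ • u₁) f j w) * (kerC (w - u) i j * M u) := by
    intro u
    have hk := kerC_mul (w - u) i
    rw [← sub_eq_zero, ← Finset.sum_sub_distrib]
    rw [← mul_zero (- (M u * sqmu w * f w / θ)), ← hk, Finset.mul_sum]
    refine Finset.sum_congr rfl fun j _ => ?_
    rw [pd_mul (sqmu_dc 1).2.1 hf.2.1, pd_sqmu, hpd]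
    simp only [xv, PiLp.smul_apply, smul_eq_mul, PiLp.sub_apply]
    ring
  simp_rw [e]
  rw [integral_finsetSum _ fun j _ => (ker_int hM.dec.ib i j w).const_mul _, Finset.mul_sum]
  refine Finset.sum_congr rfl fun j _ => ?_
  rw [integral_const_mul, cv]; ring

lemma inner2 {M f : V3 → ℝ} {θ : ℝ} {u₁ : V3} (hf : Dc 3 f)
    (hpd : ∀ j v, pd j M v = -((v j - u₁ j) / θ) * M v) (i : Fin 3) (w : V3) : 
    ∫ u, ∑ j, kerC (w - u) i j * ((sqmu u * f u) * pd j M w - M w * pd j (fun w => sqmu w * f w) u) =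
     - M w * ∑ j, cv i j (fun v => sqmu v * xv (1/θ - 1/2) (θ⁻¹ • u₁) f j v) w := by
  have e : ∀ u, ∑ j, kerC (w - u) i j * ((sqmu u * f u) * pd j M w - M w * pd j (fun w => sqmu w * f w) u) = 
      ∑ j, (- M w) * (kerC (w - u) i j * (sqmu u * xv (1/θ - 1/2) (θ⁻¹ • u₁) f j u)) := by
    intro u
    have hk := kerC_mul (w - u) i
    rw [← sub_eq_zero, ← Finset.sum_sub_distrib]
    rw [← mul_zero (- (M w * sqmu u * f u / θ)), ← hk, Finset.mul_sum]
    refine Finset.sum_congr rfl fun j _ => ?_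
    rw [pd_mul (sqmu_dc 1).2.1 hf.2.1, pd_sqmu, hpd]
    simp only [xv, PiLp.smul_apply, smul_eq_mul, PiLp.sub_apply]
    ring
  simp_rw [e]
  have hx : ∀ j, Dec (fun v => sqmu v * xv (1/θ - 1/2) (θ⁻¹ • u₁) f j v) := fun j => (sqmu_dc 0).dec.mul (xv_dc hf _ _ j).dec
  rw [integral_finsetSum _ fun j _ => (ker_int (hx j).ib i j w).const_mul _, Finset.mul_sum]
  refine Finset.sum_congr rfl fun j _ => ?_
  rw [integral_const_mul, cv]

/-- local bilinear form -/
def I1 (N : V3 → ℝ) (X Y : Fin 3 → V3 → ℝ) : ℝ := ∫ v, ∑ i, (∑ j, cv i j N v * X j v) * Y i v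
/-- nonlocal bilinear form -/
def I2 (p r : V3 → ℝ) (X Y : Fin 3 → V3 → ℝ) : ℝ := ∫ v, ∑ i, (p v * ∑ j, cv i j (fun u => r u * X j u) v) * Y i v

lemma weak_form (ϱ : ℝ) (u₁ : V3) {θ : ℝ} (h0 : 0 < θ) (h2 : θ < 2) {f g : V3 → ℝ} (hf : Dc 3 f) (hg : Dc 1 g) :
    ∫ v, Lmu (maxwellian ϱ u₁ θ) f v * g v = 
      I1 (maxwellian ϱ u₁ θ) (xv (1/θ - 1/2) (θ⁻¹ • u₁) f) (xv (1/2) 0 g) - 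
      I2 (mq ϱ u₁ θ) sqmu (xv (1/θ - 1/2) (θ⁻¹ • u₁) f) (xv (1/2) 0 g) := by
  set M := maxwellian ϱ u₁ θ with hM
  set m := mq ϱ u₁ θ with hm
  set X := xv (1/θ - 1/2) (θ⁻¹ • u₁) f with hX
  have dM : Dc 2 M := maxwellian_dc 2 ϱ u₁ h0
  have dm : Dc 1 m := mq_dc 1 ϱ u₁ h0 h2
  have dX : ∀ j, Dc 2 (X j) := fun j => xv_dc hf _ _ j
  have hpd : ∀ j v, pd j M v = -((v j - u₁ j) / θ) * M v := fun j v => by rw [hM, pd_maxwellian ϱ u₁ h0]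
  have hsm : ∀ w, sqmu w * m w = M w := fun w => sqmu_mul_mq ϱ u₁ θ w
  have e0 : (fun w => sqmu w * ((sqmu w)⁻¹ * M w)) = M := by
    ext w; exact hsm w
  set K1 : Fin 3 → V3 → ℝ := fun i w => ∑ j, cv i j M w * X j w with hK1
  set K2 : Fin 3 → V3 → ℝ := fun i w => m w * ∑ j, cv i j (fun v => sqmu v * X j v) w with hK2
  have dK1 : ∀ i, Dc 1 (K1 i) := fun i => by
    simp only [hK1, Fin.sum_univ_three]
    have h := fun j => (cv_pgc dM i j).mul_dc (dX j).mono
    exact ((h 0).add (h 1)).add (h 2)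
  have dK2 : ∀ i, Dc 1 (K2 i) := fun i => by
    simp only [hK2, Fin.sum_univ_three]
    have h := fun j => cv_pgc ((sqmu_dc 2).mul (dX j)) i j
    have := (((h 0).add (h 1)).add (h 2)).mul_dc dm
    simpa [mul_comm] using this
  have e1 : ∀ v, Gam (fun w => (sqmu w)⁻¹ * M w) f v = ∑ i, (sqmu v)⁻¹ * pd i (fun w => sqmu w * K1 i w) v := by
    intro v
    unfold Gam; rw [e0]; unfold landauQ
    rw [Finset.mul_sum]
    refine Finset.sum_congr rfl fun i _ => ?_
    congr 2; ext w
    exact inner1 dM hf hpd i w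
  have e2 : ∀ v, Gam f (fun w => (sqmu w)⁻¹ * M w) v = - ∑ i, (sqmu v)⁻¹ * pd i (fun w => sqmu w * K2 i w) v := by
    intro v
    unfold Gam; rw [e0]; unfold landauQ
    rw [Finset.mul_sum, ← Finset.sum_neg_distrib]
    refine Finset.sum_congr rfl fun i _ => ?_
    have : (fun w => ∫ u, ∑ j, kerC (w - u) i j * ((sqmu u * f u) * pd j M w - M w * pd j (fun w => sqmu w * f w) u)) = 
        fun w => (-1) * (sqmu w * K2 i w) := by
      ext w; rw [inner2 hf hpd i w, ← hsm]; simp only [hK2]; ring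
    rw [this, pd_const_mul]; ring
  have H1 := HI.sum Finset.univ fun i => weak1 i (dK1 i) hg
  have H2 := HI.sum Finset.univ fun i => weak1 i (dK2 i) hg
  have H := H2.sub H1
  have E : ∀ v, Lmu M f v * g v = (∑ i, (sqmu v)⁻¹ * pd i (fun w => sqmu w * K2 i w) v * g v) - (∑ i, (sqmu v)⁻¹ * pd i (fun w => sqmu w * K1 i w) v * g v) := by
    intro v
    unfold Lmu; rw [e1, e2, ← Finset.sum_mul, ← Finset.sum_mul]; ring
  have := (H.congr E rfl).2
  rw [this]
  have c1 : I1 M X (xv (1/2) 0 g) = ∑ i, ∫ v, K1 i v * xv (1/2) 0 g i v := by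
    unfold I1; rw [integral_finsetSum _ fun i _ => ((dK1 i).dec.mul (xv_dc hg _ _ i)).integrable]
  have c2 : I2 m sqmu X (xv (1/2) 0 g) = ∑ i, ∫ v, K2 i v * xv (1/2) 0 g i v := by
    unfold I2; rw [integral_finsetSum _ fun i _ => ((dK2 i).dec.mul (xv_dc hg _ _ i)).integrable]
  rw [c1, c2]
  simp only [Finset.sum_neg_distrib]; ring


lemma kq_abs2 (z : V3) (ξ η) (a b : ℝ) : |a * b * kq z ξ η| ≤ (b ^ 2 * kq z ξ ξ + a ^ 2 * kq z η η) / 2 := by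
  have h := kq_abs z (fun i => b * ξ i) (fun i => a * η i)
  have e1 : kq z (fun i => b * ξ i) (fun i => a * η i) = a * b * kq z ξ η := by
    simp only [kq, Fin.sum_univ_three]; ring
  have e2 : kq z (fun i => b * ξ i) (fun i => b * ξ i) = b ^ 2 * kq z ξ ξ := by
    simp only [kq, Fin.sum_univ_three]; ring
  have e3 : kq z (fun i => a * η i) (fun i => a * η i) = a ^ 2 * kq z η η := by
    simp only [kq, Fin.sum_univ_three]; ring
  rwa [e1, e2, e3] at h

lemma kq_sub_comm (v u : V3) (ξ η) : kq (v - u) ξ η = kq (u - v) ξ η := by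
  unfold kq; simp_rw [kerC_sub v u]

/-- evaluate a vector of functions at a point -/
abbrev ev (X : Fin 3 → V3 → ℝ) (v : V3) : Fin 3 → ℝ := fun i => X i v

lemma I1_hi {N : V3 → ℝ} {X Y : Fin 3 → V3 → ℝ} (hN : Dec N) (hX : ∀ i, Dec (X i)) (hY : ∀ i, Dec (Y i)) :
    HI (volume.prod volume) (fun z : V3 × V3 => N z.2 * kq (z.1 - z.2) (ev Y z.1) (ev X z.1)) (I1 N X Y) := by
  have h : Integrable (fun z : V3 × V3 => N z.2 * kq (z.1 - z.2) (ev Y z.1) (ev X z.1)) (volume.prod volume) := by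
    have := integrable_finsetSum Finset.univ fun i _ => integrable_finsetSum Finset.univ fun j _ => ker_prod ((hY i).mul (hX j)) hN i j
    refine this.congr (Filter.Eventually.of_forall fun z => ?_)
    simp only [kq, Finset.mul_sum]
    refine Finset.sum_congr rfl fun i _ => Finset.sum_congr rfl fun j _ => by ring
  refine ⟨h, ?_⟩
  rw [integral_prod _ h]
  unfold I1
  congr 1; ext v
  have := kq_int_eq hN v (ev Y v) (ev X v)
  simp only [mul_comm (N _)]
  rw [this]
  refine Finset.sum_congr rfl fun i _ => ?_
  rw [Finset.sum_mul]
  refine Finset.sum_congr rfl fun j _ => by ring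

lemma I2_hi {p r : V3 → ℝ} {X Y : Fin 3 → V3 → ℝ} (hp : Dec p) (hr : Dec r) (hX : ∀ i, Dec (X i)) (hY : ∀ i, Dec (Y i)) :
    HI (volume.prod volume) (fun z : V3 × V3 => p z.1 * r z.2 * kq (z.1 - z.2) (ev Y z.1) (ev X z.2)) (I2 p r X Y) := by
  have h : Integrable (fun z : V3 × V3 => p z.1 * r z.2 * kq (z.1 - z.2) (ev Y z.1) (ev X z.2)) (volume.prod volume) := by
    have := integrable_finsetSum Finset.univ fun i _ => integrable_finsetSum Finset.univ fun j _ => ker_prod (hp.mul (hY i)) (hr.mul (hX j)) i j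
    refine this.congr (Filter.Eventually.of_forall fun z => ?_)
    simp only [kq, Finset.mul_sum]
    refine Finset.sum_congr rfl fun i _ => Finset.sum_congr rfl fun j _ => by ring
  refine ⟨h, ?_⟩
  rw [integral_prod _ h]
  unfold I2
  congr 1; ext v
  have : ∀ u, p v * r u * kq (v - u) (ev Y v) (ev X u) = ∑ i, ∑ j, (p v * Y i v) * (kerC (v - u) i j * (r u * X j u)) := by
    intro u
    simp only [kq, Finset.mul_sum]
    refine Finset.sum_congr rfl fun i _ => Finset.sum_congr rfl fun j _ => by ring
  simp only [this]
  have hI : ∀ i j, Integrable (fun u => (p v * Y i v) * (kerC (v - u) i j * (r u * X j u))) := fun i j =>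
    (ker_int (hr.mul (hX j)).ib i j v).const_mul _
  rw [integral_finsetSum _ fun i _ => integrable_finsetSum _ fun j _ => hI i j]
  refine Finset.sum_congr rfl fun i _ => ?_
  rw [integral_finsetSum _ fun j _ => hI i j]
  rw [Finset.mul_sum, Finset.sum_mul]
  refine Finset.sum_congr rfl fun j _ => ?_
  rw [integral_const_mul, cv]; ring

lemma SB {N : V3 → ℝ} (hN : Dec N) (h0 : ∀ u, 0 ≤ N u) : ∃ C, 0 ≤ C ∧ ∀ X : Fin 3 → V3 → ℝ, (∀ i, Dec (X i)) → 
    I1 N X X ≤ C * ∫ v, qf v (ev X v) := by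
  obtain ⟨C, hC, h⟩ := sig_upper hN h0
  refine ⟨C, hC, fun X hX => ?_⟩
  have h1 := I1_hi hN hX hX
  rw [← h1.2, integral_prod _ h1.1, ← integral_const_mul]
  refine integral_mono h1.1.integral_prod_left ((qf_dec hX).integrable.const_mul C) fun v => ?_
  have := h v (ev X v)
  simpa only [mul_comm (N _)] using this

lemma I1_hi' {N : V3 → ℝ} {X Y : Fin 3 → V3 → ℝ} (hN : Dec N) (hX : ∀ i, Dec (X i)) (hY : ∀ i, Dec (Y i)) :
    HI (volume.prod volume) (fun z : V3 × V3 => N z.1 * kq (z.1 - z.2) (ev Y z.2) (ev X z.2)) (I1 N X Y) := by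
  obtain ⟨h1, h2⟩ := I1_hi hN hX hY
  have e : (fun z : V3 × V3 => N z.1 * kq (z.1 - z.2) (ev Y z.2) (ev X z.2)) = 
     (fun z : V3 × V3 => N z.2 * kq (z.1 - z.2) (ev Y z.1) (ev X z.1)) ∘ Prod.swap := by
    ext z; simp [kq_sub_comm z.1 z.2]
  rw [e]
  refine ⟨h1.swap, ?_⟩
  rw [← h2]
  exact integral_prod_swap (fun z : V3 × V3 => N z.2 * kq (z.1 - z.2) (ev Y z.1) (ev X z.1))

lemma abs_exp_sub_one (E : ℝ) : |Real.exp E - 1| ≤ |E| * Real.exp |E| := by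
  rcases le_total 0 E with h | h
  · rw [abs_of_nonneg h, abs_of_nonneg (by linarith [Real.add_one_le_exp E])]
    have h1 := Real.add_one_le_exp (-E)
    have h2 := Real.exp_pos E
    have h3 : Real.exp (-E) * Real.exp E = 1 := by rw [← Real.exp_add]; simp
    nlinarith
  · rw [abs_of_nonpos h, abs_of_nonpos (by linarith [Real.exp_le_one_iff.2 h])]
    have h1 := Real.add_one_le_exp E
    have h2 := Real.one_le_exp (neg_nonneg.2 h)
    nlinarith

/-- logarithmic ratio exponent -/
lemma mq_ratio (ϱ : ℝ) (u : V3) {θ : ℝ} (h : 0 < θ) (v : V3) : mq ϱ u θ v = sqmu v * (ϱ * Real.exp (‖v‖ ^ 2 / 2 - ‖v - u‖ ^ 2 / (2 * θ) - 3 / 2 * Real.log θ)) := by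
  have hs := sqmu_pos v
  have e : maxwellian ϱ u θ v = mu0 v * (ϱ * Real.exp (‖v‖ ^ 2 / 2 - ‖v - u‖ ^ 2 / (2 * θ) - 3 / 2 * Real.log θ)) := by
    rw [mu0_eq]; unfold maxwellian c0 gs
    rw [Real.mul_rpow (by positivity) h.le, Real.rpow_def_of_pos h]
    have : ϱ * ((2 * π) ^ (-(3:ℝ) / 2) * Real.exp (Real.log θ * (-3 / 2))) * Real.exp (-‖v - u‖ ^ 2 / (2 * θ)) = 
       (2 * π) ^ (-(3:ℝ) / 2) * ϱ * (Real.exp (Real.log θ * (-3 / 2)) * Real.exp (-‖v - u‖ ^ 2 / (2 * θ))) := by ring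
    rw [this]
    have : (2 * π) ^ (-(3:ℝ) / 2) * Real.exp (-(1 / 2) * ‖v - 0‖ ^ 2) * (ϱ * Real.exp (‖v‖ ^ 2 / 2 - ‖v - u‖ ^ 2 / (2 * θ) - 3 / 2 * Real.log θ)) = 
      (2 * π) ^ (-(3:ℝ) / 2) * ϱ * (Real.exp (-(1 / 2) * ‖v - 0‖ ^ 2) * Real.exp (‖v‖ ^ 2 / 2 - ‖v - u‖ ^ 2 / (2 * θ) - 3 / 2 * Real.log θ)) := by ring
    rw [this, ← Real.exp_add, ← Real.exp_add]
    congr 2; simp; ring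
  unfold mq; rw [e, ← sqmu_sq]; field_simp

lemma exponent_bound {η θ : ℝ} {u : V3} (hη : η ≤ 1/2) (hu : ‖u‖ ≤ η) (hθ : |θ - 1| ≤ η) (v : V3) :
    |‖v‖ ^ 2 / 2 - ‖v - u‖ ^ 2 / (2 * θ) - 3 / 2 * Real.log θ| ≤ 6 * η * (1 + ‖v‖ ^ 2) := by
  have hη0 : 0 ≤ η := (norm_nonneg u).trans hu
  obtain ⟨t1, t2⟩ := abs_le.1 hθ
  have hp : 0 < θ := by linarith
  have l1 := Real.log_le_sub_one_of_pos hp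
  have l2 := Real.one_sub_inv_le_log_of_pos hp
  have hinv : θ⁻¹ ≤ 2 := by rw [inv_le_comm₀ hp two_pos]; linarith
  have hinv0 : 0 < θ⁻¹ := by positivity
  have a1 : |1 - θ⁻¹| ≤ 2 * η := by
    have : 1 - θ⁻¹ = (θ - 1) * θ⁻¹ := by field_simp
    rw [this, abs_mul, abs_of_pos hinv0]
    nlinarith [abs_nonneg (θ - 1)]
  obtain ⟨a2, a3⟩ := abs_le.1 a1
  have l3 : |3 / 2 * Real.log θ| ≤ 3 * η := by rw [abs_le]; constructor <;> linarith
  obtain ⟨l4, l5⟩ := abs_le.1 l3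
  have hin : |inner ℝ v u| ≤ ‖v‖ * ‖u‖ := abs_real_inner_le_norm v u
  have hin2 : |inner ℝ v u| ≤ η * (1 + ‖v‖ ^ 2) / 2 := by
    refine hin.trans ?_
    have := norm_nonneg v
    nlinarith [sq_nonneg (‖v‖ - 1)]
  obtain ⟨i1, i2⟩ := abs_le.1 hin2
  have e : ‖v‖ ^ 2 / 2 - ‖v - u‖ ^ 2 / (2 * θ) = (1 - θ⁻¹) * (‖v‖ ^ 2 / 2) + θ⁻¹ * inner ℝ v u - θ⁻¹ * ‖u‖ ^ 2 / 2 := by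
    rw [norm_sub_sq_real]; field_simp; ring
  rw [e]
  have b1 : |(1 - θ⁻¹) * (‖v‖ ^ 2 / 2)| ≤ η * ‖v‖ ^ 2 := by
    rw [abs_mul, abs_of_nonneg (by positivity : 0 ≤ ‖v‖ ^ 2 / 2)]
    nlinarith [sq_nonneg ‖v‖]
  have b2 : |θ⁻¹ * inner ℝ v u| ≤ η * (1 + ‖v‖ ^ 2) := by
    rw [abs_mul, abs_of_pos hinv0]
    nlinarith [sq_nonneg ‖v‖, abs_nonneg (inner ℝ v u)]
  have b3 : |θ⁻¹ * ‖u‖ ^ 2 / 2| ≤ η := by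
    rw [abs_of_nonneg (by positivity)]
    have : ‖u‖ ^ 2 ≤ η := by nlinarith [norm_nonneg u]
    nlinarith [sq_nonneg ‖u‖]
  obtain ⟨c1, c2⟩ := abs_le.1 b1
  obtain ⟨c3, c4⟩ := abs_le.1 b2
  obtain ⟨c5, c6⟩ := abs_le.1 b3
  have : 0 ≤ η * ‖v‖ ^ 2 := by positivity
  rw [abs_le]; constructor <;> nlinarith

lemma mq_bound : ∃ C, 0 < C ∧ ∀ (η ϱ θ : ℝ) (u : V3), η ≤ 1/96 → |ϱ - 1| ≤ η → ‖u‖ ≤ η → |θ - 1| ≤ η → 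
    ∀ v, |mq ϱ u θ v - sqmu v| ≤ η * (C * gs (1/8) 0 v) := by
  obtain ⟨C, hC, hb⟩ := exp_poly_bdd (a := 1/16) (by norm_num) 2
  refine ⟨√c0 * 7 * Real.exp (1/16) * (C + 1), by have := c0_pos; positivity, fun η ϱ θ u hη hϱ hu hθ v => ?_⟩
  have hη0 : 0 ≤ η := (norm_nonneg u).trans hu
  have hp : 0 < θ := by have := abs_le.1 hθ; linarith
  rw [mq_ratio ϱ u hp]
  set E := ‖v‖ ^ 2 / 2 - ‖v - u‖ ^ 2 / (2 * θ) - 3 / 2 * Real.log θ with hE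
  have hEb : |E| ≤ 6 * η * (1 + ‖v‖ ^ 2) := exponent_bound (by linarith) hu hθ v
  have h1 : |ϱ * Real.exp E - 1| ≤ 7 * η * (1 + ‖v‖ ^ 2) * Real.exp |E| := by
    have e : ϱ * Real.exp E - 1 = (ϱ - 1) * Real.exp E + (Real.exp E - 1) := by ring
    rw [e]
    refine (abs_add_le _ _).trans ?_
    rw [abs_mul, abs_of_pos (Real.exp_pos E)]
    have a1 := abs_exp_sub_one E
    have a2 : Real.exp E ≤ Real.exp |E| := Real.exp_le_exp.2 (le_abs_self E)
    have a3 : |ϱ - 1| * Real.exp E ≤ η * Real.exp |E| := by gcongr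
    have a4 : |E| * Real.exp |E| ≤ 6 * η * (1 + ‖v‖ ^ 2) * Real.exp |E| := by gcongr
    have a5 : 0 ≤ η * Real.exp |E| * ‖v‖ ^ 2 := by positivity
    nlinarith
  have h2 : Real.exp |E| ≤ Real.exp (1/16) * Real.exp (1/16 * ‖v‖ ^ 2) := by
    rw [← Real.exp_add]; apply Real.exp_le_exp.2
    nlinarith [sq_nonneg ‖v‖]
  have h3 : (1 + ‖v‖ ^ 2) * Real.exp (-(1/16) * ‖v‖ ^ 2) ≤ C + 1 := by
    have := hb ‖v‖ (norm_nonneg v)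
    have h4 : 1 + ‖v‖ ^ 2 ≤ (1 + ‖v‖) ^ 2 := by nlinarith [norm_nonneg v]
    have := mul_le_mul_of_nonneg_right h4 (Real.exp_pos (-(1/16) * ‖v‖ ^ 2)).le
    linarith
  have e1 : sqmu v = √c0 * (Real.exp (-(1/16) * ‖v‖ ^ 2) * Real.exp (-(1/16) * ‖v‖ ^ 2) * gs (1/8) 0 v) := by
    rw [sqmu_eq]; unfold gs; rw [← Real.exp_add, ← Real.exp_add]
    simp only [sub_zero]
    rw [show -(1 / 16) * ‖v‖ ^ 2 + -(1 / 16) * ‖v‖ ^ 2 + -(1 / 8) * ‖v‖ ^ 2 = -(1 / 4) * ‖v‖ ^ 2 by ring]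
  have e2 : Real.exp (-(1/16) * ‖v‖ ^ 2) * Real.exp (1/16 * ‖v‖ ^ 2) = 1 := by
    rw [← Real.exp_add]; simp
  have hs := sqmu_pos v
  have e3 : sqmu v * (ϱ * Real.exp E) - sqmu v = sqmu v * (ϱ * Real.exp E - 1) := by ring
  rw [e3, abs_mul, abs_of_pos hs]
  have hg := gs_pos (1/8) 0 v
  have hc := c0_pos
  calc _ ≤ sqmu v * (7 * η * (1 + ‖v‖ ^ 2) * (Real.exp (1/16) * Real.exp (1/16 * ‖v‖ ^ 2))) := by
        gcongr
        exact h1.trans (by gcongr)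
    _ = (√c0 * 7 * η * Real.exp (1/16) * gs (1/8) 0 v) * ((1 + ‖v‖ ^ 2) * Real.exp (-(1/16) * ‖v‖ ^ 2)) * (Real.exp (-(1/16) * ‖v‖ ^ 2) * Real.exp (1/16 * ‖v‖ ^ 2)) := by
        rw [e1]; ring
    _ ≤ (√c0 * 7 * η * Real.exp (1/16) * gs (1/8) 0 v) * (C + 1) * 1 := by
        rw [e2]; gcongr
    _ = _ := by ring


lemma qf_add (v : V3) (ξ η : Fin 3 → ℝ) : qf v (fun i => ξ i + η i) ≤ 2 * qf v ξ + 2 * qf v η := by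
  have h := qf_nonneg v (fun i => ξ i - η i)
  have e : qf v (fun i => ξ i + η i) + qf v (fun i => ξ i - η i) = 2 * qf v ξ + 2 * qf v η := by
    unfold qf sq3 cr; ring
  linarith

lemma qf_lin (v : V3) (a α : ℝ) (β : V3) (hα : |α| ≤ 2) (hβ : ‖β‖ ≤ 2) : 
    qf v (fun i => (α * v i - β i) * a) ≤ 16 * (jp 1 v * a ^ 2) := by
  have hj := jp_pos 3 v
  have e : jp 1 v = jp 3 v * (1 + ‖v‖ ^ 2) := (jp_rel 1 v).symm
  have h1 : qf v (fun i => α * (v i * a)) ≤ 4 * (jp 3 v * (‖v‖ ^ 2 * a ^ 2)) := by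
    have : qf v (fun i => α * (v i * a)) = α ^ 2 * (jp 3 v * (‖v‖ ^ 2 * a ^ 2)) := by
      rw [← qf_self]; unfold qf sq3 cr; ring
    rw [this]
    have h4 : α ^ 2 ≤ 4 := by nlinarith [abs_le.1 hα]
    gcongr
  have h2 : qf v (fun i => - β i * a) ≤ 4 * (jp 3 v * ((1 + ‖v‖ ^ 2) * a ^ 2)) := by
    have e2 : qf v (fun i => - β i * a) = jp 3 v * ((sq3 β + cr v β) * a ^ 2) := by
      unfold qf sq3 cr; ring
    have h3 := cr_le v β
    have h4 : sq3 β = ‖β‖ ^ 2 := by rw [nsq]; rfl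
    have h5 : ‖β‖ ^ 2 ≤ 4 := by nlinarith [norm_nonneg β]
    rw [e2]
    have h6 : sq3 β + cr v β ≤ 4 * (1 + ‖v‖ ^ 2) := by rw [h4] at h3 ⊢; nlinarith [sq_nonneg ‖v‖]
    calc _ ≤ jp 3 v * ((4 * (1 + ‖v‖ ^ 2)) * a ^ 2) := by gcongr
      _ = _ := by ring
  have h := qf_add v (fun i => α * (v i * a)) (fun i => - β i * a)
  have e3 : (fun i => (α * v i - β i) * a) = fun i => α * (v i * a) + - β i * a := by ext i; ring
  rw [e3, e]
  have : 0 ≤ jp 3 v * a ^ 2 := by positivity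
  nlinarith

lemma qf_xv (α : ℝ) (β : V3) (hα : |α| ≤ 2) (hβ : ‖β‖ ≤ 2) {f : V3 → ℝ} (hf : Dc 1 f) :
    ∫ v, qf v (ev (xv α β f) v) ≤ 32 * TT f := by
  refine HI.le (qf_dec fun i => (xv_dc hf α β i)).hi ((TT_hi hf).cmul 32) fun v => ?_
  have h1 := qf_add v (gr f v) (fun i => (α * v i - β i) * f v)
  have h2 := qf_lin v (f v) α β hα hβ
  have h3 := qf_nonneg v (gr f v)
  have : qf v (fun i => xv α β f i v) = qf v (fun i => gr f v i + (α * v i - β i) * f v) := rfl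
  rw [this]; linarith
lemma qf_dv (α : ℝ) (β : V3) (hα : |α| ≤ 2) (hβ : ‖β‖ ≤ 2) {f : V3 → ℝ} (hf : Dc 1 f) :
    ∫ v, qf v (fun i => (α * v i - β i) * f v) ≤ 16 * TT f := by
  refine HI.le (qf_dec fun i => ((((PG.const α).mul (PG.coord i)).sub (PG.const (β i))).mul_dec hf.1)).hi ((TT_hi hf).cmul 16) fun v => ?_
  have h2 := qf_lin v (f v) α β hα hβ
  have h3 := qf_nonneg v (gr f v)
  linarith

/-- the form at the global Maxwellian -/
def B0 (f g : V3 → ℝ) : ℝ := I1 mu0 (xv (1/2) 0 f) (xv (1/2) 0 g) - I2 sqmu sqmu (xv (1/2) 0 f) (xv (1/2) 0 g)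

lemma kq_bound (z : V3) (ξ η) (n N : ℝ) (h : |n| ≤ N) : |n * kq z ξ η| ≤ N * kq z ξ ξ + N * kq z η η := by
  have h1 := kq_abs z ξ η
  rw [abs_mul]
  have h2 := kq_nonneg z ξ
  have h3 := kq_nonneg z η
  have hN : 0 ≤ N := (abs_nonneg _).trans h
  calc _ ≤ N * ((kq z ξ ξ + kq z η η) / 2) := by gcongr
    _ ≤ _ := by nlinarith [mul_nonneg hN h2, mul_nonneg hN h3]

lemma kq_bound2 (z : V3) (ξ η) (a b A B : ℝ) (ha : |a| ≤ A) (hb : |b| ≤ B) : 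
    |a * b * kq z ξ η| ≤ B ^ 2 * kq z ξ ξ + A ^ 2 * kq z η η := by
  refine (kq_abs2 z ξ η a b).trans ?_
  have h2 := kq_nonneg z ξ
  have h3 := kq_nonneg z η
  have h4 : a ^ 2 ≤ A ^ 2 := sq_le_sq' (by linarith [abs_le.1 ha]) (abs_le.1 ha).2
  have h5 : b ^ 2 ≤ B ^ 2 := sq_le_sq' (by linarith [abs_le.1 hb]) (abs_le.1 hb).2
  have h6 : b ^ 2 * kq z ξ ξ ≤ B ^ 2 * kq z ξ ξ := by gcongr
  have h7 : a ^ 2 * kq z η η ≤ A ^ 2 * kq z η η := by gcongr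
  have := mul_nonneg (sq_nonneg B) h2
  have := mul_nonneg (sq_nonneg A) h3
  linarith

lemma B0_hi {f g : V3 → ℝ} (hf : Dc 1 f) (hg : Dc 1 g) : HI (volume.prod volume) (fun z : V3 × V3 => 
    mu0 z.2 * kq (z.1 - z.2) (ev (xv (1/2) 0 g) z.1) (ev (xv (1/2) 0 f) z.1) - 
    sqmu z.1 * sqmu z.2 * kq (z.1 - z.2) (ev (xv (1/2) 0 g) z.1) (ev (xv (1/2) 0 f) z.2)) (B0 f g) :=
  (I1_hi (mu0_dc 0) (fun i => xv_dc hf _ _ i) (fun i => xv_dc hg _ _ i)).sub 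
   (I2_hi (sqmu_dc 0) (sqmu_dc 0) (fun i => xv_dc hf _ _ i) (fun i => xv_dc hg _ _ i))

lemma B0_bound : ∃ C, 0 < C ∧ ∀ f g, Dc 1 f → Dc 1 g → |B0 f g| ≤ C * (TT f + TT g) := by
  obtain ⟨C, hC, hS⟩ := SB (mu0_dc 0) (fun u => (mu0_pos u).le)
  refine ⟨64 * C + 1, by positivity, fun f g hf hg => ?_⟩
  have h := B0_hi hf hg
  have dX := fun i => xv_dc hf (1/2) 0 i
  have dY := fun i => xv_dc hg (1/2) 0 i
  have b1 := I1_hi (mu0_dc 0) dX dX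
  have b2 := I1_hi (mu0_dc 0) dY dY
  have b3 := I1_hi' (mu0_dc 0) dX dX
  have hb := ((b2.cmul 2).add b1).add b3
  have key : ∀ z : V3 × V3, |mu0 z.2 * kq (z.1 - z.2) (ev (xv (1/2) 0 g) z.1) (ev (xv (1/2) 0 f) z.1) - 
    sqmu z.1 * sqmu z.2 * kq (z.1 - z.2) (ev (xv (1/2) 0 g) z.1) (ev (xv (1/2) 0 f) z.2)| ≤ 
     2 * (mu0 z.2 * kq (z.1 - z.2) (ev (xv (1/2) 0 g) z.1) (ev (xv (1/2) 0 g) z.1)) + mu0 z.2 * kq (z.1 - z.2) (ev (xv (1/2) 0 f) z.1) (ev (xv (1/2) 0 f) z.1)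
      + mu0 z.1 * kq (z.1 - z.2) (ev (xv (1/2) 0 f) z.2) (ev (xv (1/2) 0 f) z.2) := fun z => by
    have h1 := kq_bound (z.1 - z.2) (ev (xv (1/2) 0 g) z.1) (ev (xv (1/2) 0 f) z.1) (mu0 z.2) (mu0 z.2) (abs_of_pos (mu0_pos _)).le
    have h2 := kq_bound2 (z.1 - z.2) (ev (xv (1/2) 0 g) z.1) (ev (xv (1/2) 0 f) z.2) _ _ _ _ (abs_of_pos (sqmu_pos z.1)).le (abs_of_pos (sqmu_pos z.2)).le
    rw [pow_two, pow_two, sqmu_sq, sqmu_sq] at h2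
    refine (abs_sub _ _).trans ((add_le_add h1 h2).trans ?_); linarith
  have hab : |B0 f g| ≤ 2 * I1 mu0 (xv (1/2) 0 g) (xv (1/2) 0 g) + I1 mu0 (xv (1/2) 0 f) (xv (1/2) 0 f) + I1 mu0 (xv (1/2) 0 f) (xv (1/2) 0 f) := by
    rw [abs_le]
    constructor
    · rw [neg_le]; exact h.neg.le hb fun z => (neg_le_abs _).trans (key z)
    · exact h.le hb fun z => (le_abs_self _).trans (key z)
  have s1 := hS _ dX
  have s2 := hS _ dY
  have q1 := qf_xv (1/2) 0 (by norm_num [abs_le]) (by simp) hf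
  have q2 := qf_xv (1/2) 0 (by norm_num [abs_le]) (by simp) hg
  have q1' := mul_le_mul_of_nonneg_left q1 hC
  have q2' := mul_le_mul_of_nonneg_left q2 hC
  nlinarith [TT_nonneg f, TT_nonneg g]


/-- the form at a nearby Maxwellian -/
def BM (ϱ : ℝ) (u : V3) (θ : ℝ) (f g : V3 → ℝ) : ℝ := I1 (maxwellian ϱ u θ) (xv (1/θ - 1/2) (θ⁻¹ • u) f) (xv (1/2) 0 g) - 
      I2 (mq ϱ u θ) sqmu (xv (1/θ - 1/2) (θ⁻¹ • u) f) (xv (1/2) 0 g)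

lemma kq_lin (z : V3) (ξ η ζ : Fin 3 → ℝ) (c : ℝ) : kq z ξ (fun i => η i + c * ζ i) = kq z ξ η + c * kq z ξ ζ := by
  simp only [kq, Fin.sum_univ_three]; ring

lemma pert_pt (z : V3) (Y X D X' E : Fin 3 → ℝ) (η M μ m s s' N p : ℝ) (h0 : 0 < η) (hμ : 0 ≤ μ) (hs : 0 ≤ s) (hs' : 0 ≤ s')
   (hM : |M - μ| ≤ η * N) (hm : |m - s| ≤ η * p) :
    |(M * kq z Y (fun i => X i + η * D i) - m * s' * kq z Y (fun i => X' i + η * E i)) - (μ * kq z Y X - s * s' * kq z Y X')| ≤ 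
    η * ((N * kq z Y Y + N * kq z (fun i => X i + η * D i) (fun i => X i + η * D i)) + (μ * kq z Y Y + μ * kq z D D) 
     + (s' ^ 2 * kq z Y Y + p ^ 2 * kq z (fun i => X' i + η * E i) (fun i => X' i + η * E i)) + (s' ^ 2 * kq z Y Y + s ^ 2 * kq z E E)) := by
  have b1 := kq_bound z Y (fun i => X i + η * D i) ((M - μ) / η) N (by
    rw [abs_div, abs_of_pos h0, div_le_iff₀ h0]; linarith)
  have b2 := kq_bound z Y D μ μ (abs_of_nonneg hμ).le
  have b3 := kq_bound2 z Y (fun i => X' i + η * E i) ((m - s) / η) s' p s' (by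
    rw [abs_div, abs_of_pos h0, div_le_iff₀ h0]; linarith) (abs_of_nonneg hs').le
  have b4 := kq_bound2 z Y E s s' s s' (abs_of_nonneg hs).le (abs_of_nonneg hs').le
  have e : (M * kq z Y (fun i => X i + η * D i) - m * s' * kq z Y (fun i => X' i + η * E i)) - (μ * kq z Y X - s * s' * kq z Y X') = 
     η * ((M - μ) / η * kq z Y (fun i => X i + η * D i) + μ * kq z Y D - (m - s) / η * s' * kq z Y (fun i => X' i + η * E i) - s * s' * kq z Y E) := by
    have hM' : M = μ + η * ((M - μ) / η) := by field_simp; ring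
    have hm' : m = s + η * ((m - s) / η) := by field_simp; ring
    generalize (M - μ) / η = a at *
    generalize (m - s) / η = b at *
    subst hM' hm'
    rw [kq_lin, kq_lin]; ring
  rw [e, abs_mul, abs_of_pos h0]
  gcongr
  rw [abs_le] at *
  constructor <;> linarith

lemma HI.abs_le {α : Type*} [MeasurableSpace α] {μ : Measure α} {f g : α → ℝ} {a b : ℝ} (hf : HI μ f a) (hg : HI μ g b) 
    (h : ∀ x, |f x| ≤ g x) : |a| ≤ b := by
  rw [_root_.abs_le]
  constructor
  · rw [neg_le]; exact hf.neg.le hg fun z => (neg_le_abs _).trans (h z)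
  · exact hf.le hg fun z => (le_abs_self _).trans (h z)

lemma pert : ∃ C, 0 < C ∧ ∀ (η ϱ θ : ℝ) (u : V3), 0 < η → η ≤ 1/96 → |ϱ - 1| ≤ η → ‖u‖ ≤ η → |θ - 1| ≤ η → 
    ∀ f g, Dc 1 f → Dc 1 g → |BM ϱ u θ f g - B0 f g| ≤ η * (C * (TT f + TT g)) := by
  obtain ⟨K, hK, hm⟩ := mq_bound
  set p : V3 → ℝ := fun v => K * gs (1/8) 0 v with hp
  set N : V3 → ℝ := fun v => sqmu v * p v with hN
  have p0 : ∀ v, 0 ≤ p v := fun v => mul_nonneg hK.le (gs_pos _ _ _).le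
  have pd : Dec p := (gs_dc 0 (by norm_num) 0).const_mul K
  have sd : Dec sqmu := sqmu_dc 0
  have N0 : ∀ v, 0 ≤ N v := fun v => mul_nonneg (sqmu_pos v).le (p0 v)
  have Nd : Dec N := sd.mul pd
  have p2 : Dec (fun v => p v ^ 2) := by simpa only [pow_two] using pd.mul pd
  obtain ⟨C1, hC1, S1⟩ := SB (mu0_dc 0) (fun u => (mu0_pos u).le)
  obtain ⟨C2, hC2, S2⟩ := SB Nd N0
  obtain ⟨C3, hC3, S3⟩ := SB p2 (fun v => sq_nonneg _)
  refine ⟨100 * (C1 + C2 + C3) + 1, by positivity, fun η ϱ θ u h0 hη hϱ hu hθ f g hf hg => ?_⟩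
  have tθ := abs_le.1 hθ
  have θ0 : 0 < θ := by linarith
  set α' := (1/θ - 1) / η with hα
  set β' : V3 := (η⁻¹ * θ⁻¹) • u with hβ
  have i2 : θ⁻¹ ≤ 2 := by rw [inv_le_comm₀ θ0 (by norm_num)]; linarith
  have bα : |α'| ≤ 2 := by
    have : α' = θ⁻¹ * ((1 - θ) / η) := by rw [hα]; field_simp
    rw [this, abs_mul, abs_div, abs_of_pos h0, abs_of_pos (inv_pos.2 θ0), abs_sub_comm]
    have : |θ - 1| / η ≤ 1 := by rw [div_le_one h0]; exact hθ
    have := mul_le_mul i2 this (by positivity) (by norm_num)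
    linarith
  have bβ : ‖β'‖ ≤ 2 := by
    rw [hβ, norm_smul, Real.norm_of_nonneg (by positivity)]
    have : η⁻¹ * ‖u‖ ≤ 1 := by rw [inv_mul_le_iff₀ h0]; linarith
    have := mul_le_mul i2 this (by positivity) (by norm_num)
    linarith
  have bα1 : |1/θ - 1/2| ≤ 2 := by
    rw [one_div]; rw [abs_le]; have := inv_pos.2 θ0; constructor <;> linarith
  have bβ1 : ‖θ⁻¹ • u‖ ≤ 2 := by
    rw [norm_smul, Real.norm_of_nonneg (by positivity)]
    have := mul_le_mul i2 (hu.trans hη) (norm_nonneg _) (by norm_num)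
    linarith
  set D : Fin 3 → V3 → ℝ := fun i v => (α' * v i - β' i) * f v with hD
  have hX1 : ∀ v, ev (xv (1/θ - 1/2) (θ⁻¹ • u) f) v = fun i => ev (xv (1/2) 0 f) v i + η * ev D v i := by
    intro v; ext i
    simp only [ev, xv, hD, hα, hβ]
    simp
    field_simp
    ring
  have dX := fun i => xv_dc hf (1/2) 0 i
  have dX1 := fun i => xv_dc hf (1/θ - 1/2) (θ⁻¹ • u) i
  have dY := fun i => xv_dc hg (1/2) 0 i
  have dD : ∀ i, Dec (D i) := fun i => ((((PG.const α').mul (PG.coord i)).sub (PG.const (β' i))).mul_dec hf.1)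
  have h1 := (I1_hi (maxwellian_dc 0 ϱ u θ0) dX1 dY).sub (I2_hi (mq_dc 0 ϱ u θ0 (by linarith)) sd dX1 dY)
  have h2 := h1.sub (B0_hi hf hg)
  have md : Dec mu0 := mu0_dc 0
  have hb := (((((I1_hi Nd dY dY).add (I1_hi Nd dX1 dX1)).add ((I1_hi md dY dY).add (I1_hi md dD dD))).add 
    ((I1_hi md dY dY).add (I1_hi' p2 dX1 dX1))).add ((I1_hi md dY dY).add (I1_hi' md dD dD))).cmul η
  have key := h2.abs_le hb (fun z => by
    have := pert_pt (z.1 - z.2) (ev (xv (1/2) 0 g) z.1) (ev (xv (1/2) 0 f) z.1) (ev D z.1) (ev (xv (1/2) 0 f) z.2) (ev D z.2) η 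
      (maxwellian ϱ u θ z.2) (mu0 z.2) (mq ϱ u θ z.1) (sqmu z.1) (sqmu z.2) (N z.2) (p z.1) h0 (mu0_pos _).le (sqmu_pos _).le (sqmu_pos _).le
      (by 
        rw [← sqmu_mul_mq, ← sqmu_sq, ← mul_sub, abs_mul, abs_of_pos (sqmu_pos _)]
        have := mul_le_mul_of_nonneg_left (hm η ϱ θ u hη hϱ hu hθ z.2) (sqmu_pos z.2).le
        refine this.trans (le_of_eq ?_)
        simp only [hN, hp]; ring) (hm η ϱ θ u hη hϱ hu hθ z.1)
    rw [← hX1, ← hX1] at this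
    refine this.trans (le_of_eq ?_)
    rw [pow_two (sqmu _), pow_two (sqmu _), sqmu_sq, sqmu_sq])
  refine key.trans ?_
  gcongr
  have q1 := qf_xv (1/θ - 1/2) (θ⁻¹ • u) bα1 bβ1 hf
  have q2 := qf_xv (1/2) 0 (by norm_num [abs_le]) (by simp) hg
  have q3 := qf_dv α' β' bα bβ hf
  have t1 := (S1 _ dY).trans (mul_le_mul_of_nonneg_left q2 hC1)
  have t2 := (S1 _ dD).trans (mul_le_mul_of_nonneg_left q3 hC1)
  have t3 := (S2 _ dX1).trans (mul_le_mul_of_nonneg_left q1 hC2)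
  have t4 := (S2 _ dY).trans (mul_le_mul_of_nonneg_left q2 hC2)
  have t5 := (S3 _ dX1).trans (mul_le_mul_of_nonneg_left q1 hC3)
  have n1 := mul_nonneg hC1 (TT_nonneg f)
  have n2 := mul_nonneg hC2 (TT_nonneg f)
  have n3 := mul_nonneg hC3 (TT_nonneg f)
  have n1' := mul_nonneg hC1 (TT_nonneg g)
  have n2' := mul_nonneg hC2 (TT_nonneg g)
  have n3' := mul_nonneg hC3 (TT_nonneg g)
  have := TT_nonneg f
  have := TT_nonneg g
  linarith


lemma scale_opt {B C a b : ℝ} (hC : 0 ≤ C) (ha : 0 ≤ a) (hb : 0 ≤ b) (h : ∀ t > 0, B ≤ C * (t ^ 2 * a + t⁻¹ ^ 2 * b)) : 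
    B ≤ 2 * C * (√a * √b) := by
  have key : ∀ ε > 0, B ≤ 2 * C * (√(a + ε) * √(b + ε)) := by
    intro ε hε
    set x := √(a + ε) with hx
    set y := √(b + ε) with hy
    have x0 : 0 < x := Real.sqrt_pos.2 (by linarith)
    have y0 : 0 < y := Real.sqrt_pos.2 (by linarith)
    have hx2 : x ^ 2 = a + ε := Real.sq_sqrt (by linarith)
    have hy2 : y ^ 2 = b + ε := Real.sq_sqrt (by linarith)
    have := h (√(y / x)) (Real.sqrt_pos.2 (by positivity))
    rw [inv_pow, Real.sq_sqrt (by positivity)] at this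
    refine this.trans ?_
    have e1 : y / x * a ≤ y * x := by
      rw [div_mul_eq_mul_div, div_le_iff₀ x0]; nlinarith
    have e2 : (y / x)⁻¹ * b ≤ y * x := by
      rw [inv_div, div_mul_eq_mul_div, div_le_iff₀ y0]; nlinarith
    have := mul_le_mul_of_nonneg_left (add_le_add e1 e2) hC
    linarith
  have ht : Filter.Tendsto (fun ε : ℝ => 2 * C * (√(a + ε) * √(b + ε))) (nhdsWithin 0 (Set.Ioi 0)) (nhds (2 * C * (√(a + 0) * √(b + 0)))) := by
    have : Continuous (fun ε : ℝ => 2 * C * (√(a + ε) * √(b + ε))) := by fun_prop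
    exact (this.tendsto 0).mono_left nhdsWithin_le_nhds
  rw [add_zero, add_zero] at ht
  exact ge_of_tendsto ht (Filter.eventually_of_mem self_mem_nhdsWithin fun ε hε => key ε hε)

lemma xv_smul (α β f j) (t : ℝ) (v : V3) : xv α β (fun v => t * f v) j v = t * xv α β f j v := by
  unfold xv; rw [pd_const_mul]; ring

lemma BM_scale {ϱ θ : ℝ} {u : V3} (h0 : 0 < θ) (h2 : θ < 2) {f g : V3 → ℝ} (hf : Dc 1 f) (hg : Dc 1 g) {t : ℝ} (ht : 0 < t) : 
    BM ϱ u θ (fun v => t * f v) (fun v => t⁻¹ * g v) = BM ϱ u θ f g := by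
  have hi : ∀ {f g : V3 → ℝ}, Dc 1 f → Dc 1 g → _ := fun {f g} (hf : Dc 1 f) (hg : Dc 1 g) => 
    ((I1_hi (maxwellian_dc 0 ϱ u h0) (fun i => xv_dc hf (1/θ - 1/2) (θ⁻¹ • u) i) (fun i => xv_dc hg (1/2) 0 i)).sub 
     (I2_hi (mq_dc 0 ϱ u h0 h2) (sqmu_dc 0) (fun i => xv_dc hf (1/θ - 1/2) (θ⁻¹ • u) i) (fun i => xv_dc hg (1/2) 0 i))).2
  have e1 := hi hf hg
  have e2 := hi (hf.const_mul t) (hg.const_mul t⁻¹)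
  unfold BM
  rw [← e1, ← e2]
  congr 1; ext z
  simp only [kq, ev, xv_smul, Fin.sum_univ_three]
  field_simp

lemma TT_scale (f : V3 → ℝ) (hf : Dc 1 f) (t : ℝ) : TT (fun v => t * f v) = t ^ 2 * TT f := by
  unfold TT
  rw [← integral_const_mul]
  congr 1; ext v
  simp only [qf, gr, pd_const_mul, sq3, cr]; ring

lemma bound_a : ∃ C, 0 < C ∧ ∀ (ϱ θ : ℝ) (u : V3), |ϱ - 1| ≤ 1/96 → ‖u‖ ≤ 1/96 → |θ - 1| ≤ 1/96 → 
    ∀ f g, Dc 1 f → Dc 1 g → |BM ϱ u θ f g| ≤ C * √(sNormSq f) * √(sNormSq g) := by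
  obtain ⟨C1, h1, H1⟩ := B0_bound
  obtain ⟨C2, h2, H2⟩ := pert
  obtain ⟨C3, h3, H3⟩ := sNorm_equiv
  refine ⟨2 * ((C1 + C2) * C3), by positivity, fun ϱ θ u hϱ hu hθ f g hf hg => ?_⟩
  have tθ := abs_le.1 hθ
  have key : ∀ f g, Dc 1 f → Dc 1 g → |BM ϱ u θ f g| ≤ (C1 + C2) * (TT f + TT g) := by
    intro f g hf hg
    have a := H1 f g hf hg
    have b := H2 (1/96) ϱ θ u (by norm_num) le_rfl hϱ hu hθ f g hf hg
    have c : |BM ϱ u θ f g| ≤ |BM ϱ u θ f g - B0 f g| + |B0 f g| := by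
      simpa using abs_add_le (BM ϱ u θ f g - B0 f g) (B0 f g)
    have := mul_nonneg h2.le (add_nonneg (TT_nonneg f) (TT_nonneg g))
    linarith
  have nn : ∀ {f}, Dc 1 f → 0 ≤ sNormSq f := fun {f} hf => by
    have := (H3 f hf).1
    by_contra hneg
    push Not at hneg
    nlinarith [TT_nonneg f]
  have := scale_opt (B := |BM ϱ u θ f g|) (C := (C1 + C2) * C3) (by positivity) (nn hf) (nn hg) fun t ht => by
    rw [← BM_scale (by linarith) (by linarith) hf hg ht]
    refine (key _ _ (hf.const_mul t) (hg.const_mul t⁻¹)).trans ?_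
    rw [TT_scale f hf, TT_scale g hg, mul_assoc]
    have a1 := mul_le_mul_of_nonneg_left (H3 f hf).1 (sq_nonneg t)
    have a2 := mul_le_mul_of_nonneg_left (H3 g hg).1 (sq_nonneg t⁻¹)
    gcongr
    linarith
  rw [mul_assoc]; exact this


/-- purely microscopic -/
def Micro (f : V3 → ℝ) : Prop := (∫ v : V3, sqmu v * f v) = 0 ∧
            (∀ i : Fin 3, (∫ v : V3, sqmu v * f v * v i) = 0) ∧
            (∫ v : V3, sqmu v * f v * ‖v‖ ^ 2) = 0

/-- the vector field `X = ∇f + v f / 2` -/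
abbrev xf (f : V3 → ℝ) : Fin 3 → V3 → ℝ := xv (1/2) 0 f

lemma mom {f p : V3 → ℝ} (hf : Dc 1 f) (hp : PGc 1 p) (j : Fin 3) : 
    HI volume (fun w => p w * sqmu w * xf f j w) (∫ w, (- pd j p w + p w * w j) * (sqmu w * f w)) := by
  have hsf : Dc 1 (fun w => sqmu w * f w) := (sqmu_dc 1).mul hf
  have h1 : Dc 1 (fun w => p w * (sqmu w * f w)) := hp.mul_dc hsf
  have h2 : HI volume (pd j (fun w => p w * (sqmu w * f w))) 0 := ⟨(h1.2.2 j).integrable, integral_pd j h1⟩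
  have h3 : Dec (fun w => (- pd j p w + p w * w j) * (sqmu w * f w)) := 
    ((PG.neg (hp.2.2 j)).add (hp.1.mul (PG.coord j))).mul_dec hsf.1
  refine (h2.add h3.hi).congr (fun w => ?_) (zero_add _).symm
  rw [pd_mul hp.2.1 hsf.2.1, pd_mul (sqmu_dc 1).2.1 hf.2.1, pd_sqmu]
  simp only [xf, xv]
  simp
  ring

/-- second moments of X -/
def MM (f : V3 → ℝ) (k j : Fin 3) : ℝ := ∫ w, w k * w j * (sqmu w * f w)
/-- third moments of X -/
def T3 (f : V3 → ℝ) (k i j : Fin 3) : ℝ := ∫ w, w k * w i * w j * (sqmu w * f w)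

lemma micro_coord {f : V3 → ℝ} (hm : Micro f) (i : Fin 3) : ∫ w, w i * (sqmu w * f w) = 0 := by
  rw [← hm.2.1 i]; congr 1; ext w; ring

lemma hP {f : V3 → ℝ} (hf : Dc 1 f) (hm : Micro f) (j : Fin 3) : HI volume (fun w => sqmu w * xf f j w) 0 := by
  have h := mom hf (PGc.const 1) j
  rw [pd_const] at h
  refine h.congr (fun w => by ring) ?_
  simp only [neg_zero, zero_add, one_mul]
  exact (micro_coord hm j).symm

lemma hM {f : V3 → ℝ} (hf : Dc 1 f) (hm : Micro f) (k j : Fin 3) : HI volume (fun w => w k * sqmu w * xf f j w) (MM f k j) := by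
  have h := mom hf (PGc.coord k) j
  rw [pd_coord] at h
  refine h.congr (fun w => by ring) ?_
  have hsf : Dec (fun w => sqmu w * f w) := (sqmu_dc 0).mul hf.1
  have a : HI volume (fun w => sqmu w * f w) 0 := ⟨hsf.integrable, hm.1⟩
  have b : HI volume (fun w => w k * w j * (sqmu w * f w)) (MM f k j) := (((PG.coord k).mul (PG.coord j)).mul_dec hsf).hi
  have := ((a.cmul (-(if j = k then 1 else 0))).add b).2
  rw [mul_zero, zero_add] at this
  rw [← this]; congr 1; ext w; ring

lemma hT {f : V3 → ℝ} (hf : Dc 1 f) (hm : Micro f) (k i j : Fin 3) : HI volume (fun w => w k * w i * sqmu w * xf f j w) (T3 f k i j) := by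
  have h := mom hf ((PGc.coord k).mul (PGc.coord i)) j
  rw [pd_mul (by fun_prop) (by fun_prop), pd_coord, pd_coord] at h
  refine h.congr (fun w => by ring) ?_
  have hsf : Dec (fun w => sqmu w * f w) := (sqmu_dc 0).mul hf.1
  have a : ∀ l : Fin 3, HI volume (fun w => w l * (sqmu w * f w)) 0 := fun l => ⟨((PG.coord l).mul_dec hsf).integrable, micro_coord hm l⟩
  have b : HI volume (fun w => w k * w i * w j * (sqmu w * f w)) (T3 f k i j) := ((((PG.coord k).mul (PG.coord i)).mul (PG.coord j)).mul_dec hsf).hi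
  have := ((((a i).cmul (-(if j = k then 1 else 0))).add ((a k).cmul (-(if j = i then 1 else 0)))).add b).2
  rw [mul_zero, mul_zero, zero_add, zero_add] at this
  rw [← this]; congr 1; ext w; ring

lemma MM_symm (f : V3 → ℝ) (k j) : MM f k j = MM f j k := by
  unfold MM; congr 1; ext w; ring
lemma T3_symm (f : V3 → ℝ) (k i j) : T3 f k i j = T3 f k j i := by
  unfold T3; congr 1; ext w; ring
lemma MM_tr {f : V3 → ℝ} (hf : Dc 1 f) (hm : Micro f) : MM f 0 0 + MM f 1 1 + MM f 2 2 = 0 := by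
  have hsf : Dec (fun w => sqmu w * f w) := (sqmu_dc 0).mul hf.1
  have b : ∀ k, HI volume (fun w => w k * w k * (sqmu w * f w)) (MM f k k) := fun k => (((PG.coord k).mul (PG.coord k)).mul_dec hsf).hi
  rw [← (((b 0).add (b 1)).add (b 2)).2, ← hm.2.2]
  congr 1; ext w; rw [nsq]; ring

lemma hmu : HI volume mu0 1 := ⟨(mu0_dc 0).integrable, integral_mu0⟩
lemma hmu1 (i : Fin 3) : HI volume (fun w => w i * mu0 w) 0 := ⟨((PG.coord i).mul_dec (mu0_dc 0)).integrable, integral_mu0_coord i⟩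
lemma hmu2 (i j : Fin 3) : HI volume (fun w => w i * w j * mu0 w) (if i = j then 1 else 0) := 
  ⟨(((PG.coord i).mul (PG.coord j)).mul_dec (mu0_dc 0)).integrable, integral_mu0_coord2 i j⟩

/-- difference vector -/
def Zf (f : V3 → ℝ) (v w : V3) (j : Fin 3) : ℝ := sqmu w * xf f j v - sqmu v * xf f j w
/-- cross components -/
def yf (f : V3 → ℝ) (v w : V3) (i j : Fin 3) : ℝ := (v i - w i) * Zf f v w j - (v j - w j) * Zf f v w i

lemma elim1 {f : V3 → ℝ} (hf : Dc 1 f) (hm : Micro f) (v : V3) (i j : Fin 3) : 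
    HI volume (fun w => sqmu w * yf f v w i j) (v i * xf f j v - v j * xf f i v) := by
  have half : ∀ i j, HI volume (fun w => sqmu w * ((v i - w i) * Zf f v w j)) (v i * xf f j v + sqmu v * MM f i j) := fun i j => by
    refine ((((hmu.cmul (v i * xf f j v)).sub ((hmu1 i).cmul (xf f j v))).sub ((hP hf hm j).cmul (sqmu v * v i))).add ((hM hf hm i j).cmul (sqmu v))).congr (fun w => ?_) (by ring)
    rw [← sqmu_sq]; unfold Zf; ring
  refine ((half i j).sub (half j i)).congr (fun w => by unfold yf; ring) (by rw [MM_symm f j i]; ring)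

/-- single piece -/
def rl (f : V3 → ℝ) (v : V3) (l j : Fin 3) : ℝ := ∫ w, w l * sqmu w * yf f v w l j

lemma elim2 {f : V3 → ℝ} (hf : Dc 1 f) (hm : Micro f) (v : V3) (l j : Fin 3) : 
    HI volume (fun w => w l * sqmu w * yf f v w l j) 
      (-xf f j v - sqmu v * (v l * MM f l j - T3 f l l j) + (if l = j then 1 else 0) * xf f l v + sqmu v * (v j * MM f l l - T3 f l j l)) := by
  have half : ∀ i j, HI volume (fun w => w l * sqmu w * ((v i - w i) * Zf f v w j)) (-(if l = i then 1 else 0) * xf f j v - sqmu v * (v i * MM f l j - T3 f l i j)) := fun i j => by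
    refine (((((hmu1 l).cmul (v i * xf f j v)).sub ((hmu2 l i).cmul (xf f j v))).sub ((hM hf hm l j).cmul (sqmu v * v i))).add ((hT hf hm l i j).cmul (sqmu v))).congr (fun w => ?_) (by ring)
    rw [← sqmu_sq]; unfold Zf; ring
  refine ((half l j).sub (half j l)).congr (fun w => by unfold yf; ring) (by simp; ring)

lemma rl_sum {f : V3 → ℝ} (hf : Dc 1 f) (hm : Micro f) (v : V3) (j : Fin 3) : 
    rl f v 0 j + rl f v 1 j + rl f v 2 j = -2 * xf f j v - sqmu v * (v 0 * MM f 0 j + v 1 * MM f 1 j + v 2 * MM f 2 j) := by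
  have e := fun l => (elim2 hf hm v l j).2
  unfold rl
  rw [e, e, e, T3_symm f 0 j 0, T3_symm f 1 j 1, T3_symm f 2 j 2]
  have t := MM_tr hf hm
  have t' : MM f 2 2 = - MM f 0 0 - MM f 1 1 := by linarith
  rw [t']
  fin_cases j <;> simp <;> ring

lemma rl_dec {f : V3 → ℝ} (hf : Dc 1 f) (hm : Micro f) (l j : Fin 3) : Dec (fun v => rl f v l j) := by
  have e : (fun v => rl f v l j) = fun v => (-xf f j v - (v l * MM f l j - T3 f l l j) * sqmu v + (if l = j then 1 else 0) * xf f l v + (v j * MM f l l - T3 f l j l) * sqmu v) := by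
    ext v; unfold rl; rw [(elim2 hf hm v l j).2]; ring
  rw [e]
  have dX : ∀ i, Dec (xf f i) := fun i => xv_dc hf (1/2) 0 i
  have sd : Dec sqmu := sqmu_dc 0
  exact ((((dX j).neg.sub ((((PG.coord l).mul (PG.const _)).sub (PG.const _)).mul_dec sd)).add ((dX l).const_mul _))).add 
    ((((PG.coord j).mul (PG.const _)).sub (PG.const _)).mul_dec sd)

lemma elim3 {f : V3 → ℝ} (hf : Dc 1 f) (hm : Micro f) (k j : Fin 3) : 
    HI volume (fun v => v k * sqmu v * (rl f v 0 j + rl f v 1 j + rl f v 2 j)) (-3 * MM f k j) := by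
  refine ((((hM hf hm k j).cmul (-2)).sub ((hmu2 k 0).cmul (MM f 0 j))).sub (((hmu2 k 1).cmul (MM f 1 j)).add ((hmu2 k 2).cmul (MM f 2 j)))).congr (fun w => ?_) ?_
  · rw [rl_sum hf hm, ← sqmu_sq]; ring
  · fin_cases k <;> simp <;> ring


/-- dissipation density -/
def Dd (f : V3 → ℝ) (z : V3 × V3) : ℝ := kq (z.1 - z.2) (Zf f z.1 z.2) (Zf f z.1 z.2)

lemma kq_comm (z : V3) (ξ η) : kq z ξ η = kq z η ξ := by
  simp only [kq, Fin.sum_univ_three]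
  rw [kerC_symm z 1 0, kerC_symm z 2 0, kerC_symm z 2 1]; ring

lemma kq_sq (z : V3) (ξ η : Fin 3 → ℝ) (a b : ℝ) : kq z (fun i => a * ξ i - b * η i) (fun i => a * ξ i - b * η i) = 
    a * a * kq z ξ ξ + b * b * kq z η η - 2 * (b * a * kq z ξ η) := by
  have h := kq_comm z ξ η
  have e : kq z (fun i => a * ξ i - b * η i) (fun i => a * ξ i - b * η i) = 
    a * a * kq z ξ ξ + b * b * kq z η η - a * b * kq z ξ η - a * b * kq z η ξ := by
    simp only [kq, Fin.sum_univ_three]; ring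
  rw [e, ← h]; ring

lemma Dd_hi {f : V3 → ℝ} (hf : Dc 1 f) : HI (volume.prod volume) (Dd f) (2 * B0 f f) := by
  have dX := fun i => xv_dc hf (1/2) 0 i
  have sd : Dec sqmu := sqmu_dc 0
  have md : Dec mu0 := mu0_dc 0
  refine (((I1_hi md dX dX).add (I1_hi' md dX dX)).sub ((I2_hi sd sd dX dX).cmul 2)).congr (fun z => ?_) (by unfold B0; ring)
  have := kq_sq (z.1 - z.2) (ev (xf f) z.1) (ev (xf f) z.2) (sqmu z.2) (sqmu z.1)
  rw [sqmu_sq, sqmu_sq] at this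
  exact this

lemma Dd_nonneg (f z) : 0 ≤ Dd f z := kq_nonneg _ _

/-- partial integral -/
def dt (f : V3 → ℝ) (v : V3) : ℝ := ∫ w, Dd f (v, w)
lemma dt_nonneg (f v) : 0 ≤ dt f v := integral_nonneg fun _ => Dd_nonneg f _
lemma dt_hi {f : V3 → ℝ} (hf : Dc 1 f) : HI volume (dt f) (2 * B0 f f) := by
  have h := Dd_hi hf
  exact ⟨h.1.integral_prod_left, by rw [← h.2, integral_prod _ h.1]; rfl⟩

lemma cs {α : Type*} [MeasurableSpace α] {μ : Measure α} {F A B : α → ℝ} {I a b : ℝ} (hF : HI μ F I) (hA : HI μ A a) (hB : HI μ B b) 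
    (h : ∀ t : ℝ, ∀ᵐ x ∂μ, 2 * t * F x ≤ t ^ 2 * A x + B x) : I ^ 2 ≤ a * b := by
  have key : ∀ t : ℝ, 0 ≤ a * (t * t) + (-2 * I) * t + b := by
    intro t
    have h1 := hF.cmul (2 * t)
    have h2 := (hA.cmul (t ^ 2)).add hB
    have := integral_mono_ae h1.1 h2.1 (h t)
    rw [h1.2, h2.2] at this
    linarith
  have := discrim_le_zero key
  unfold discrim at this
  nlinarith

lemma y_bound (f : V3 → ℝ) (v w : V3) (i j) : ‖v - w‖⁻¹ ^ 3 * yf f v w i j ^ 2 ≤ Dd f (v, w) := by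
  unfold Dd; rw [kq_self]
  have : yf f v w i j ^ 2 ≤ cr (v - w) (Zf f v w) := by
    simp only [yf, cr, PiLp.sub_apply]
    fin_cases i <;> fin_cases j <;> simp only [Fin.zero_eta, Fin.mk_one, Fin.reduceFinMk] <;> nlinarith [sq_nonneg ((v 0 - w 0) * Zf f v w 1 - (v 1 - w 1) * Zf f v w 0), sq_nonneg ((v 0 - w 0) * Zf f v w 2 - (v 2 - w 2) * Zf f v w 0), sq_nonneg ((v 1 - w 1) * Zf f v w 2 - (v 2 - w 2) * Zf f v w 1)]
  gcongr

/-- moment weight -/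
def EE (w : V3) : ℝ := (1 + ‖w‖) ^ 5 * mu0 w
lemma EE_dec : Dec EE := (onorm_pg 5).mul_dec (mu0_dc 0)
/-- its integral -/
def ee : ℝ := ∫ w, EE w
lemma EE_nonneg (w) : 0 ≤ EE w := mul_nonneg (by positivity) (mu0_pos w).le
lemma ee_nonneg : 0 ≤ ee := integral_nonneg EE_nonneg

lemma pt1 (f : V3 → ℝ) (v w : V3) (i j) (t p : ℝ) (hp : |p| ≤ 1 + ‖w‖) : 
    2 * t * (p * sqmu w * yf f v w i j) ≤ t ^ 2 * ((1 + ‖v‖) ^ 3 * EE w) + Dd f (v, w) := by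
  have hD := Dd_nonneg f (v, w)
  have hE := EE_nonneg w
  by_cases hz : v - w = 0
  · have : v = w := sub_eq_zero.1 hz
    subst this
    have : yf f v v i j = 0 := by simp [yf]
    rw [this]; simp only [mul_zero]; positivity
  have hn : 0 < ‖v - w‖ := norm_pos_iff.2 hz
  have h1 := y_bound f v w i j
  have h2 := norm_sub_le' v w
  set n := ‖v - w‖
  set y := yf f v w i j
  set s := sqmu w with hs
  have h3 : 2 * t * (p * s * y) ≤ t ^ 2 * (p ^ 2 * s ^ 2 * n ^ 3) + n⁻¹ ^ 3 * y ^ 2 := by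
    have : 0 ≤ n⁻¹ ^ 3 * (t * p * s * n ^ 3 - y) ^ 2 := by positivity
    have e : n⁻¹ ^ 3 * (t * p * s * n ^ 3 - y) ^ 2 = t ^ 2 * (p ^ 2 * s ^ 2 * n ^ 3) + n⁻¹ ^ 3 * y ^ 2 - 2 * t * (p * s * y) := by
      field_simp; ring
    linarith
  have h4 : p ^ 2 * s ^ 2 * n ^ 3 ≤ (1 + ‖v‖) ^ 3 * EE w := by
    have a1 : p ^ 2 ≤ (1 + ‖w‖) ^ 2 := by rw [← sq_abs]; gcongr
    have a2 : s ^ 2 = mu0 w := by rw [pow_two, hs, sqmu_sq]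
    have := mu0_pos w
    rw [a2]
    calc _ ≤ (1 + ‖w‖) ^ 2 * mu0 w * ((1 + ‖v‖) * (1 + ‖w‖)) ^ 3 := by gcongr
      _ = _ := by unfold EE; ring
  have := mul_le_mul_of_nonneg_left h4 (sq_nonneg t)
  linarith

lemma pt_ae {f : V3 → ℝ} (hf : Dc 1 f) (hm : Micro f) : ∀ᵐ v, ∀ i j, 
    (v i * xf f j v - v j * xf f i v) ^ 2 ≤ (1 + ‖v‖) ^ 3 * ee * dt f v ∧ rl f v i j ^ 2 ≤ (1 + ‖v‖) ^ 3 * ee * dt f v := by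
  filter_upwards [(Dd_hi hf).1.prod_right_ae] with v hv i j
  have hB : HI volume (fun w => Dd f (v, w)) (dt f v) := HI.mk' hv
  have hA := EE_dec.hi.cmul ((1 + ‖v‖) ^ 3)
  constructor
  · refine cs (elim1 hf hm v i j) hA hB fun t => Filter.Eventually.of_forall fun w => ?_
    have := pt1 f v w i j t 1 (by simp)
    simpa using this
  · refine cs (HI.mk' (elim2 hf hm v i j).1) hA hB fun t => Filter.Eventually.of_forall fun w => ?_
    exact pt1 f v w i j t (w i) ((abs_coord_le _ _).trans (by linarith))

lemma MM_bound {f : V3 → ℝ} (hf : Dc 1 f) (hm : Micro f) (k j) : MM f k j ^ 2 ≤ ee ^ 2 * (2 * B0 f f) := by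
  have h := cs (elim3 hf hm k j) EE_dec.hi ((dt_hi hf).cmul (9 * ee)) fun t => by
    filter_upwards [pt_ae hf hm] with v hv
    have r0 := (hv 0 j).2
    have r1 := (hv 1 j).2
    have r2 := (hv 2 j).2
    set R := rl f v 0 j + rl f v 1 j + rl f v 2 j with hR
    have hp : 0 < (1 + ‖v‖) ^ 3 := by positivity
    have hR2 : R ^ 2 ≤ (1 + ‖v‖) ^ 3 * (9 * ee * dt f v) := by
      have : R ^ 2 ≤ 3 * (rl f v 0 j ^ 2 + rl f v 1 j ^ 2 + rl f v 2 j ^ 2) := by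
        rw [hR]; nlinarith [sq_nonneg (rl f v 0 j - rl f v 1 j), sq_nonneg (rl f v 0 j - rl f v 2 j), sq_nonneg (rl f v 1 j - rl f v 2 j)]
      linarith
    have hk : v k ^ 2 ≤ (1 + ‖v‖) ^ 2 := by
      rw [← sq_abs]; have := abs_coord_le v k; gcongr; linarith
    have h1 : 2 * t * (v k * sqmu v * R) ≤ t ^ 2 * (v k ^ 2 * sqmu v ^ 2 * (1 + ‖v‖) ^ 3) + ((1 + ‖v‖) ^ 3)⁻¹ * R ^ 2 := by
      have : 0 ≤ ((1 + ‖v‖) ^ 3)⁻¹ * (t * v k * sqmu v * (1 + ‖v‖) ^ 3 - R) ^ 2 := by positivity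
      have e : ((1 + ‖v‖) ^ 3)⁻¹ * (t * v k * sqmu v * (1 + ‖v‖) ^ 3 - R) ^ 2 = 
        t ^ 2 * (v k ^ 2 * sqmu v ^ 2 * (1 + ‖v‖) ^ 3) + ((1 + ‖v‖) ^ 3)⁻¹ * R ^ 2 - 2 * t * (v k * sqmu v * R) := by
        field_simp; ring
      linarith
    have h2 : ((1 + ‖v‖) ^ 3)⁻¹ * R ^ 2 ≤ 9 * ee * dt f v := by rw [inv_mul_le_iff₀ hp]; exact hR2
    have h3 : v k ^ 2 * sqmu v ^ 2 * (1 + ‖v‖) ^ 3 ≤ EE v := by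
      have := mu0_pos v
      rw [pow_two (sqmu v), sqmu_sq]
      calc _ ≤ (1 + ‖v‖) ^ 2 * mu0 v * (1 + ‖v‖) ^ 3 := by gcongr
        _ = _ := by unfold EE; ring
    have := mul_le_mul_of_nonneg_left h3 (sq_nonneg t)
    linarith
  have e : ∫ x, EE x = ee := rfl
  rw [e] at h
  linarith

lemma elim_main : ∃ C, 0 < C ∧ ∀ f, Dc 1 f → Micro f → ∫ v, qf v (ev (xf f) v) ≤ C * B0 f f := by
  have e0 := ee_nonneg
  refine ⟨2 * (132 * ee + 14 * ee ^ 3) + 1, by positivity, fun f hf hm => ?_⟩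
  have dX := fun i => xv_dc hf (1/2) 0 i
  have hb := ((dt_hi hf).cmul (132 * ee)).add (EE_dec.hi.cmul (14 * (ee ^ 2 * (2 * B0 f f))))
  have hD : 0 ≤ 2 * B0 f f := (dt_hi hf).nonneg (dt_nonneg f)
  have := integral_mono_ae (qf_dec dX).integrable hb.1 (by
    filter_upwards [pt_ae hf hm] with v hv
    have mb := MM_bound hf hm
    set D := 2 * B0 f f
    set m := ee ^ 2 * D with hmdef
    set q := (1 + ‖v‖) ^ 3 * ee * dt f v with hq
    have hcr : cr v (ev (xf f) v) ≤ 3 * q := by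
      unfold cr; linarith [(hv 0 1).1, (hv 0 2).1, (hv 1 2).1]
    have hmu := mu0_pos v
    have m0 : 0 ≤ m := by positivity
    have hXj : ∀ j, xf f j v ^ 2 ≤ 9/2 * q + 3/2 * (mu0 v * (‖v‖ ^ 2 * m)) := by
      intro j
      have h := rl_sum hf hm v j
      have r0 := (hv 0 j).2
      have r1 := (hv 1 j).2
      have r2 := (hv 2 j).2
      set R := rl f v 0 j + rl f v 1 j + rl f v 2 j with hR
      have hR2 : R ^ 2 ≤ 9 * q := by
        have : R ^ 2 ≤ 3 * (rl f v 0 j ^ 2 + rl f v 1 j ^ 2 + rl f v 2 j ^ 2) := by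
          rw [hR]; nlinarith [sq_nonneg (rl f v 0 j - rl f v 1 j), sq_nonneg (rl f v 0 j - rl f v 2 j), sq_nonneg (rl f v 1 j - rl f v 2 j)]
        linarith
      set S := v 0 * MM f 0 j + v 1 * MM f 1 j + v 2 * MM f 2 j with hS
      have hS2 : S ^ 2 ≤ 3 * (‖v‖ ^ 2 * m) := by
        have a : S ^ 2 ≤ 3 * ((v 0 * MM f 0 j) ^ 2 + (v 1 * MM f 1 j) ^ 2 + (v 2 * MM f 2 j) ^ 2) := by
          rw [hS]; nlinarith [sq_nonneg (v 0 * MM f 0 j - v 1 * MM f 1 j), sq_nonneg (v 0 * MM f 0 j - v 2 * MM f 2 j), sq_nonneg (v 1 * MM f 1 j - v 2 * MM f 2 j)]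
        have b := fun l => mul_le_mul_of_nonneg_left (mb l j) (sq_nonneg (v l))
        rw [nsq]
        linarith [b 0, b 1, b 2]
      have e : xf f j v = -(R + sqmu v * S) / 2 := by linarith
      have e2 : (sqmu v * S) ^ 2 = mu0 v * S ^ 2 := by rw [mul_pow, pow_two (sqmu v), sqmu_sq]
      have := mul_le_mul_of_nonneg_left hS2 hmu.le
      rw [e]
      nlinarith [sq_nonneg (R - sqmu v * S)]
    have hj : jp 3 v * q ≤ 8 * (ee * dt f v) := by
      have h1 := le_jb v
      have h2 := jb_pos v
      have : jp 3 v * (1 + ‖v‖) ^ 3 ≤ 8 := by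
        unfold jp
        calc _ ≤ (jb v)⁻¹ ^ 3 * (2 * jb v) ^ 3 := by gcongr
          _ = 8 := by field_simp; norm_num
      have hd := dt_nonneg f v
      calc _ = (jp 3 v * (1 + ‖v‖) ^ 3) * (ee * dt f v) := by rw [hq]; ring
        _ ≤ _ := by gcongr
    have hj1 := jp_le_one 3 v
    have hj0 := jp_pos 3 v
    have hE : mu0 v * ‖v‖ ^ 2 ≤ EE v := by
      unfold EE
      have : ‖v‖ ^ 2 ≤ (1 + ‖v‖) ^ 5 := by
        calc _ ≤ (1 + ‖v‖) ^ 2 := by gcongr; linarith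
          _ ≤ _ := pow_le_pow_right₀ (by linarith [norm_nonneg v]) (by norm_num)
      rw [mul_comm]; gcongr
    have hE2 : jp 3 v * (mu0 v * (‖v‖ ^ 2 * m)) ≤ EE v * m := by
      have : 0 ≤ mu0 v * (‖v‖ ^ 2 * m) := by positivity
      calc _ ≤ 1 * (mu0 v * (‖v‖ ^ 2 * m)) := by gcongr
        _ = (mu0 v * ‖v‖ ^ 2) * m := by ring
        _ ≤ _ := by gcongr
    have hs3 : sq3 (ev (xf f) v) ≤ 27/2 * q + 9/2 * (mu0 v * (‖v‖ ^ 2 * m)) := by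
      unfold sq3; linarith [hXj 0, hXj 1, hXj 2]
    have : qf v (ev (xf f) v) ≤ jp 3 v * (33/2 * q + 9/2 * (mu0 v * (‖v‖ ^ 2 * m))) := by
      unfold qf; refine mul_le_mul_of_nonneg_left ?_ hj0.le; linarith
    have h0 := mul_nonneg (EE_nonneg v) m0
    change qf v (ev (xf f) v) ≤ _
    linarith)
  rw [hb.2] at this
  have e : ∫ x, EE x = ee := rfl
  rw [e] at this
  change ∫ v, qf v (ev (xf f) v) ≤ _ at this
  linarith


/-- rotation on V3 × V3 -/
def rot (θ : ℝ) : V3 × V3 →ₗ[ℝ] V3 × V3 :=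
  LinearMap.prod (cos θ • LinearMap.fst ℝ V3 V3 + sin θ • LinearMap.snd ℝ V3 V3) (-sin θ • LinearMap.fst ℝ V3 V3 + cos θ • LinearMap.snd ℝ V3 V3)
/-- flip -/
def flp : V3 × V3 →ₗ[ℝ] V3 × V3 := LinearMap.prod (LinearMap.fst ℝ V3 V3) (-LinearMap.snd ℝ V3 V3)

lemma rot_apply (θ : ℝ) (z : V3 × V3) : rot θ z = (cos θ • z.1 + sin θ • z.2, -sin θ • z.1 + cos θ • z.2) := rfl

lemma rot_det (θ : ℝ) : LinearMap.det (rot θ) ^ 2 = 1 := by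
  have h1 : rot θ ∘ₗ rot (-θ) = LinearMap.id := by
    apply LinearMap.ext; intro z
    simp only [LinearMap.comp_apply, rot_apply, LinearMap.id_apply, Real.cos_neg, Real.sin_neg]
    have := Real.cos_sq_add_sin_sq θ
    ext i
    · simp; linear_combination (z.1 i) * this
    · simp; linear_combination (z.2 i) * this
  have h2 : flp ∘ₗ flp = LinearMap.id := by
    apply LinearMap.ext; intro z
    simp [flp]
  have h3 : rot (-θ) = flp ∘ₗ (rot θ ∘ₗ flp) := by
    apply LinearMap.ext; intro z
    ext i
    · simp [flp, rot_apply]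
    · simp [flp, rot_apply]; ring
  have d1 := congrArg LinearMap.det h1
  have d2 := congrArg LinearMap.det h2
  rw [h3] at d1
  simp only [LinearMap.det_comp, LinearMap.det_id] at d1 d2
  linear_combination d1 - LinearMap.det (rot θ) ^ 2 * (d2)

lemma rot_lint (θ : ℝ) (G : V3 × V3 → ENNReal) (hG : Measurable G) : 
    ∫⁻ z, G (rot θ z) ∂(volume.prod volume) = ∫⁻ z, G z ∂(volume.prod volume) := by
  have hd := rot_det θ
  have h0 : LinearMap.det (rot θ) ≠ 0 := by intro h; rw [h] at hd; norm_num at hd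
  have h1 := Measure.map_linearMap_addHaar_eq_smul_addHaar (μ := (volume.prod volume : Measure (V3 × V3))) h0
  have h2 : |(LinearMap.det (rot θ))⁻¹| = 1 := by
    rw [abs_inv, ← Real.sqrt_sq_eq_abs, hd]; simp
  rw [h2] at h1
  simp only [ENNReal.ofReal_one, one_smul] at h1
  have hm : Measurable (rot θ) := (LinearMap.continuous_of_finiteDimensional (rot θ)).measurable
  conv_rhs => rw [← h1]
  rw [lintegral_map hG hm]

/-- directional derivative -/
def psi (h : V3 → ℝ) (z : V3 × V3) : ℝ := ∑ j, z.2 j * pd j h z.1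

lemma psi_cont {h : V3 → ℝ} (hc : ∀ j, Continuous (pd j h)) : Continuous (psi h) := by
  unfold psi
  refine continuous_finsetSum _ fun j _ => ?_
  have := (hc j).comp (continuous_fst (X := V3) (Y := V3))
  exact Continuous.mul (by fun_prop) this

lemma rot_cont (z : V3 × V3) : Continuous (fun θ => rot θ z) := by
  simp only [rot_apply]
  fun_prop
lemma rot_cont2 : Continuous (fun p : (V3 × V3) × ℝ => rot p.2 p.1) := by
  simp only [rot_apply]
  fun_prop

lemma curve {h : V3 → ℝ} (hd : Differentiable ℝ h) (z : V3 × V3) (θ : ℝ) : 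
    HasDerivAt (fun θ => h (rot θ z).1) (psi h (rot θ z)) θ := by
  have h1 : HasDerivAt (fun θ : ℝ => cos θ • z.1 + sin θ • z.2) (-sin θ • z.1 + cos θ • z.2) θ := 
    ((Real.hasDerivAt_cos θ).smul_const z.1).add ((Real.hasDerivAt_sin θ).smul_const z.2)
  have h2 := (hd (cos θ • z.1 + sin θ • z.2)).hasFDerivAt.comp_hasDerivAt θ h1
  have e : psi h (rot θ z) = fderiv ℝ h (cos θ • z.1 + sin θ • z.2) (-sin θ • z.1 + cos θ • z.2) := by
    rw [fderiv_coord]; simp only [psi, rot_apply]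
  rw [e]; exact h2

lemma seg {h : V3 → ℝ} (hd : Differentiable ℝ h) (hc : ∀ j, Continuous (pd j h)) (z : V3 × V3) : 
    (h z.1 - h z.2) ^ 2 ≤ π / 2 * ∫ θ in Set.Ioc 0 (π/2), psi h (rot θ z) ^ 2 := by
  have hcont : Continuous (fun θ => psi h (rot θ z)) := (psi_cont hc).comp (rot_cont z)
  have e : ∫ θ in Set.Ioc 0 (π/2), psi h (rot θ z) = h z.2 - h z.1 := by
    rw [← intervalIntegral.integral_of_le (by positivity)]
    rw [intervalIntegral.integral_eq_sub_of_hasDerivAt (fun θ _ => curve hd z θ) (hcont.intervalIntegrable _ _)]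
    simp [rot_apply]
  have i1 : IntegrableOn (fun θ => psi h (rot θ z)) (Set.Ioc 0 (π/2)) := (hcont.continuousOn.integrableOn_Icc).mono_set Set.Ioc_subset_Icc_self
  have i2 : IntegrableOn (fun θ => psi h (rot θ z) ^ 2) (Set.Ioc 0 (π/2)) := ((hcont.pow 2).continuousOn.integrableOn_Icc).mono_set Set.Ioc_subset_Icc_self
  have hF : HI (volume.restrict (Set.Ioc 0 (π/2))) (fun θ => psi h (rot θ z)) (h z.2 - h z.1) := ⟨i1, e⟩
  have hA : HI (volume.restrict (Set.Ioc 0 (π/2))) (fun _ : ℝ => (1:ℝ)) (π/2) := ⟨by simp, by simp; positivity⟩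
  have := cs hF hA (HI.mk' i2) fun t => Filter.Eventually.of_forall fun θ => by nlinarith [sq_nonneg (t - psi h (rot θ z))]
  linarith

/-- Gaussian pair weight -/
def mm (z : V3 × V3) : ℝ := gs 1 0 z.1 * gs 1 0 z.2
lemma mm_pos (z) : 0 < mm z := mul_pos (gs_pos _ _ _) (gs_pos _ _ _)
lemma mm_rot (θ : ℝ) (z) : mm (rot θ z) = mm z := by
  unfold mm gs
  rw [← Real.exp_add, ← Real.exp_add]
  congr 1
  simp only [rot_apply, sub_zero, nsq]
  simp
  have := Real.cos_sq_add_sin_sq θ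
  linear_combination (-(z.1 0 ^ 2 + z.1 1 ^ 2 + z.1 2 ^ 2 + z.2 0 ^ 2 + z.2 1 ^ 2 + z.2 2 ^ 2)) * this
lemma mm_cont : Continuous mm := by
  have := (gs_differentiable 1 0).continuous
  unfold mm; fun_prop

lemma poin_pair {h : V3 → ℝ} (hd : Differentiable ℝ h) (hc : ∀ j, Continuous (pd j h)) {a k : ℝ}
    (ha : HI (volume.prod volume) (fun z : V3 × V3 => mm z * (h z.1 - h z.2) ^ 2) a)
    (hk : HI (volume.prod volume) (fun z : V3 × V3 => mm z * psi h z ^ 2) k) : a ≤ 4 * k := by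
  have k0 : 0 ≤ k := hk.nonneg fun z => by have := mm_pos z; positivity
  have cK : Continuous (fun z : V3 × V3 => mm z * psi h z ^ 2) := mm_cont.mul ((psi_cont hc).pow 2)
  have e1 := ofReal_integral_eq_lintegral_ofReal ha.1 (Filter.Eventually.of_forall fun z => by have := mm_pos z; simp only [Pi.zero_apply]; positivity)
  have e2 := ofReal_integral_eq_lintegral_ofReal hk.1 (Filter.Eventually.of_forall fun z => by have := mm_pos z; simp only [Pi.zero_apply]; positivity)
  rw [ha.2] at e1
  rw [hk.2] at e2
  have p1 : ∀ z : V3 × V3, ENNReal.ofReal (mm z * (h z.1 - h z.2) ^ 2) ≤ 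
      ENNReal.ofReal (π/2) * ∫⁻ θ in Set.Ioc 0 (π/2), ENNReal.ofReal (mm (rot θ z) * psi h (rot θ z) ^ 2) := by
    intro z
    have c2 : Continuous (fun θ => mm (rot θ z) * psi h (rot θ z) ^ 2) := cK.comp (rot_cont z)
    have i2 : IntegrableOn (fun θ => mm (rot θ z) * psi h (rot θ z) ^ 2) (Set.Ioc 0 (π/2)) := (c2.continuousOn.integrableOn_Icc).mono_set Set.Ioc_subset_Icc_self
    rw [← ofReal_integral_eq_lintegral_ofReal i2 (Filter.Eventually.of_forall fun θ => by have := mm_pos (rot θ z); simp only [Pi.zero_apply]; positivity), ← ENNReal.ofReal_mul (by positivity)]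
    apply ENNReal.ofReal_le_ofReal
    simp only [mm_rot]
    rw [integral_const_mul]
    have := mul_le_mul_of_nonneg_left (seg hd hc z) (mm_pos z).le
    linarith
  have meas : Measurable (fun z : V3 × V3 => ENNReal.ofReal (mm z * psi h z ^ 2)) := cK.measurable.ennreal_ofReal
  have key : ENNReal.ofReal a ≤ ENNReal.ofReal (π/2) * (ENNReal.ofReal (π/2) * ENNReal.ofReal k) := by
    rw [e1]
    refine (lintegral_mono p1).trans ?_
    rw [lintegral_const_mul' _ _ ENNReal.ofReal_ne_top]
    gcongr
    rw [lintegral_lintegral_swap]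
    · rw [lintegral_congr (fun θ => rot_lint θ _ meas), ← e2, lintegral_const]
      simp only [Measure.restrict_apply_univ, Real.volume_Ioc, sub_zero]
      rw [mul_comm]
    · have : Measurable (fun p : (V3 × V3) × ℝ => ENNReal.ofReal (mm (rot p.2 p.1) * psi h (rot p.2 p.1) ^ 2)) := (cK.comp rot_cont2).measurable.ennreal_ofReal
      exact this.aemeasurable
  rw [← ENNReal.ofReal_mul (by positivity), ← ENNReal.ofReal_mul (by positivity), ENNReal.ofReal_le_ofReal_iff (by positivity)] at key
  have : π / 2 ≤ 2 := by linarith [Real.pi_le_four]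
  have h1 : π / 2 * k ≤ 2 * k := by gcongr
  have h2 : π / 2 * (π / 2 * k) ≤ 2 * (2 * k) := by gcongr
  linarith


lemma gs_mul (a b : ℝ) (v : V3) : gs a 0 v * gs b 0 v = gs (a + b) 0 v := by
  unfold gs; rw [← Real.exp_add]; congr 1; ring

lemma HI.prod_mul {p q : V3 → ℝ} (hp : Dec p) (hq : Dec q) : HI (volume.prod volume) (fun z : V3 × V3 => p z.1 * q z.2) ((∫ x, p x) * ∫ x, q x) :=
  ⟨hp.integrable.mul_prod hq.integrable, integral_prod_mul p q⟩

/-- the quotient f / gs (1/4) -/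
def hq (f : V3 → ℝ) (v : V3) : ℝ := Real.exp (‖v‖ ^ 2 / 4) * f v

lemma hq_gs (f : V3 → ℝ) (v : V3) : hq f v * gs (1/4) 0 v = f v := by
  unfold hq gs
  rw [mul_right_comm, ← Real.exp_add]
  have : ‖v‖ ^ 2 / 4 + -(1/4) * ‖v - 0‖ ^ 2 = 0 := by rw [sub_zero]; ring
  rw [this, Real.exp_zero, one_mul]

lemma hq_diff {f : V3 → ℝ} (hf : Differentiable ℝ f) : Differentiable ℝ (hq f) := by
  unfold hq
  have : Differentiable ℝ (fun v : V3 => ‖v‖ ^ 2) := by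
    intro v; exact (differentiableAt_id.norm_sq ℝ)
  have h : Differentiable ℝ (fun v : V3 => Real.exp (‖v‖ ^ 2 / 4)) := by fun_prop
  exact h.fun_mul hf

lemma hq_pd {f : V3 → ℝ} (hf : Differentiable ℝ f) (j : Fin 3) : pd j (hq f) = fun v => Real.exp (‖v‖ ^ 2 / 4) * xf f j v := by
  have h1 : (fun v => hq f v * gs (1/4) 0 v) = f := funext (hq_gs f)
  have h2 := pd_mul (hq_diff hf) (gs_differentiable (1/4) 0) j
  rw [h1, pd_gs] at h2
  ext v
  have h3 := congrFun h2 v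
  have h4 := hq_gs f v
  have h5 : Real.exp (‖v‖ ^ 2 / 4) * gs (1/4) 0 v = 1 := by
    have := hq_gs (fun _ => 1) v
    simpa [hq] using this
  simp only [xf, xv]
  rw [h3]
  rw [← h4]
  simp only [PiLp.zero_apply, mul_zero, add_zero, sub_zero]
  linear_combination (-(pd j (hq f) v)) * h5

lemma poin {f : V3 → ℝ} (hf : Dc 2 f) : ∃ c : ℝ, 
    (∫ x, gs 1 0 x) * (∫ v, gs (1/2) 0 v * (f v - c * gs (1/4) 0 v) ^ 2) ≤ 2 * ((∫ v, gs (1/2) 0 v * sq3 (ev (xf f) v)) * ∫ x, gs 1 0 x * ‖x‖ ^ 2) := by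
  have hf1 : Dc 1 f := hf.mono
  have dX : ∀ i, Dec (xf f i) := fun i => xv_dc hf1 (1/2) 0 i
  have d : ∀ a > 0, Dec (gs a 0) := fun a ha => gs_dc 0 ha 0
  have d1 := d 1 (by norm_num)
  have d2 := d (1/2) (by norm_num)
  have d3 := d (3/4) (by norm_num)
  have m1 : Dec (fun v => gs (3/4) 0 v * f v) := d3.mul hf1.1
  have m2 : Dec (fun v => gs (1/2) 0 v * f v ^ 2) := d2.mul hf1.1.sq
  set G := ∫ x, gs 1 0 x with hG
  set F := ∫ v, gs (3/4) 0 v * f v with hF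
  set S := ∫ v, gs (1/2) 0 v * f v ^ 2 with hS
  have G0 : 0 < G := by
    rw [hG]; unfold gs
    simp only [sub_zero]
    have := GaussianFourier.integral_rexp_neg_mul_sq_norm (V := V3) (b := 1) (by norm_num)
    rw [this]; positivity
  have q : ∀ v, hq f v * gs (1/4) 0 v = f v := hq_gs f
  have e1 : ∀ v, gs 1 0 v = gs (1/4) 0 v * gs (1/4) 0 v * gs (1/2) 0 v := fun v => by rw [gs_mul, gs_mul]; norm_num
  have e3 : ∀ v, gs (3/4) 0 v = gs (1/4) 0 v * gs (1/2) 0 v := fun v => by rw [gs_mul]; norm_num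
  have ha : HI (volume.prod volume) (fun z : V3 × V3 => mm z * (hq f z.1 - hq f z.2) ^ 2) (2 * (S * G) - 2 * (F * F)) := by
    refine (((HI.prod_mul m2 d1).add (HI.prod_mul d1 m2)).sub ((HI.prod_mul m1 m1).cmul 2)).congr (fun z => ?_) (by simp only [← hG, ← hF, ← hS]; ring)
    simp only [mm, e3]
    rw [← q z.1, ← q z.2, e1 z.1, e1 z.2]
    ring
  have d4 : Dec (fun v => gs (1/2) 0 v * sq3 (ev (xf f) v)) := d2.mul (sq3_dec dX)
  have d5 : Dec (fun v => gs 1 0 v * ‖v‖ ^ 2) := d1.mul_pg (PG.norm.pow 2)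
  have hb := HI.prod_mul d4 d5
  have hx : ∀ v : V3, Real.exp (‖v‖ ^ 2 / 4) * gs (1/4) 0 v = 1 := fun v => by
    have := hq_gs (fun _ => 1) v
    simpa [hq] using this
  have psie : ∀ z, mm z * psi (hq f) z ^ 2 = gs (1/2) 0 z.1 * gs 1 0 z.2 * (∑ j, z.2 j * xf f j z.1) ^ 2 := by
    intro z
    have : psi (hq f) z = Real.exp (‖z.1‖ ^ 2 / 4) * (∑ j, z.2 j * xf f j z.1) := by
      unfold psi; rw [Finset.mul_sum]
      refine Finset.sum_congr rfl fun j _ => ?_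
      rw [hq_pd hf1.2.1]; ring
    rw [this, mm, e1 z.1]
    have h := hx z.1
    have h2 : (Real.exp (‖z.1‖ ^ 2 / 4) * gs (1/4) 0 z.1) ^ 2 = 1 := by rw [h]; norm_num
    linear_combination (gs (1/2) 0 z.1 * gs 1 0 z.2 * (∑ j, z.2 j * xf f j z.1) ^ 2) * h2
  have dij : ∀ i j : Fin 3, HI (volume.prod volume) _ _ := fun i j => HI.prod_mul (d2.mul ((dX i).mul (dX j))) (d1.mul_pg ((PG.coord i).mul (PG.coord j)))
  have hk0 := HI.sum Finset.univ fun i => HI.sum Finset.univ fun j => dij i j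
  have hk : HI (volume.prod volume) (fun z : V3 × V3 => mm z * psi (hq f) z ^ 2) _ := hk0.congr (fun z => by
    rw [psie]; simp only [Fin.sum_univ_three]; ring) rfl
  have hle := hk.le hb fun z => by
    rw [psie]
    have c : (∑ j, z.2 j * xf f j z.1) ^ 2 ≤ sq3 (ev (xf f) z.1) * ‖z.2‖ ^ 2 := by
      rw [nsq]; unfold sq3; rw [Fin.sum_univ_three]
      simp only [ev]
      nlinarith [sq_nonneg (z.2 0 * xf f 1 z.1 - z.2 1 * xf f 0 z.1), sq_nonneg (z.2 0 * xf f 2 z.1 - z.2 2 * xf f 0 z.1), sq_nonneg (z.2 1 * xf f 2 z.1 - z.2 2 * xf f 1 z.1)]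
    have := mul_pos (gs_pos (1/2) 0 z.1) (gs_pos 1 0 z.2)
    have := mul_le_mul_of_nonneg_left c this.le
    linarith
  have hc : ∀ j, Continuous (pd j (hq f)) := fun j => by
    rw [hq_pd hf1.2.1]
    have := (dX j).1
    exact Continuous.mul (by fun_prop) this
  have key := poin_pair (hq_diff hf1.2.1) hc ha hk
  refine ⟨F / G, ?_⟩
  have hfin : HI volume (fun v => gs (1/2) 0 v * (f v - F / G * gs (1/4) 0 v) ^ 2) (S - F ^ 2 / G) := by
    refine ((m2.hi.sub (m1.hi.cmul (2 * (F / G)))).add (d1.hi.cmul ((F / G) ^ 2))).congr (fun v => ?_) ?_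
    · rw [e3, e1]; ring
    · rw [← hG, ← hF, ← hS]; field_simp; ring
  rw [hfin.2]
  have : G * (S - F ^ 2 / G) = S * G - F * F := by field_simp
  rw [this]
  linarith


lemma xf_sub {f : V3 → ℝ} (hf : Differentiable ℝ f) (c : ℝ) (j v) : xf (fun v => f v - c * gs (1/4) 0 v) j v = xf f j v := by
  have e : (fun v => f v - c * gs (1/4) 0 v) = fun v => f v + (-c) * gs (1/4) 0 v := by ext v; ring
  simp only [xf, xv]
  rw [e, pd_add hf ((gs_differentiable _ _).const_mul _), pd_const_mul, pd_gs]
  simp only [PiLp.zero_apply]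
  ring

lemma gs_le_jp : ∃ C, 0 ≤ C ∧ ∀ v, gs (1/2) 0 v ≤ C * jp 3 v := by
  obtain ⟨C, hC, h⟩ := exp_poly_bdd (a := 1/2) (by norm_num) 3
  refine ⟨C, hC, fun v => ?_⟩
  have h1 := h ‖v‖ (norm_nonneg v)
  have h2 := jb_le v
  have h3 := jb_pos v
  have h4 : gs (1/2) 0 v = Real.exp (-(1/2) * ‖v‖ ^ 2) := by unfold gs; rw [sub_zero]
  have h5 : jb v ^ 3 * gs (1/2) 0 v ≤ C := by
    rw [h4]; refine le_trans ?_ h1; gcongr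
  unfold jp
  rw [inv_pow, ← div_eq_mul_inv, le_div_iff₀ (by positivity)]
  linarith

lemma hardy {f : V3 → ℝ} (hf : Dc 1 f) : ∫ v, jp 1 v * f v ^ 2 ≤ 
    8 * (∫ v, qf v (ev (xf f) v)) + 14 * Real.exp (13/2) * ∫ v, gs (1/2) 0 v * f v ^ 2 := by
  have dX : ∀ i, Dec (xf f i) := fun i => xv_dc hf (1/2) 0 i
  have j1 : Dec (fun v => jp 1 v * f v ^ 2) := (jp_pg 1).mul_dec hf.1.sq
  have j3 : Dec (fun v => jp 3 v * f v ^ 2) := (jp_pg 3).mul_dec hf.1.sq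
  have g1 : Dec (fun v => gs (1/2) 0 v * f v ^ 2) := (gs_dc 0 (by norm_num) 0).mul hf.1.sq
  have r : ∀ v, jp 1 v = jp 3 v * (1 + ‖v‖ ^ 2) := fun v => (jp_rel 1 v).symm
  have U := unc hf 3
  have dw : Dec (fun v => (3 * jp 3 v - ((3:ℕ):ℝ) * (‖v‖ ^ 2 * jp (3+2) v)) * f v ^ 2) :=
    (((PG.const 3).mul (jp_pg 3)).sub ((PG.const _).mul ((PG.norm.pow 2).mul (jp_pg _)))).mul_dec hf.1.sq
  have h1 := j1.hi.le ((((qf_dec dX).hi.cmul 4).add j3.hi).sub (U.cmul 2)) fun v => by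
    have hj := jp_pos 3 v
    have hc := cr_nonneg v (ev (xf f) v)
    have e : 4 * sq3 (ev (xf f) v) = 4 * sq3 (gr f v) + 2 * (2 * f v * ∑ i, v i * pd i f v) + ‖v‖ ^ 2 * f v ^ 2 := by
      rw [nsq]; simp only [sq3, ev, xf, xv, gr, Fin.sum_univ_three]; simp; ring
    have e2 : qf v (fun i => xf f i v) = jp 3 v * (sq3 (ev (xf f) v) + cr v (ev (xf f) v)) := rfl
    rw [e2, r]
    have := mul_nonneg hj.le (sq3_nonneg (gr f v))
    have := mul_nonneg hj.le hc
    have e' := congrArg (fun x => jp 3 v * x) e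
    simp only at e'
    linarith
  have h2 := dw.hi.le (j3.hi.cmul 3) fun v => by
    have := jp_pos 5 v
    have : 0 ≤ 3 * (‖v‖ ^ 2 * jp (3+2) v) * f v ^ 2 := by positivity
    push_cast
    linarith
  have h3 := (j3.hi.cmul 7).le ((j1.hi.cmul (1/2)).add (g1.hi.cmul (7 * Real.exp (13/2)))) fun v => by
    have hj := jp_pos 3 v
    have hj1 := jp_le_one 3 v
    have hg := gs_pos (1/2) 0 v
    have : 7 * jp 3 v ≤ 1/2 * jp 1 v + 7 * Real.exp (13/2) * gs (1/2) 0 v := by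
      rw [r]
      rcases le_total 13 (‖v‖ ^ 2) with h | h
      · have : 0 ≤ 7 * Real.exp (13/2) * gs (1/2) 0 v := by positivity
        nlinarith
      · have : 1 ≤ Real.exp (13/2) * gs (1/2) 0 v := by
          unfold gs; rw [← Real.exp_add]; apply Real.one_le_exp; rw [sub_zero]; linarith
        have : 0 ≤ jp 3 v * (1 + ‖v‖ ^ 2) := by positivity
        linarith
    have := mul_le_mul_of_nonneg_right this (sq_nonneg (f v))
    linarith
  change _ ≤ 4 * (∫ v, qf v (ev (xf f) v)) + _ - _ at h1
  linarith

lemma coer : ∃ C, 0 < C ∧ ∀ f, Dc 2 f → Micro f → TT f ≤ C * B0 f f := by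
  obtain ⟨C0, hC0, H0⟩ := elim_main
  obtain ⟨C1, hC1, H1⟩ := gs_le_jp
  have e0 := ee_nonneg
  set G := ∫ x, gs 1 0 x with hG
  have G0 : 0 < G := by
    rw [hG]; unfold gs
    simp only [sub_zero]
    have := GaussianFourier.integral_rexp_neg_mul_sq_norm (V := V3) (b := 1) (by norm_num)
    rw [this]; positivity
  set κ := ∫ x, gs 1 0 x * ‖x‖ ^ 2 with hκ
  have κ0 : 0 ≤ κ := integral_nonneg fun x => mul_nonneg (gs_pos _ _ _).le (by positivity)
  set E := Real.exp (13/2)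
  have hE : 0 < E := Real.exp_pos _
  set C2 := 8 + 14 * E * (2 * C1 * κ / G) with hC2
  have C20 : 0 < C2 := by positivity
  refine ⟨(2 + 33 * (2 * (1 + ee) * C2)) * C0, by positivity, fun f hf hm => ?_⟩
  have hf1 : Dc 1 f := hf.mono
  have dX : ∀ i, Dec (xf f i) := fun i => xv_dc hf1 (1/2) 0 i
  set A := ∫ v, qf v (ev (xf f) v) with hA
  have hqi : HI volume (fun v => qf v (ev (xf f) v)) A := (qf_dec dX).hi
  have A0 : 0 ≤ A := hqi.nonneg fun v => qf_nonneg _ _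
  obtain ⟨c, hc⟩ := poin hf
  have dgs : Dec (gs (1/2) 0) := gs_dc 0 (by norm_num) 0
  have k1 : ∫ v, gs (1/2) 0 v * sq3 (ev (xf f) v) ≤ C1 * A := by
    refine (dgs.mul (sq3_dec dX)).hi.le (hqi.cmul C1) fun v => ?_
    have a1 := H1 v
    have a2 := sq3_nonneg (ev (xf f) v)
    have a3 := cr_nonneg v (ev (xf f) v)
    have a4 := jp_pos 3 v
    calc _ ≤ (C1 * jp 3 v) * sq3 (ev (xf f) v) := by gcongr
      _ ≤ (C1 * jp 3 v) * (sq3 (ev (xf f) v) + cr v (ev (xf f) v)) := by gcongr; linarith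
      _ = _ := by unfold qf; ring
  set fh : V3 → ℝ := fun v => f v - c * gs (1/4) 0 v with hfh
  have dfh : Dc 1 fh := by
    have e : fh = fun v => f v + (-c) * gs (1/4) 0 v := by ext v; rw [hfh]; ring
    rw [e]; exact hf1.add ((gs_dc 1 (by norm_num) 0).const_mul _)
  have k2 : ∫ v, gs (1/2) 0 v * fh v ^ 2 ≤ 2 * C1 * κ / G * A := by
    have : G * ∫ v, gs (1/2) 0 v * fh v ^ 2 ≤ 2 * ((C1 * A) * κ) := hc.trans (by gcongr)
    rw [div_mul_eq_mul_div, le_div_iff₀ G0]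
    linarith
  have k3 := hardy dfh
  have ex : (fun v => qf v (ev (xf fh) v)) = fun v => qf v (ev (xf f) v) := by
    ext v; congr 1; ext j; exact xf_sub hf1.2.1 c j v
  rw [ex, ← hA] at k3
  set Q := ∫ v, jp 1 v * fh v ^ 2 with hQ
  have k4 : Q ≤ C2 * A := by
    have := mul_le_mul_of_nonneg_left k2 (by positivity : 0 ≤ 14 * E)
    rw [hC2]; linarith
  have hQi : HI volume (fun v => jp 1 v * fh v ^ 2) Q := ((jp_pg 1).mul_dec dfh.1.sq).hi
  have Q0 : 0 ≤ Q := hQi.nonneg fun v => by have := jp_pos 1 v; positivity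
  -- the mean
  set d := c / √c0 with hd
  have c0p : 0 < √c0 := Real.sqrt_pos.2 c0_pos
  have fd : ∀ v, f v = fh v + d * sqmu v := fun v => by
    rw [sqmu_eq, hd]; simp only [hfh]; field_simp; ring
  have mf : HI volume (fun v => sqmu v * f v) 0 := ⟨((sqmu_dc 0).mul hf1.1).integrable, hm.1⟩
  have mfh : HI volume (fun v => sqmu v * fh v) (-d) := by
    refine (mf.sub (hmu.cmul d)).congr (fun v => ?_) (by ring)
    rw [fd v, ← sqmu_sq]; ring
  have k5 : (-d) ^ 2 ≤ ee * Q := by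
    refine cs mfh EE_dec.hi hQi fun t => Filter.Eventually.of_forall fun v => ?_
    have h3 := jb_pos v
    have a : 2 * t * (sqmu v * fh v) ≤ t ^ 2 * (sqmu v ^ 2 * jb v) + jp 1 v * fh v ^ 2 := by
      have : 0 ≤ (jb v)⁻¹ * (t * sqmu v * jb v - fh v) ^ 2 := by positivity
      have e : (jb v)⁻¹ * (t * sqmu v * jb v - fh v) ^ 2 = t ^ 2 * (sqmu v ^ 2 * jb v) + jp 1 v * fh v ^ 2 - 2 * t * (sqmu v * fh v) := by
        unfold jp; field_simp; ring
      linarith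
    have b : sqmu v ^ 2 * jb v ≤ EE v := by
      rw [pow_two, sqmu_sq, mul_comm]; unfold EE
      have := mu0_pos v
      have h6 : jb v ≤ (1 + ‖v‖) ^ 5 := (jb_le v).trans (le_self_pow₀ (by linarith [norm_nonneg v]) (by norm_num))
      gcongr
    have := mul_le_mul_of_nonneg_left b (sq_nonneg t)
    linarith
  have k6 : ∫ v, jp 1 v * f v ^ 2 ≤ 2 * Q + 2 * d ^ 2 * 1 := by
    refine ((jp_pg 1).mul_dec hf1.1.sq).hi.le ((hQi.cmul 2).add (hmu.cmul (2 * d ^ 2))) fun v => ?_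
    have a4 := jp_pos 1 v
    have a5 := jp_le_one 1 v
    have a6 := mu0_pos v
    have a7 : f v ^ 2 ≤ 2 * fh v ^ 2 + 2 * d ^ 2 * mu0 v := by
      rw [fd v, ← sqmu_sq]; nlinarith [sq_nonneg (fh v - d * sqmu v)]
    have a8 : jp 1 v * (2 * d ^ 2 * mu0 v) ≤ 1 * (2 * d ^ 2 * mu0 v) := by gcongr
    have := mul_le_mul_of_nonneg_left a7 a4.le
    linarith
  have k7 : ∫ v, jp 1 v * f v ^ 2 ≤ 2 * (1 + ee) * C2 * A := by
    have : (1 + ee) * Q ≤ (1 + ee) * (C2 * A) := by gcongr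
    linarith
  have k8 : TT f ≤ 2 * A + 33 * ∫ v, jp 1 v * f v ^ 2 := by
    refine (TT_hi hf1).le ((hqi.cmul 2).add (((jp_pg 1).mul_dec hf1.1.sq).hi.cmul 33)) fun v => ?_
    have a1 := qf_add v (ev (xf f) v) (fun i => ((-1/2) * v i - (0 : V3) i) * f v)
    have a2 := qf_lin v (f v) (-1/2) 0 (by norm_num [abs_le]) (by simp)
    have e : gr f v = fun i => ev (xf f) v i + ((-1/2) * v i - (0 : V3) i) * f v := by
      ext i; simp only [gr, ev, xf, xv, PiLp.zero_apply]; ring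
    rw [e]
    linarith
  have k9 := H0 f hf1 hm
  have : (2 + 33 * (2 * (1 + ee) * C2)) * A ≤ (2 + 33 * (2 * (1 + ee) * C2)) * (C0 * B0 f f) := by gcongr
  linarith

/-- **Boundedness and coercivity of the Landau operator linearized at nearby
Maxwellians.** -/
theorem linearized_landau_nearby_maxwellians :
    ∃ η > (0 : ℝ), ∃ c > (0 : ℝ), ∃ C > (0 : ℝ),
      ∀ (ϱ₁ θ₁ : ℝ) (u₁ : V3), 0 < ϱ₁ → 0 < θ₁ →
        |ϱ₁ - 1| + ‖u₁‖ + |θ₁ - 1| ≤ η →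
        ∀ f g : SchwartzMap V3 ℝ,
          -- (a) boundedness
          (|∫ v : V3, Lmu (maxwellian ϱ₁ u₁ θ₁) ⇑f v * g v|
            ≤ C * Real.sqrt (sNormSq ⇑f) * Real.sqrt (sNormSq ⇑g)) ∧
          -- (b) coercivity on the purely microscopic subspace
          (((∫ v : V3, Real.sqrt (mu0 v) * f v) = 0 ∧
            (∀ i : Fin 3, (∫ v : V3, Real.sqrt (mu0 v) * f v * v i) = 0) ∧
            (∫ v : V3, Real.sqrt (mu0 v) * f v * ‖v‖ ^ 2) = 0) →
            (∫ v : V3, Lmu (maxwellian ϱ₁ u₁ θ₁) ⇑f v * f v) ≥ c * sNormSq ⇑f) := by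
  obtain ⟨Ca, hCa, Ha⟩ := bound_a
  obtain ⟨Cp, hCp, Hp⟩ := pert
  obtain ⟨Cc, hCc, Hc⟩ := coer
  obtain ⟨Cs, hCs, Hs⟩ := sNorm_equiv
  refine ⟨min (1 / 96) (1 / (4 * Cc * Cp)), by positivity, 1 / (2 * Cc * Cs), by positivity,
    Ca, hCa, ?_⟩
  intro ϱ₁ θ₁ u₁ _ hθ hη f g
  have hn : min (1 / 96 : ℝ) (1 / (4 * Cc * Cp)) ≤ 1 / 96 := min_le_left _ _
  have hn2 : min (1 / 96 : ℝ) (1 / (4 * Cc * Cp)) ≤ 1 / (4 * Cc * Cp) := min_le_right _ _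
  have hn0 : 0 < min (1 / 96 : ℝ) (1 / (4 * Cc * Cp)) := by positivity
  generalize min (1 / 96 : ℝ) (1 / (4 * Cc * Cp)) = η at hη hn hn2 hn0
  have a1 := abs_nonneg (ϱ₁ - 1)
  have a2 := norm_nonneg u₁
  have a3 := abs_nonneg (θ₁ - 1)
  have hr : |ϱ₁ - 1| ≤ η := by linarith
  have hu : ‖u₁‖ ≤ η := by linarith
  have ht : |θ₁ - 1| ≤ η := by linarith
  have hθ2 : θ₁ < 2 := by
    have := le_abs_self (θ₁ - 1)
    linarith
  have hw : ∀ g : SchwartzMap V3 ℝ, ∫ v : V3, Lmu (maxwellian ϱ₁ u₁ θ₁) ⇑f v * g v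
      = BM ϱ₁ u₁ θ₁ ⇑f ⇑g := fun g =>
    weak_form ϱ₁ u₁ hθ hθ2 (Dc.schwartz 3 f) (Dc.schwartz 1 g)
  refine ⟨?_, ?_⟩
  · rw [hw]
    exact Ha ϱ₁ θ₁ u₁ (hr.trans hn) (hu.trans hn) (ht.trans hn) f g (Dc.schwartz 1 f)
      (Dc.schwartz 1 g)
  · intro hm
    rw [hw]
    have h1 := Hc f (Dc.schwartz 2 f) hm
    have h2 := (abs_le.1 (Hp η ϱ₁ θ₁ u₁ hn0 hn hr hu ht f f (Dc.schwartz 1 f)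
      (Dc.schwartz 1 f))).1
    have h3 := (Hs f (Dc.schwartz 1 f)).2
    have hT := TT_nonneg ⇑f
    have h4 : η * (Cp * (TT ⇑f + TT ⇑f)) ≤ TT ⇑f / (2 * Cc) := by
      calc η * (Cp * (TT ⇑f + TT ⇑f)) ≤ 1 / (4 * Cc * Cp) * (Cp * (TT ⇑f + TT ⇑f)) := by gcongr
        _ = TT ⇑f / (2 * Cc) := by field_simp; ring
    have h5 : TT ⇑f / Cc ≤ B0 ⇑f ⇑f := by
      rw [div_le_iff₀ hCc]; linarith
    have h6 : 1 / (2 * Cc * Cs) * sNormSq ⇑f ≤ TT ⇑f / (2 * Cc) := by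
      calc 1 / (2 * Cc * Cs) * sNormSq ⇑f ≤ 1 / (2 * Cc * Cs) * (Cs * TT ⇑f) := by gcongr
        _ = TT ⇑f / (2 * Cc) := by field_simp
    have h7 : TT ⇑f / Cc = TT ⇑f / (2 * Cc) + TT ⇑f / (2 * Cc) := by field_simp; ring
    linarith
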